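/- For every integer n > 6, if g_n < p_n (ln(n ln n) + ln ln n − ln ln(n ln(n ln n)))/n, then g_n ≤ p_n ((p_n ln n / ln p_n)^{1/n} − 1); that is, this strict bound is a sufficient condition for the Farhadian inequality at index n. -/

import Mathlib

open Real

/-- `p n` is the n-th prime, with `p 1 = 2`, `p 2 = 3`, `p 3 = 5`, ... -/
noncomputable def p (n : ℕ) : ℕ := Nat.nth Nat.Prime (n - 1)

/-- `g n = p (n+1) - p n` is the n-th prime gap, as a real number. -/
noncomputable def g (n : ℕ) : ℝ := (p (n + 1) : ℝ) - (p n : ℝ)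

/-! part P3 -/

namespace Hadamard

open Complex Filter Topology Metric

/-- multiplicity -/
noncomputable def ord (f : ℂ → ℂ) (z : ℂ) : ℕ := analyticOrderNatAt f z

lemma order_ne_top {f : ℂ → ℂ} (hf : Differentiable ℂ f) {w : ℂ} (hw : f w ≠ 0) (z : ℂ) :
    analyticOrderAt f z ≠ ⊤ := by
  intro h
  rw [analyticOrderAt_eq_top] at h
  have h1 : AnalyticOnNhd ℂ f Set.univ := fun x _ => hf.analyticAt x
  have h2 := h1.eqOn_zero_of_preconnected_of_eventuallyEq_zero isPreconnected_univ (Set.mem_univ z) h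
  exact hw (h2 (Set.mem_univ w))

lemma ord_eq_zero_iff {f : ℂ → ℂ} (hf : Differentiable ℂ f) {w : ℂ} (hw : f w ≠ 0) (z : ℂ) :
    ord f z = 0 ↔ f z ≠ 0 := by
  have h0 := order_ne_top hf hw z
  have h1 : analyticOrderAt f z = 0 ↔ f z ≠ 0 := (hf.analyticAt z).analyticOrderAt_eq_zero
  rw [← h1, ← Nat.cast_analyticOrderNatAt h0]
  simp [ord]

lemma factor_one {f : ℂ → ℂ} (hf : Differentiable ℂ f) {w : ℂ} (hw : f w ≠ 0) (ρ : ℂ) :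
    ∃ g : ℂ → ℂ, Differentiable ℂ g ∧ g ρ ≠ 0 ∧ ∀ z, f z = (z - ρ) ^ ord f ρ * g z := by
  classical
  obtain ⟨g, hg, hg0, hfg⟩ := ((hf.analyticAt ρ).analyticOrderAt_ne_top).1 (order_ne_top hf hw ρ)
  change ∀ᶠ z in 𝓝 ρ, f z = (z - ρ) ^ ord f ρ • g z at hfg
  set k := ord f ρ with hk
  let G : ℂ → ℂ := Function.update (fun z => f z / (z - ρ) ^ k) ρ (g ρ)
  have hG1 : ∀ z, z ≠ ρ → G z = f z / (z - ρ) ^ k := fun z hz => by simp [G, hz]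
  have hG0 : G ρ = g ρ := by simp [G]
  have hne : ∀ z, z ≠ ρ → (z - ρ) ^ k ≠ 0 := fun z hz => pow_ne_zero _ (sub_ne_zero.2 hz)
  refine ⟨G, ?_, by rw [hG0]; exact hg0, ?_⟩
  · intro z
    by_cases hz : z = ρ
    · subst hz
      refine hg.differentiableAt.congr_of_eventuallyEq ?_
      filter_upwards [hfg] with x hx
      by_cases hxz : x = z
      · rw [hxz, hG0]
      · rw [hG1 x hxz, hx, smul_eq_mul, mul_div_cancel_left₀ _ (hne x hxz)]
    · have : DifferentiableAt ℂ (fun z => f z / (z - ρ) ^ k) z :=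
        (hf z).div (by fun_prop) (hne z hz)
      refine this.congr_of_eventuallyEq ?_
      filter_upwards [isOpen_ne.mem_nhds hz] with x hx
      exact hG1 x hx
  · intro z
    by_cases hz : z = ρ
    · subst hz
      rw [hG0]
      have := hfg.self_of_nhds
      simpa using this
    · rw [hG1 z hz]; field_simp [hne z hz]

lemma factor_finset {f : ℂ → ℂ} (hf : Differentiable ℂ f) {w : ℂ} (hw : f w ≠ 0) (S : Finset ℂ) :
    ∃ g : ℂ → ℂ, Differentiable ℂ g ∧ (∀ ρ ∈ S, g ρ ≠ 0) ∧
      ∀ z, f z = (∏ ρ ∈ S, (z - ρ) ^ ord f ρ) * g z := by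
  classical
  induction S using Finset.induction_on with
  | empty => exact ⟨f, hf, by simp, by simp⟩
  | insert ρ S hρ ih =>
    obtain ⟨g, hg, hgS, hfg⟩ := ih
    have hgw : g w ≠ 0 := by
      intro h; apply hw; rw [hfg, h, mul_zero]
    obtain ⟨G, hG, hGρ, hgG⟩ := factor_one hg hgw ρ
    have hord : ord g ρ = ord f ρ := by
      have hP : Differentiable ℂ (fun z => ∏ ρ ∈ S, (z - ρ) ^ ord f ρ) := by fun_prop
      have e : f = (fun z => ∏ ρ ∈ S, (z - ρ) ^ ord f ρ) * g := by
        funext z; exact hfg z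
      have hPρ : (fun z => ∏ ρ ∈ S, (z - ρ) ^ ord f ρ) ρ ≠ 0 := by
        simp only
        rw [Finset.prod_ne_zero_iff]
        intro a ha
        exact pow_ne_zero _ (sub_ne_zero.2 (fun h => hρ (h ▸ ha)))
      have h2 := analyticOrderNatAt_mul (hP.analyticAt ρ) (hg.analyticAt ρ)
        (order_ne_top hP hPρ ρ) (order_ne_top hg hgw ρ)
      rw [← e] at h2
      have h3 := (ord_eq_zero_iff hP hPρ ρ).2 hPρ
      change analyticOrderNatAt g ρ = analyticOrderNatAt f ρ
      change analyticOrderNatAt _ _ = 0 at h3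
      rw [h2, h3, zero_add]
    refine ⟨G, hG, ?_, ?_⟩
    · intro a ha
      rw [Finset.mem_insert] at ha
      rcases ha with rfl | ha
      · exact hGρ
      · intro h; apply hgS a ha; rw [hgG, h, mul_zero]
    · intro z
      rw [Finset.prod_insert hρ, hfg z, hgG z, hord]; ring

lemma zeros_finite {f : ℂ → ℂ} (hf : Differentiable ℂ f) {w : ℂ} (hw : f w ≠ 0) (R : ℝ) :
    {z : ℂ | f z = 0 ∧ ‖z‖ ≤ R}.Finite := by
  by_contra h
  have hinf : {z : ℂ | f z = 0 ∧ ‖z‖ ≤ R}.Infinite := h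
  obtain ⟨x, -, hx⟩ := hinf.exists_accPt_of_subset_isCompact (isCompact_closedBall (0:ℂ) R)
    (fun z hz => by simpa using hz.2)
  have h1 : AnalyticOnNhd ℂ f Set.univ := fun x _ => hf.analyticAt x
  have h2 : ∃ᶠ z in 𝓝[≠] x, f z = 0 := by
    rw [accPt_iff_frequently_nhdsNE] at hx
    exact hx.mono (fun z hz => hz.1)
  exact hw (h1.eqOn_zero_of_preconnected_of_frequently_eq_zero isPreconnected_univ
    (Set.mem_univ x) h2 (Set.mem_univ w))

/-- zeros in ball -/
noncomputable def zset {f : ℂ → ℂ} (hf : Differentiable ℂ f) {w : ℂ} (hw : f w ≠ 0) (R : ℝ) :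
    Finset ℂ := (zeros_finite hf hw R).toFinset

lemma mem_zset {f : ℂ → ℂ} (hf : Differentiable ℂ f) {w : ℂ} (hw : f w ≠ 0) (R : ℝ) (z : ℂ) :
    z ∈ zset hf hw R ↔ f z = 0 ∧ ‖z‖ ≤ R := by simp [zset]

/-- Normalised factorization with bound -/
lemma factor_bound {f : ℂ → ℂ} (hf : Differentiable ℂ f) (h0 : f 0 = 1) {R B : ℝ} (hR : 0 < R)
    (hB : ∀ z, ‖z‖ ≤ 3 * R → ‖f z‖ ≤ Real.exp B) :
    ∃ G : ℂ → ℂ, Differentiable ℂ G ∧ G 0 = 1 ∧ (∀ z, ‖z‖ ≤ R → G z ≠ 0) ∧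
      (∀ z, f z = (∏ ρ ∈ zset hf (w := 0) (by simp [h0]) R, (1 - z / ρ) ^ ord f ρ) * G z) ∧
      (∀ z, ‖z‖ ≤ 3 * R → ‖G z‖ ≤ Real.exp B) ∧
      (∑ ρ ∈ zset hf (w := 0) (by simp [h0]) R, (ord f ρ : ℝ)) * Real.log 2 ≤ B := by
  have hw : f 0 ≠ 0 := by simp [h0]
  set S := zset hf hw R with hS
  have hmem : ∀ ρ ∈ S, f ρ = 0 ∧ ‖ρ‖ ≤ R := fun ρ h => (mem_zset hf hw R ρ).1 h
  have hne : ∀ ρ ∈ S, ρ ≠ 0 := fun ρ h h' => hw (h' ▸ (hmem ρ h).1)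
  obtain ⟨g, hg, hgS, hfg⟩ := factor_finset hf hw S
  let c : ℂ := ∏ ρ ∈ S, (-ρ) ^ ord f ρ
  have hc : c ≠ 0 := by
    rw [Finset.prod_ne_zero_iff]; intro ρ h; exact pow_ne_zero _ (neg_ne_zero.2 (hne ρ h))
  have hfG : ∀ z, f z = (∏ ρ ∈ S, (1 - z / ρ) ^ ord f ρ) * (c * g z) := by
    intro z
    rw [hfg z, ← mul_assoc, ← Finset.prod_mul_distrib]
    congr 1
    refine Finset.prod_congr rfl fun ρ h => ?_
    rw [← mul_pow]
    congr 1
    field_simp [hne ρ h]; ring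
  have hG0 : c * g 0 = 1 := by
    have := hfG 0
    simp [h0] at this
    exact this.symm
  set N := ∑ ρ ∈ S, ord f ρ with hN
  have hlow : ∀ z, ‖z‖ = 3 * R → (2:ℝ) ^ N ≤ ‖∏ ρ ∈ S, (1 - z / ρ) ^ ord f ρ‖ := by
    intro z hz
    rw [norm_prod, hN, ← Finset.prod_pow_eq_pow_sum]
    refine Finset.prod_le_prod (fun _ _ => by positivity) fun ρ h => ?_
    rw [norm_pow]
    refine pow_le_pow_left₀ (by norm_num) ?_ _
    have hρ : 0 < ‖ρ‖ := norm_pos_iff.2 (hne ρ h)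
    have h1 : 3 ≤ ‖z / ρ‖ := by
      rw [norm_div, hz, le_div_iff₀ hρ]; nlinarith [(hmem ρ h).2]
    have h2 := norm_sub_norm_le (z / ρ) 1
    rw [norm_sub_rev] at h2
    rw [norm_one] at h2
    linarith
  have hGd : Differentiable ℂ (fun z => c * g z) := by fun_prop
  have hsph : ∀ z, ‖z‖ = 3 * R → ‖c * g z‖ ≤ Real.exp B / 2 ^ N := by
    intro z hz
    rw [le_div_iff₀ (by positivity)]
    calc ‖c * g z‖ * 2 ^ N ≤ ‖c * g z‖ * ‖∏ ρ ∈ S, (1 - z / ρ) ^ ord f ρ‖ := by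
          gcongr; exact hlow z hz
      _ = ‖f z‖ := by rw [hfG z, norm_mul (∏ ρ ∈ S, (1 - z / ρ) ^ ord f ρ), mul_comm]
      _ ≤ _ := hB z hz.le
  have hball : ∀ z, ‖z‖ ≤ 3 * R → ‖c * g z‖ ≤ Real.exp B / 2 ^ N := by
    intro z hz
    refine Complex.norm_le_of_forall_mem_frontier_norm_le (U := ball (0:ℂ) (3 * R))
      (f := fun z => c * g z) isBounded_ball hGd.diffContOnCl ?_ ?_
    · intro x hx
      rw [frontier_ball _ (by positivity)] at hx
      exact hsph x (by simpa using hx)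
    · rw [closure_ball _ (by positivity)]; simpa using hz
  refine ⟨fun z => c * g z, hGd, hG0, ?_, hfG, ?_, ?_⟩
  · intro z hz h
    have hgz : g z = 0 := by simpa [hc] using h
    by_cases hzS : z ∈ S
    · exact hgS z hzS hgz
    · apply hzS; rw [hS, mem_zset]; exact ⟨by rw [hfg z, hgz, mul_zero], hz⟩
  · intro z hz
    refine (hball z hz).trans (div_le_self (Real.exp_pos _).le (one_le_pow₀ (by norm_num)))
  · have h1 := hball 0 (by simp; positivity)
    rw [hG0, norm_one, le_div_iff₀ (by positivity), one_mul] at h1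
    have h2 := Real.log_le_log (by positivity) h1
    rw [Real.log_exp, Real.log_pow] at h2
    have h3 : (∑ ρ ∈ S, (ord f ρ : ℝ)) = (N : ℝ) := by rw [hN]; push_cast; rfl
    rw [h3]; exact h2

section main

lemma count_le {f : ℂ → ℂ} (hf : Differentiable ℂ f) (h0 : f 0 = 1) {C : ℝ}
    (hgrow : ∀ k : ℕ, ∀ z : ℂ, ‖z‖ ≤ 3 * 4 ^ k → ‖f z‖ ≤ Real.exp (C * 8 ^ k)) (k : ℕ) (T : Finset ℂ) (hT : ∀ z ∈ T, ‖z‖ ≤ 4 ^ k) :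
    ∑ z ∈ T, (ord f z : ℝ) ≤ 2 * (C * 8 ^ k) := by
  have hw : f 0 ≠ 0 := by simp [h0]
  obtain ⟨G, -, -, -, -, -, h⟩ := factor_bound hf h0 (R := 4 ^ k) (B := C * 8 ^ k) (by positivity)
    (hgrow k)
  have h1 : ∑ z ∈ T, (ord f z : ℝ) ≤ ∑ ρ ∈ zset hf hw (4 ^ k), (ord f ρ : ℝ) := by
    classical
    rw [← Finset.sum_filter_ne_zero]
    refine Finset.sum_le_sum_of_subset_of_nonneg ?_ (fun _ _ _ => by positivity)
    intro z hz
    rw [Finset.mem_filter] at hz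
    rw [mem_zset]
    refine ⟨?_, hT z hz.1⟩
    by_contra hne
    exact hz.2 (by exact_mod_cast (ord_eq_zero_iff hf hw z).2 hne)
  have h2 : 0.6931 < Real.log 2 := by linarith [Real.log_two_gt_d9]
  have h3 : 0 ≤ ∑ ρ ∈ zset hf hw (4 ^ k), (ord f ρ : ℝ) := Finset.sum_nonneg (fun _ _ => by positivity)
  nlinarith

lemma summable_ord {f : ℂ → ℂ} (hf : Differentiable ℂ f) (h0 : f 0 = 1) {C : ℝ} (hC : 0 < C)
    (hgrow : ∀ k : ℕ, ∀ z : ℂ, ‖z‖ ≤ 3 * 4 ^ k → ‖f z‖ ≤ Real.exp (C * 8 ^ k)) : Summable (fun z : ℂ => (ord f z : ℝ) / (1 + ‖z‖ ^ 2)) := by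
  refine summable_of_sum_le (c := 64 * C) (fun _ => by positivity) fun T => ?_
  obtain ⟨N, hN⟩ : ∃ N : ℕ, ∀ z ∈ T, ‖z‖ ≤ 4 ^ N := by
    obtain ⟨M, hM⟩ : ∃ M : ℝ, ∀ z ∈ T, ‖z‖ ≤ M := by
      refine ⟨∑ z ∈ T, ‖z‖, fun z hz => ?_⟩
      exact Finset.single_le_sum (f := fun z : ℂ => ‖z‖) (fun _ _ => by positivity) hz
    obtain ⟨N, hN⟩ := pow_unbounded_of_one_lt M (by norm_num : (1:ℝ) < 4)
    exact ⟨N, fun z hz => (hM z hz).trans hN.le⟩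
  classical
  have key : ∀ z ∈ T, (1:ℝ) / (1 + ‖z‖ ^ 2) ≤
      ∑ k ∈ Finset.range (N + 1), if ‖z‖ ≤ 4 ^ k then 16 / (16:ℝ) ^ k else 0 := by
    intro z hz
    have hex : ∃ k : ℕ, ‖z‖ ≤ 4 ^ k := ⟨N, hN z hz⟩
    set k := Nat.find hex with hk
    have hk1 : ‖z‖ ≤ 4 ^ k := Nat.find_spec hex
    have hk2 : k ≤ N := Nat.find_min' hex (hN z hz)
    have h1 : (1:ℝ) / (1 + ‖z‖ ^ 2) ≤ 16 / (16:ℝ) ^ k := by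
      rcases Nat.eq_zero_or_pos k with h | h
      · rw [h, pow_zero, div_one, div_le_iff₀ (by positivity)]; nlinarith [sq_nonneg ‖z‖]
      · obtain ⟨j, hj⟩ := Nat.exists_eq_succ_of_ne_zero h.ne'
        have h3 : ¬ ‖z‖ ≤ 4 ^ j := Nat.find_min hex (by omega)
        push Not at h3
        rw [hj, div_le_div_iff₀ (by positivity) (by positivity), pow_succ]
        have : (16:ℝ) ^ j = (4 ^ j) ^ 2 := by rw [← pow_mul, mul_comm, pow_mul]; norm_num
        have h4 : ((4:ℝ) ^ j) ^ 2 ≤ ‖z‖ ^ 2 := by gcongr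
        nlinarith
    refine h1.trans ?_
    have := Finset.single_le_sum (f := fun k : ℕ => if ‖z‖ ≤ 4 ^ k then 16 / (16:ℝ) ^ k else 0)
      (s := Finset.range (N + 1)) (fun _ _ => by split_ifs <;> positivity)
      (Finset.mem_range.2 (Nat.lt_succ_of_le hk2))
    simpa [hk1] using this
  calc ∑ z ∈ T, (ord f z : ℝ) / (1 + ‖z‖ ^ 2)
      ≤ ∑ z ∈ T, ∑ k ∈ Finset.range (N + 1),
          (ord f z : ℝ) * (if ‖z‖ ≤ 4 ^ k then 16 / (16:ℝ) ^ k else 0) := by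
        refine Finset.sum_le_sum fun z hz => ?_
        rw [← Finset.mul_sum, div_eq_mul_one_div]
        exact mul_le_mul_of_nonneg_left (key z hz) (by positivity)
    _ = ∑ k ∈ Finset.range (N + 1), (16 / (16:ℝ) ^ k) *
          ∑ z ∈ T.filter (fun z => ‖z‖ ≤ 4 ^ k), (ord f z : ℝ) := by
        rw [Finset.sum_comm]
        refine Finset.sum_congr rfl fun k _ => ?_
        rw [Finset.mul_sum, Finset.sum_filter]
        refine Finset.sum_congr rfl fun z _ => ?_
        split_ifs <;> ring
    _ ≤ ∑ k ∈ Finset.range (N + 1), (16 / (16:ℝ) ^ k) * (2 * (C * 8 ^ k)) := by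
        refine Finset.sum_le_sum fun k _ => ?_
        refine mul_le_mul_of_nonneg_left ?_ (by positivity)
        exact count_le hf h0 hgrow k _ (fun z hz => (Finset.mem_filter.1 hz).2)
    _ = 32 * C * ∑ k ∈ Finset.range (N + 1), (1 / 2 : ℝ) ^ k := by
        rw [Finset.mul_sum]
        refine Finset.sum_congr rfl fun k _ => ?_
        have : (16:ℝ) ^ k = 8 ^ k * 2 ^ k := by rw [← mul_pow]; norm_num
        rw [this, one_div, inv_pow]; field_simp; ring
    _ ≤ 64 * C := by
        have : ∑ k ∈ Finset.range (N + 1), (1 / 2 : ℝ) ^ k ≤ 2 := sum_geometric_two_le _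
        nlinarith

/-- approximate formula at level k -/
lemma approx_logDeriv {f : ℂ → ℂ} (hf : Differentiable ℂ f) (h0 : f 0 = 1) {C : ℝ} (hC : 0 < C)
    (hgrow : ∀ k : ℕ, ∀ z : ℂ, ‖z‖ ≤ 3 * 4 ^ k → ‖f z‖ ≤ Real.exp (C * 8 ^ k)) (k : ℕ) (s w : ℂ) (hs : f s ≠ 0) (hw' : f w ≠ 0)
    (hs1 : ‖s‖ < 4 ^ k / 8) (hw1 : ‖w‖ < 4 ^ k / 8) :
    ‖logDeriv f s - logDeriv f w - ∑ ρ ∈ zset hf (w := 0) (by simp [h0]) (4 ^ k),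
      (ord f ρ : ℂ) * (1 / (s - ρ) - 1 / (w - ρ))‖ ≤ 64 * C * (1 / 2) ^ k * ‖s - w‖ := by
  have hw : f 0 ≠ 0 := by simp [h0]
  set R : ℝ := 4 ^ k with hRdef
  have hR : 0 < R := by positivity
  set B : ℝ := C * 8 ^ k with hBdef
  have hBpos : 0 < B := by positivity
  obtain ⟨G, hG, hG0, hGne, hfG, hGb, -⟩ := factor_bound hf h0 hR (hgrow k)
  set S := zset hf hw R with hS
  have hLD : DifferentiableOn ℂ (logDeriv G) (ball 0 R) := by
    intro z hz
    have : G z ≠ 0 := hGne z (by simpa using (mem_ball_zero_iff.1 hz).le)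
    refine DifferentiableAt.differentiableWithinAt ?_
    unfold logDeriv
    exact ((hG.analyticAt z).deriv.differentiableAt).div (hG z) this
  obtain ⟨L, hL0, hL⟩ := hLD.isExactOn_ball.with_val_at 0 0
  -- exp L = G
  have hexp : ∀ z ∈ ball (0:ℂ) R, Complex.exp (L z) = G z := by
    have hne : ∀ z ∈ ball (0:ℂ) R, G z ≠ 0 := fun z hz => hGne z (mem_ball_zero_iff.1 hz).le
    have hd : ∀ z ∈ ball (0:ℂ) R, HasDerivAt (fun z => Complex.exp (L z) / G z) 0 z := by
      intro z hz
      have h1 := ((hL z hz).cexp).div (hG z).hasDerivAt (hne z hz)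
      refine HasDerivAt.congr_deriv (f := fun z => Complex.exp (L z) / G z) h1 ?_
      have := hne z hz
      rw [logDeriv_apply]
      field_simp
      ring
    intro z hz
    have this := (convex_ball (0:ℂ) R).is_const_of_fderivWithin_eq_zero (𝕜 := ℂ)
      (f := fun z => Complex.exp (L z) / G z)
      (fun z hz => (hd z hz).differentiableAt.differentiableWithinAt)
      (fun z hz => by
        rw [fderivWithin_of_isOpen isOpen_ball hz]
        ext; simp [(hd z hz).hasFDerivAt.fderiv]) hz (mem_ball_self hR)
    simp only [hL0, hG0, Complex.exp_zero, div_one] at this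
    rwa [div_eq_one_iff_eq (hne z hz)] at this
  have hLre : Set.MapsTo L (ball 0 R) {z | z.re ≤ B} := by
    intro z hz
    have h1 := hGb z (by have := mem_ball_zero_iff.1 hz; linarith)
    rw [← hexp z hz, Complex.norm_exp] at h1
    exact Real.exp_le_exp.1 h1
  have hLdiff : DifferentiableOn ℂ L (ball 0 R) :=
    fun z hz => (hL z hz).differentiableAt.differentiableWithinAt
  have hL1 : ∀ z, ‖z‖ ≤ R / 2 → ‖L z‖ ≤ 2 * B := by
    intro z hz
    have hz' : z ∈ ball (0:ℂ) R := mem_ball_zero_iff.2 (by linarith)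
    refine (borelCaratheodory_zero hBpos hLdiff hLre hR hz' hL0).trans ?_
    rw [div_le_iff₀ (by linarith)]
    nlinarith
  have hL2 : ∀ z, ‖z‖ ≤ R / 4 → ‖logDeriv G z‖ ≤ 8 * B / R := by
    intro z hz
    have hz' : z ∈ ball (0:ℂ) R := mem_ball_zero_iff.2 (by linarith)
    have hsub : closedBall z (R / 4) ⊆ ball (0:ℂ) R := by
      intro x hx
      rw [mem_closedBall, dist_eq_norm] at hx
      rw [mem_ball_zero_iff]
      have := norm_sub_norm_le x z
      linarith
    have h1 := norm_deriv_le_of_forall_mem_sphere_norm_le (c := z) (R := R / 4) (C := 2 * B)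
      (f := L) (by positivity) ((hLdiff.mono hsub).diffContOnCl_ball subset_rfl) (by
        intro x hx
        rw [mem_sphere, dist_eq_norm] at hx
        have := norm_sub_norm_le x z
        exact hL1 x (by linarith))
    rw [(hL z hz').deriv] at h1
    refine h1.trans (le_of_eq ?_)
    field_simp; ring
  have hL3 : ∀ z, ‖z‖ ≤ R / 8 → ‖deriv (logDeriv G) z‖ ≤ 64 * B / R ^ 2 := by
    intro z hz
    have hsub : closedBall z (R / 8) ⊆ ball (0:ℂ) R := by
      intro x hx
      rw [mem_closedBall, dist_eq_norm] at hx
      rw [mem_ball_zero_iff]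
      have := norm_sub_norm_le x z
      linarith
    have h1 := norm_deriv_le_of_forall_mem_sphere_norm_le (c := z) (R := R / 8) (C := 8 * B / R)
      (f := logDeriv G) (by positivity) ((hLD.mono hsub).diffContOnCl_ball subset_rfl) (by
        intro x hx
        rw [mem_sphere, dist_eq_norm] at hx
        have := norm_sub_norm_le x z
        exact hL2 x (by linarith))
    refine h1.trans (le_of_eq ?_)
    field_simp; ring
  have hmv : ‖logDeriv G s - logDeriv G w‖ ≤ 64 * B / R ^ 2 * ‖s - w‖ := by
    refine (convex_ball (0:ℂ) (R / 8)).norm_image_sub_le_of_norm_deriv_le (𝕜 := ℂ)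
      (f := logDeriv G) (fun z hz => ?_) (fun z hz => hL3 z (mem_ball_zero_iff.1 hz).le)
      (mem_ball_zero_iff.2 hw1) (mem_ball_zero_iff.2 hs1)
    have hz' : z ∈ ball (0:ℂ) R := by
      have := mem_ball_zero_iff.1 hz
      exact mem_ball_zero_iff.2 (by linarith)
    exact hLD.differentiableAt (isOpen_ball.mem_nhds hz')
  have hρne : ∀ ρ ∈ S, ρ ≠ 0 := fun ρ h h' => hw (h' ▸ ((mem_zset hf hw R ρ).1 h).1)
  have hformula : ∀ z, f z ≠ 0 → ‖z‖ < R →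
      logDeriv f z = ∑ ρ ∈ S, (ord f ρ : ℂ) * (1 / (z - ρ)) + logDeriv G z := by
    intro z hz hzR
    have e : f = fun z => (∏ ρ ∈ S, (1 - z / ρ) ^ ord f ρ) * G z := funext hfG
    have hzρ : ∀ ρ ∈ S, z ≠ ρ := fun ρ h h' => hz (h' ▸ ((mem_zset hf hw R ρ).1 h).1)
    have hfac : ∀ ρ ∈ S, (1 - z / ρ) ≠ 0 := by
      intro ρ h h'
      have := hρne ρ h
      rw [sub_eq_zero, eq_comm, div_eq_one_iff_eq this] at h'
      exact hzρ ρ h h'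
    have hP : (∏ ρ ∈ S, (1 - z / ρ) ^ ord f ρ) ≠ 0 :=
      Finset.prod_ne_zero_iff.2 fun ρ h => pow_ne_zero _ (hfac ρ h)
    conv_lhs => rw [e]
    rw [logDeriv_mul (f := fun z => ∏ ρ ∈ S, (1 - z / ρ) ^ ord f ρ) z hP (hGne z hzR.le)
      (by fun_prop) (hG z), logDeriv_prod (f := fun ρ z => (1 - z / ρ) ^ ord f ρ) (fun ρ h => pow_ne_zero _ (hfac ρ h)) (fun ρ h => by fun_prop)]
    congr 1
    refine Finset.sum_congr rfl fun ρ h => ?_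
    have h3 : logDeriv (fun z : ℂ => (1 - z / ρ) ^ ord f ρ) z
        = ord f ρ * logDeriv (fun z : ℂ => 1 - z / ρ) z :=
      logDeriv_fun_pow (f := fun z : ℂ => 1 - z / ρ) (by fun_prop) _
    rw [h3, logDeriv_apply]
    have hd : deriv (fun z : ℂ => 1 - z / ρ) z = -1 / ρ := by
      have : HasDerivAt (fun z : ℂ => 1 - z / ρ) (-(1 / ρ)) z :=
        ((hasDerivAt_id z).div_const ρ).const_sub 1
      rw [this.deriv]; ring
    rw [hd]
    have h5 := hρne ρ h
    have h6 : z - ρ ≠ 0 := sub_ne_zero.2 (hzρ ρ h)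
    have h7 : (ρ - z) ≠ 0 := sub_ne_zero.2 (hzρ ρ h).symm
    have h8 : 1 - z / ρ = (ρ - z) / ρ := by field_simp
    rw [h8]
    congr 1
    field_simp
    ring
  rw [hformula s hs (by linarith), hformula w hw' (by linarith)]
  have : ∀ a b c d e : ℂ, (a + b) - (c + d) - e = (a - c - e) + (b - d) := by intros; ring
  rw [this, ← Finset.sum_sub_distrib, ← Finset.sum_sub_distrib]
  rw [Finset.sum_eq_zero (fun ρ _ => by ring), zero_add]
  refine hmv.trans (le_of_eq ?_)
  have h16 : ((4:ℝ) ^ k) ^ 2 = 8 ^ k * 2 ^ k := by rw [← pow_mul, mul_comm, pow_mul, ← mul_pow]; norm_num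
  rw [hRdef, hBdef, h16, one_div, inv_pow]
  field_simp

lemma dist_zeros {f : ℂ → ℂ} (hf : Differentiable ℂ f) (s : ℂ) (hs : f s ≠ 0) :
    ∃ K : ℝ, 0 < K ∧ ∀ z, f z = 0 → 1 + ‖z‖ ≤ K * ‖s - z‖ := by
  have h1 : {z | f z ≠ 0} ∈ 𝓝 s := (isOpen_ne.preimage hf.continuous).mem_nhds hs
  obtain ⟨d, hd, hball⟩ := Metric.mem_nhds_iff.1 h1
  refine ⟨(1 + ‖s‖) / d + 1, by positivity, fun z hz => ?_⟩
  have h2 : d ≤ ‖s - z‖ := by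
    by_contra hlt
    push Not at hlt
    have : z ∈ ball s d := by rw [mem_ball, dist_eq_norm, norm_sub_rev]; exact hlt
    exact hball this hz
  have h3 : ‖z‖ ≤ ‖s‖ + ‖s - z‖ := by
    have := norm_sub_norm_le z s
    rw [norm_sub_rev] at this; linarith
  have h4 : 1 + ‖s‖ ≤ (1 + ‖s‖) / d * ‖s - z‖ := by
    rw [div_mul_eq_mul_div, le_div_iff₀ hd]
    gcongr
  nlinarith

lemma summable_diff {f : ℂ → ℂ} (hf : Differentiable ℂ f) (h0 : f 0 = 1) {C : ℝ} (hC : 0 < C)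
    (hgrow : ∀ k : ℕ, ∀ z : ℂ, ‖z‖ ≤ 3 * 4 ^ k → ‖f z‖ ≤ Real.exp (C * 8 ^ k)) (s w : ℂ) (hs : f s ≠ 0) (hw : f w ≠ 0) :
    Summable (fun z : ℂ => ‖(ord f z : ℂ) * (1 / (s - z) - 1 / (w - z))‖) := by
  obtain ⟨K, hK, hK'⟩ := dist_zeros hf s hs
  obtain ⟨M, hM, hM'⟩ := dist_zeros hf w hw
  refine Summable.of_nonneg_of_le (fun _ => norm_nonneg _) (fun z => ?_)
    ((summable_ord hf h0 hC hgrow).mul_left (K * M * ‖w - s‖))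
  by_cases hz : f z = 0
  · have hsz : s - z ≠ 0 := fun h => hs (by rw [sub_eq_zero.1 h, hz])
    have hwz : w - z ≠ 0 := fun h => hw (by rw [sub_eq_zero.1 h, hz])
    have e : 1 / (s - z) - 1 / (w - z) = (w - s) / ((s - z) * (w - z)) := by field_simp; ring
    rw [e, norm_mul, norm_div, norm_mul, Complex.norm_natCast]
    have p1 : 0 < ‖s - z‖ := norm_pos_iff.2 hsz
    have p2 : 0 < ‖w - z‖ := norm_pos_iff.2 hwz
    have h1 := hK' z hz
    have h2 := hM' z hz
    have h3 : 1 + ‖z‖ ^ 2 ≤ K * M * (‖s - z‖ * ‖w - z‖) := by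
      have h4 : (1 + ‖z‖) * (1 + ‖z‖) ≤ (K * ‖s - z‖) * (M * ‖w - z‖) := by gcongr
      nlinarith [norm_nonneg z]
    have h5 : ‖w - s‖ / (‖s - z‖ * ‖w - z‖) ≤ K * M * ‖w - s‖ / (1 + ‖z‖ ^ 2) := by
      rw [div_le_div_iff₀ (by positivity) (by positivity)]
      nlinarith [mul_le_mul_of_nonneg_left h3 (norm_nonneg (w - s))]
    calc (ord f z : ℝ) * (‖w - s‖ / (‖s - z‖ * ‖w - z‖))
        ≤ ord f z * (K * M * ‖w - s‖ / (1 + ‖z‖ ^ 2)) := by gcongr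
      _ = _ := by ring
  · rw [(ord_eq_zero_iff hf hs z).2 hz]; simp

theorem logDeriv_sub {f : ℂ → ℂ} (hf : Differentiable ℂ f) (h0 : f 0 = 1) {C : ℝ} (hC : 0 < C)
    (hgrow : ∀ k : ℕ, ∀ z : ℂ, ‖z‖ ≤ 3 * 4 ^ k → ‖f z‖ ≤ Real.exp (C * 8 ^ k)) (s w : ℂ) (hs : f s ≠ 0) (hw : f w ≠ 0) :
    HasSum (fun z : ℂ => (ord f z : ℂ) * (1 / (s - z) - 1 / (w - z)))
      (logDeriv f s - logDeriv f w) := by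
  have hsum := summable_diff hf h0 hC hgrow s w hs hw
  have h00 : f 0 ≠ 0 := by simp [h0]
  set F : ℂ → ℂ := fun z : ℂ => (ord f z : ℂ) * (1 / (s - z) - 1 / (w - z)) with hF
  have hFz : ∀ z, f z ≠ 0 → F z = 0 := fun z hz => by
    simp [hF, (ord_eq_zero_iff hf hs z).2 hz]
  have h1 : Tendsto (fun k : ℕ => ∑ ρ ∈ zset hf h00 (4 ^ k), F ρ) atTop (𝓝 (∑' z, F z)) := by
    have h2 : ∀ k : ℕ, ∑ ρ ∈ zset hf h00 (4 ^ k), F ρ = ∑' z, (if ‖z‖ ≤ 4 ^ k then F z else 0) := by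
      intro k
      rw [tsum_eq_sum (s := zset hf h00 (4 ^ k))]
      · refine Finset.sum_congr rfl fun z hz => ?_
        rw [if_pos ((mem_zset _ _ _ _).1 hz).2]
      · intro z hz
        split_ifs with hzk
        · refine hFz z fun h => hz ((mem_zset _ _ _ _).2 ⟨h, hzk⟩)
        · rfl
    simp_rw [h2]
    refine tendsto_tsum_of_dominated_convergence hsum ?_ ?_
    · intro z
      refine tendsto_const_nhds.congr' ?_
      obtain ⟨N, hN⟩ := pow_unbounded_of_one_lt ‖z‖ (by norm_num : (1:ℝ) < 4)
      filter_upwards [eventually_ge_atTop N] with k hk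
      rw [if_pos (hN.le.trans (pow_le_pow_right₀ (by norm_num) hk))]
    · refine Eventually.of_forall fun k z => ?_
      split_ifs
      · exact le_rfl
      · rw [norm_zero]; exact norm_nonneg _
  have h3 : Tendsto (fun k : ℕ => ∑ ρ ∈ zset hf h00 (4 ^ k), F ρ) atTop
      (𝓝 (logDeriv f s - logDeriv f w)) := by
    rw [tendsto_iff_norm_sub_tendsto_zero]
    have h4 : Tendsto (fun k : ℕ => 64 * C * (1 / 2 : ℝ) ^ k * ‖s - w‖) atTop (𝓝 0) := by
      have := tendsto_pow_atTop_nhds_zero_of_lt_one (by norm_num : (0:ℝ) ≤ 1 / 2) (by norm_num)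
      simpa using (this.const_mul (64 * C)).mul_const ‖s - w‖
    refine squeeze_zero' (Eventually.of_forall fun _ => norm_nonneg _) ?_ h4
    obtain ⟨N, hN⟩ := pow_unbounded_of_one_lt (8 * (‖s‖ + ‖w‖)) (by norm_num : (1:ℝ) < 4)
    filter_upwards [eventually_ge_atTop N] with k hk
    have h5 : 8 * (‖s‖ + ‖w‖) < 4 ^ k := hN.trans_le (pow_le_pow_right₀ (by norm_num) hk)
    have h6 := norm_nonneg s
    have h7 := norm_nonneg w
    rw [norm_sub_rev]
    exact approx_logDeriv hf h0 hC hgrow k s w hs hw (by linarith) (by linarith)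
  have := tendsto_nhds_unique h1 h3
  rw [← this]
  exact hsum.of_norm.hasSum

end main
end Hadamard

/-! part P31 -/

namespace ZetaXi
open Complex Filter Topology Metric MeasureTheory

lemma bound_mellin {F : ℝ → ℂ} {a b : ℝ} (ha : MellinConvergent F a) (hb : MellinConvergent F b) :
    ∃ A : ℝ, 0 < A ∧ ∀ s : ℂ, a ≤ s.re → s.re ≤ b → ‖mellin F s‖ ≤ A := by
  have hna := ha.norm
  have hnb := hb.norm
  refine ⟨(∫ t in Set.Ioi (0:ℝ), (‖(t:ℂ) ^ ((a:ℂ) - 1) • F t‖ + ‖(t:ℂ) ^ ((b:ℂ) - 1) • F t‖)) + 1,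
    ?_, ?_⟩
  · have : 0 ≤ ∫ t in Set.Ioi (0:ℝ), (‖(t:ℂ) ^ ((a:ℂ) - 1) • F t‖ + ‖(t:ℂ) ^ ((b:ℂ) - 1) • F t‖) :=
      integral_nonneg fun t => by positivity
    linarith
  · intro s h1 h2
    have hle : ‖mellin F s‖ ≤ ∫ t in Set.Ioi (0:ℝ), (‖(t:ℂ) ^ ((a:ℂ) - 1) • F t‖ + ‖(t:ℂ) ^ ((b:ℂ) - 1) • F t‖) := by
      unfold mellin
      refine norm_integral_le_of_norm_le (hna.add hnb) ?_
      refine (ae_restrict_iff' measurableSet_Ioi).2 (Eventually.of_forall fun t ht => ?_)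
      have ht : 0 < t := ht
      try simp only [Pi.add_apply]
      rw [norm_smul, norm_smul, norm_smul, Complex.norm_cpow_eq_rpow_re_of_pos ht,
        Complex.norm_cpow_eq_rpow_re_of_pos ht, Complex.norm_cpow_eq_rpow_re_of_pos ht, ← add_mul]
      refine mul_le_mul_of_nonneg_right ?_ (norm_nonneg _)
      simp only [sub_re, one_re, ofReal_re]
      rcases le_total t 1 with h | h
      · have := Real.rpow_le_rpow_of_exponent_ge ht h (by linarith : a - 1 ≤ s.re - 1)
        have h3 : 0 ≤ t ^ (b - 1) := by positivity
        linarith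
      · have := Real.rpow_le_rpow_of_exponent_le h (by linarith : s.re - 1 ≤ b - 1)
        have h3 : 0 ≤ t ^ (a - 1) := by positivity
        linarith
    linarith

lemma bound_strip : ∃ A : ℝ, 0 < A ∧ ∀ s : ℂ, -3 ≤ s.re → s.re ≤ 4 →
    ‖completedRiemannZeta₀ s‖ ≤ A := by
  have hconv : ∀ s, MellinConvergent (HurwitzZeta.hurwitzEvenFEPair 0).f_modif s := fun s =>
    (HurwitzZeta.hurwitzEvenFEPair 0).isStrongFEPair_toStrongFEPair.hasMellin s |>.1
  obtain ⟨A, hA, h⟩ := bound_mellin (hconv (((-3/2 : ℝ)):ℂ)) (hconv ((2:ℝ):ℂ))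
  refine ⟨A, hA, fun s h1 h2 => ?_⟩
  have e : completedRiemannZeta₀ s = mellin (HurwitzZeta.hurwitzEvenFEPair 0).f_modif (s / 2) / 2 := rfl
  have hre : (s / 2).re = s.re / 2 := by simp
  have := h (s / 2) (by rw [hre]; linarith) (by rw [hre]; linarith)
  rw [e, norm_div]
  simp only [Complex.norm_ofNat]
  have := norm_nonneg (mellin (HurwitzZeta.hurwitzEvenFEPair 0).f_modif (s / 2))
  linarith

lemma norm_Gamma_le {s : ℂ} (hs : 0 < s.re) : ‖Complex.Gamma s‖ ≤ Real.Gamma s.re := by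
  rw [Complex.Gamma_eq_integral hs, Complex.GammaIntegral, Real.Gamma_eq_integral hs]
  refine norm_integral_le_of_norm_le (Real.GammaIntegral_convergent hs) ?_
  refine (ae_restrict_iff' measurableSet_Ioi).2 (Eventually.of_forall fun t ht => ?_)
  have ht : 0 < t := ht
  rw [norm_mul, Complex.norm_cpow_eq_rpow_re_of_pos ht, Complex.norm_real,
    Real.norm_of_nonneg (Real.exp_pos _).le]
  simp

lemma Gamma_le_exp {x : ℝ} (hx : 2 ≤ x) (k : ℕ) (hk : x ≤ 3 / 2 * 4 ^ k) :
    Real.Gamma x ≤ Real.exp (6 * 8 ^ k) := by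
  set N := ⌈x⌉₊ with hN
  have h1 : x ≤ N := Nat.le_ceil x
  have h2 : (N : ℝ) < x + 1 := Nat.ceil_lt_add_one (by linarith)
  have h3 : Real.Gamma x ≤ Real.Gamma (N + 1) :=
    Real.Gamma_strictMonoOn_Ici.monotoneOn (by simpa using hx) (by simp; linarith) (by linarith)
  rw [Real.Gamma_nat_eq_factorial] at h3
  have h4 : (N.factorial : ℝ) ≤ (N:ℝ) ^ N := by exact_mod_cast Nat.factorial_le_pow N
  have h41 : (1:ℝ) ≤ 4 ^ k := one_le_pow₀ (by norm_num)
  have hN3 : (N : ℝ) ≤ 3 * 4 ^ k := by linarith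
  have hN0 : (0:ℝ) < N := by linarith
  have h5 : Real.log N ≤ 2 * 2 ^ k := by
    have h6 : Real.log N ≤ Real.log (3 * 4 ^ k) := Real.log_le_log hN0 hN3
    rw [Real.log_mul (by norm_num) (by positivity), Real.log_pow] at h6
    have h7 : Real.log 3 ≤ 2 := by
      have := Real.log_le_sub_one_of_pos (by norm_num : (0:ℝ) < 3); linarith
    have h8 : Real.log 4 ≤ 2 := by
      have : (4:ℝ) = 2 ^ 2 := by norm_num
      rw [this, Real.log_pow]; push_cast; linarith [Real.log_two_lt_d9]
    have h9 : (k : ℝ) + 1 ≤ 2 ^ k := by exact_mod_cast (Nat.lt_two_pow_self (n := k))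
    have h10 : (0:ℝ) ≤ k := by positivity
    nlinarith
  have h6 : (N:ℝ) ^ N ≤ Real.exp (6 * 8 ^ k) := by
    have : (N:ℝ) ^ N = Real.exp (N * Real.log N) := by
      rw [mul_comm, Real.exp_mul, Real.exp_log hN0, Real.rpow_natCast]
    rw [this]
    refine Real.exp_le_exp.2 ?_
    have h8 : (8:ℝ) ^ k = 4 ^ k * 2 ^ k := by rw [← mul_pow]; norm_num
    calc (N:ℝ) * Real.log N ≤ (3 * 4 ^ k) * (2 * 2 ^ k) := by
          gcongr
      _ = 6 * 8 ^ k := by rw [h8]; ring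
  linarith

lemma norm_zeta_le {s : ℂ} (hs : 2 ≤ s.re) : ‖∑' n : ℕ, 1 / (n : ℂ) ^ s‖ ≤ ∑' n : ℕ, 1 / (n:ℝ) ^ 2 := by
  have hsum : Summable (fun n : ℕ => 1 / (n:ℝ) ^ 2) := Real.summable_one_div_nat_pow.2 (by norm_num)
  refine tsum_of_norm_bounded hsum.hasSum fun n => ?_
  rcases Nat.eq_zero_or_pos n with h | h
  · subst h
    have : s ≠ 0 := fun h => by rw [h] at hs; simp at hs; linarith
    simp [this]
  · rw [norm_div, norm_one, Complex.norm_natCast_cpow_of_pos h, ← Real.rpow_natCast]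
    have : (1:ℝ) ≤ n := by exact_mod_cast h
    refine one_div_le_one_div_of_le (by positivity) ?_
    exact Real.rpow_le_rpow_of_exponent_le this (by exact_mod_cast hs)

lemma bound_right : ∃ A : ℝ, 0 < A ∧ ∀ (k : ℕ) (s : ℂ), 4 ≤ s.re → ‖s‖ ≤ 3 * 4 ^ k →
    ‖completedRiemannZeta₀ s‖ ≤ A * Real.exp (6 * 8 ^ k) := by
  have hZ0 : 0 ≤ ∑' n : ℕ, 1 / (n:ℝ) ^ 2 := tsum_nonneg fun _ => by positivity
  refine ⟨(∑' n : ℕ, 1 / (n:ℝ) ^ 2) + 2, by linarith, fun k s h1 h2 => ?_⟩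
  have hre := (Complex.abs_re_le_norm s)
  rw [abs_of_nonneg (by linarith)] at hre
  have e1 := completedRiemannZeta_eq s
  have e2 := completedZeta_eq_tsum_of_one_lt_re (s := s) (by linarith)
  have e3 : completedRiemannZeta₀ s = completedRiemannZeta s + 1 / s + 1 / (1 - s) := by rw [e1]; ring
  have hE : 1 ≤ Real.exp (6 * 8 ^ k) := Real.one_le_exp (by positivity)
  have n1 : ‖1 / s‖ ≤ 1 := by
    rw [norm_div, norm_one, div_le_one (by linarith)]; linarith
  have n2 : ‖1 / (1 - s)‖ ≤ 1 := by
    have : 1 ≤ ‖1 - s‖ := by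
      have := Complex.abs_re_le_norm (1 - s)
      rw [abs_of_nonpos (by simp; linarith)] at this
      simp at this; linarith
    rw [norm_div, norm_one, div_le_one (by linarith)]; linarith
  have n3 : ‖completedRiemannZeta s‖ ≤ (∑' n : ℕ, 1 / (n:ℝ) ^ 2) * Real.exp (6 * 8 ^ k) := by
    rw [e2, norm_mul, norm_mul]
    have hhalf : (s / 2).re = s.re / 2 := by simp
    have g1 : ‖Complex.Gamma (s / 2)‖ ≤ Real.exp (6 * 8 ^ k) := by
      refine (norm_Gamma_le (by rw [hhalf]; linarith)).trans ?_
      rw [hhalf]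
      exact Gamma_le_exp (by linarith) k (by linarith)
    have g2 : ‖(π:ℂ) ^ (-s / 2)‖ ≤ 1 := by
      rw [Complex.norm_cpow_eq_rpow_re_of_pos Real.pi_pos]
      refine Real.rpow_le_one_of_one_le_of_nonpos (by linarith [Real.pi_gt_three]) ?_
      simp; linarith
    have g3 := norm_zeta_le (s := s) (by linarith)
    calc _ ≤ 1 * Real.exp (6 * 8 ^ k) * ∑' n : ℕ, 1 / (n:ℝ) ^ 2 := by gcongr
      _ = _ := by ring
  rw [e3]
  calc _ ≤ ‖completedRiemannZeta s‖ + ‖1 / s‖ + ‖1 / (1 - s)‖ := norm_add₃_le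
    _ ≤ _ := by nlinarith

/-- The entire function `s (s-1) Λ(s)`. -/
noncomputable def Xi (s : ℂ) : ℂ := 1 - s * (1 - s) * completedRiemannZeta₀ s

lemma differentiable_Xi : Differentiable ℂ Xi := by
  unfold Xi
  have := differentiable_completedZeta₀
  fun_prop

lemma Xi_zero : Xi 0 = 1 := by simp [Xi]

lemma Xi_one_sub (s : ℂ) : Xi (1 - s) = Xi s := by
  simp only [Xi, completedRiemannZeta₀_one_sub]; ring

lemma Xi_eq {s : ℂ} (h0 : s ≠ 0) (h1 : s ≠ 1) : Xi s = s * (s - 1) * completedRiemannZeta s := by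
  rw [completedRiemannZeta_eq, Xi]
  have : 1 - s ≠ 0 := sub_ne_zero.2 (Ne.symm h1)
  field_simp
  ring

lemma growth : ∃ C : ℝ, 0 < C ∧ ∀ k : ℕ, ∀ z : ℂ, ‖z‖ ≤ 3 * 4 ^ k → ‖Xi z‖ ≤ Real.exp (C * 8 ^ k) := by
  obtain ⟨A, hA, hstrip⟩ := bound_strip
  obtain ⟨B, hB, hright⟩ := bound_right
  have key : ∀ k : ℕ, ∀ z : ℂ, ‖z‖ ≤ 3 * 4 ^ (k+1) → -3 ≤ z.re →
      ‖completedRiemannZeta₀ z‖ ≤ (A + B) * Real.exp (48 * 8 ^ k) := by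
    intro k z hz hre
    have hE : 1 ≤ Real.exp (48 * 8 ^ k) := Real.one_le_exp (by positivity)
    rcases le_total z.re 4 with h | h
    · refine (hstrip z hre h).trans ?_
      nlinarith
    · refine (hright (k+1) z h hz).trans ?_
      rw [show (6:ℝ) * 8 ^ (k+1) = 48 * 8 ^ k by rw [pow_succ]; ring]
      nlinarith
  refine ⟨Real.log (1 + 12 * (A + B)) + 51, ?_, fun k z hz => ?_⟩
  · have := Real.log_nonneg (by linarith : (1:ℝ) ≤ 1 + 12 * (A + B)); linarith
  have hE : 1 ≤ Real.exp (48 * 8 ^ k) := Real.one_le_exp (by positivity)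
  have h41 : (1:ℝ) ≤ 4 ^ k := one_le_pow₀ (by norm_num)
  have h81 : (1:ℝ) ≤ 8 ^ k := one_le_pow₀ (by norm_num)
  have hz1 : ‖1 - z‖ ≤ 4 * 4 ^ k := by
    have := norm_sub_le (1:ℂ) z
    rw [norm_one] at this; linarith
  have hΛ : ‖completedRiemannZeta₀ z‖ ≤ (A + B) * Real.exp (48 * 8 ^ k) := by
    rcases le_total (-3) z.re with h | h
    · exact key k z (by rw [pow_succ]; linarith) h
    · rw [← completedRiemannZeta₀_one_sub]
      refine key k (1 - z) (by rw [pow_succ]; linarith) ?_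
      simp; linarith
  have h16 : (4:ℝ) ^ k * 4 ^ k ≤ Real.exp (3 * 8 ^ k) := by
    have e : (4:ℝ) ^ k * 4 ^ k = 16 ^ k := by rw [← mul_pow]; norm_num
    rw [e]
    have h16' : (16:ℝ) ≤ Real.exp 3 := by
      have := Real.exp_one_gt_d9
      have h : Real.exp 3 = Real.exp 1 ^ 3 := by rw [← Real.exp_nat_mul]; norm_num
      rw [h]
      calc (16:ℝ) ≤ 2.7 ^ 3 := by norm_num
        _ ≤ _ := by gcongr; linarith
    calc (16:ℝ) ^ k ≤ Real.exp 3 ^ k := by gcongr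
      _ = Real.exp (3 * k) := by rw [← Real.exp_nat_mul, mul_comm]
      _ ≤ _ := by
        refine Real.exp_le_exp.2 ?_
        have h9 : (k : ℝ) ≤ 8 ^ k := by
          exact_mod_cast (Nat.lt_pow_self (n := k) (by norm_num : 1 < 8)).le
        linarith
  have hE3 : 1 ≤ Real.exp (3 * 8 ^ k) := Real.one_le_exp (by positivity)
  have hc : (0:ℝ) < 1 + 12 * (A + B) := by linarith
  calc ‖Xi z‖ ≤ 1 + ‖z‖ * ‖1 - z‖ * ‖completedRiemannZeta₀ z‖ := by
        unfold Xi
        refine (norm_sub_le _ _).trans ?_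
        rw [norm_one, norm_mul, norm_mul]
    _ ≤ 1 + (3 * 4 ^ k) * (4 * 4 ^ k) * ((A + B) * Real.exp (48 * 8 ^ k)) := by gcongr
    _ = 1 + 12 * (A + B) * ((4 ^ k * 4 ^ k) * Real.exp (48 * 8 ^ k)) := by ring
    _ ≤ 1 + 12 * (A + B) * (Real.exp (3 * 8 ^ k) * Real.exp (48 * 8 ^ k)) := by gcongr
    _ ≤ (1 + 12 * (A + B)) * (Real.exp (3 * 8 ^ k) * Real.exp (48 * 8 ^ k)) := by
        have : 1 ≤ Real.exp (3 * 8 ^ k) * Real.exp (48 * 8 ^ k) := one_le_mul_of_one_le_of_one_le hE3 hE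
        nlinarith
    _ = Real.exp (Real.log (1 + 12 * (A + B)) + 51 * 8 ^ k) := by
        rw [Real.exp_add, Real.exp_log hc, ← Real.exp_add]; ring_nf
    _ ≤ _ := by
        refine Real.exp_le_exp.2 ?_
        have := Real.log_nonneg (by linarith : (1:ℝ) ≤ 1 + 12 * (A + B))
        nlinarith

end ZetaXi

/-! part P32 -/

namespace ZetaXi
open Complex Filter Topology Metric MeasureTheory

lemma Xi_ne_zero_of_one_le_re {s : ℂ} (hs : 1 ≤ s.re) : Xi s ≠ 0 := by
  by_cases h1 : s = 1
  · rw [h1, ← sub_zero (1:ℂ), Xi_one_sub, Xi_zero]; exact one_ne_zero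
  have h0 : s ≠ 0 := fun h => by rw [h] at hs; simp at hs; linarith
  rw [Xi_eq h0 h1]
  have hz := riemannZeta_ne_zero_of_one_le_re hs
  have hG : Gammaℝ s ≠ 0 := Gammaℝ_ne_zero_of_re_pos (by linarith)
  rw [riemannZeta_def_of_ne_zero h0] at hz
  have : completedRiemannZeta s ≠ 0 := fun h => hz (by rw [h, zero_div])
  exact mul_ne_zero (mul_ne_zero h0 (sub_ne_zero.2 h1)) this

lemma Xi_zero_re {s : ℂ} (hs : Xi s = 0) : 0 < s.re ∧ s.re < 1 := by
  constructor
  · by_contra h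
    push Not at h
    apply Xi_ne_zero_of_one_le_re (s := 1 - s) (by simp; linarith)
    rw [Xi_one_sub, hs]
  · by_contra h
    push Not at h
    exact Xi_ne_zero_of_one_le_re h hs

lemma Xi_zero_iff {s : ℂ} (h1 : 0 < s.re) (h2 : s.re < 1) : Xi s = 0 ↔ riemannZeta s = 0 := by
  have hs0 : s ≠ 0 := fun h => by rw [h] at h1; simp at h1
  have hs1 : s ≠ 1 := fun h => by rw [h] at h2; simp at h2
  have hG : Gammaℝ s ≠ 0 := Gammaℝ_ne_zero_of_re_pos h1
  rw [Xi_eq hs0 hs1, riemannZeta_def_of_ne_zero hs0]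
  simp [hs0, sub_ne_zero.2 hs1, hG]

lemma Xi_conj_zero {s : ℂ} (hs : Xi s = 0) : Xi (starRingEnd ℂ s) = 0 := by
  obtain ⟨h1, h2⟩ := Xi_zero_re hs
  rw [Xi_zero_iff (by simpa using h1) (by simpa using h2), riemannZeta_conj,
    (Xi_zero_iff h1 h2).1 hs, map_zero]

/-- multiplicity of zeros of Xi -/
noncomputable def mu (z : ℂ) : ℕ := Hadamard.ord Xi z

lemma mu_eq_zero_iff (z : ℂ) : mu z = 0 ↔ Xi z ≠ 0 :=
  Hadamard.ord_eq_zero_iff differentiable_Xi (w := 0) (by rw [Xi_zero]; exact one_ne_zero) z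

lemma mu_pos {z : ℂ} (hz : Xi z = 0) : 1 ≤ mu z :=
  Nat.one_le_iff_ne_zero.2 fun h => (mu_eq_zero_iff z).1 h hz

lemma summable_mu : Summable (fun z : ℂ => (mu z : ℝ) / (1 + ‖z‖ ^ 2)) := by
  obtain ⟨C, hC, h⟩ := growth
  exact Hadamard.summable_ord differentiable_Xi Xi_zero hC h

lemma logDeriv_one_sub (s : ℂ) : logDeriv Xi (1 - s) = - logDeriv Xi s := by
  have h : HasDerivAt Xi (deriv Xi (1 - s)) (1 - s) := (differentiable_Xi _).hasDerivAt
  have h2 : HasDerivAt (fun z : ℂ => 1 - z) (-1) s := by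
    simpa using (hasDerivAt_id s).const_sub 1
  have h3 := h.comp s h2
  have e : Xi ∘ (fun z : ℂ => 1 - z) = Xi := funext fun z => Xi_one_sub z
  rw [e] at h3
  have h4 := h3.deriv
  rw [logDeriv_apply, logDeriv_apply, Xi_one_sub, h4]; ring

theorem hasSum_H {s : ℂ} (hs : Xi s ≠ 0) :
    HasSum (fun z : ℂ => (mu z : ℂ) * (1 / (s - z) + 1 / (s - 1 + z))) (2 * logDeriv Xi s) := by
  obtain ⟨C, hC, h⟩ := growth
  have hs' : Xi (1 - s) ≠ 0 := by rwa [Xi_one_sub]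
  have := Hadamard.logDeriv_sub differentiable_Xi Xi_zero hC h s (1 - s) hs hs'
  rw [logDeriv_one_sub] at this
  convert! this using 1
  · funext z
    have e : (1 - s - z) = -(s - 1 + z) := by ring
    rw [e, div_neg, sub_neg_eq_add]; rfl
  · ring

lemma Hterm_re_nonneg {s z : ℂ} (hs : 1 ≤ s.re) (hz : Xi z = 0) :
    0 ≤ (1 / (s - z)).re ∧ 0 ≤ (1 / (s - 1 + z)).re := by
  obtain ⟨h1, h2⟩ := Xi_zero_re hz
  constructor
  · rw [one_div, Complex.inv_re]
    exact div_nonneg (by simp; linarith) (Complex.normSq_nonneg _)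
  · rw [one_div, Complex.inv_re]
    exact div_nonneg (by simp; linarith) (Complex.normSq_nonneg _)

lemma hasSum_H_re {s : ℂ} (hs : 1 ≤ s.re) :
    HasSum (fun z : ℂ => (mu z : ℝ) * ((1 / (s - z)).re + (1 / (s - 1 + z)).re))
      (2 * (logDeriv Xi s).re) := by
  have h := Complex.hasSum_re (hasSum_H (Xi_ne_zero_of_one_le_re hs))
  convert! h using 1
  · funext z
    rw [← Complex.ofReal_natCast, Complex.re_ofReal_mul, Complex.add_re]
  · rw [show (2:ℂ) = ((2:ℝ):ℂ) by simp, Complex.re_ofReal_mul]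

/-- formula for `H` on `Re s > 1` -/
lemma logDeriv_Xi_eq {s : ℂ} (hs : 1 < s.re) :
    logDeriv Xi s = 1 / s + 1 / (s - 1) - Real.log π / 2 + digamma (s / 2) / 2
      - LSeries (fun n => (ArithmeticFunction.vonMangoldt n : ℂ)) s := by
  have h0 : s ≠ 0 := fun h => by rw [h] at hs; simp at hs; linarith
  have h1 : s ≠ 1 := fun h => by rw [h] at hs; simp at hs
  have hz : riemannZeta s ≠ 0 := riemannZeta_ne_zero_of_one_le_re hs.le
  have hGne : Complex.Gamma (s / 2) ≠ 0 := Complex.Gamma_ne_zero_of_re_pos (by simp; linarith)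
  have hpine : (π:ℂ) ≠ 0 := by exact_mod_cast Real.pi_ne_zero
  have hpow : (π:ℂ) ^ (-s / 2) ≠ 0 := by simp [Complex.cpow_eq_zero_iff, hpine]
  have e : Xi =ᶠ[𝓝 s] fun s => (s * (s - 1)) * ((π:ℂ) ^ (-s / 2) * (Complex.Gamma (s / 2)) * riemannZeta s) := by
    have hopen : {z : ℂ | 1 < z.re} ∈ 𝓝 s := (isOpen_lt continuous_const Complex.continuous_re).mem_nhds hs
    filter_upwards [hopen] with z hz
    have hz : 1 < z.re := hz
    have g0 : z ≠ 0 := fun h => by rw [h] at hz; simp at hz; linarith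
    have g1 : z ≠ 1 := fun h => by rw [h] at hz; simp at hz
    have hG : Gammaℝ z ≠ 0 := Gammaℝ_ne_zero_of_re_pos (by linarith)
    rw [Xi_eq g0 g1, riemannZeta_def_of_ne_zero g0, ← Gammaℝ_def, mul_div_cancel₀ _ hG]
  have dG : HasDerivAt (fun s : ℂ => Complex.Gamma (s / 2)) (deriv Complex.Gamma (s / 2) * (1 / 2)) s := by
    have : DifferentiableAt ℂ Complex.Gamma (s / 2) := by
      refine Complex.differentiableAt_Gamma _ fun m h => ?_
      have := congrArg Complex.re h
      simp at this
      have : (0:ℝ) ≤ m := by positivity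
      linarith
    exact this.hasDerivAt.comp s ((hasDerivAt_id s).div_const 2)
  have dpow : HasDerivAt (fun s : ℂ => (π:ℂ) ^ (-s / 2)) ((π:ℂ) ^ (-s / 2) * Complex.log π * (-1 / 2)) s := by
    refine HasDerivAt.const_cpow ?_ (Or.inl hpine)
    exact ((hasDerivAt_id s).neg).div_const 2
  have dz : DifferentiableAt ℂ riemannZeta s := differentiableAt_riemannZeta h1
  rw [logDeriv_apply, e.deriv_eq, e.self_of_nhds, ← logDeriv_apply
    (f := fun s => (s * (s - 1)) * ((π:ℂ) ^ (-s / 2) * (Complex.Gamma (s / 2)) * riemannZeta s))]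
  rw [logDeriv_mul (f := fun s : ℂ => s * (s - 1)) (g := fun s : ℂ => (π:ℂ) ^ (-s / 2) * (Complex.Gamma (s / 2)) * riemannZeta s) _ (mul_ne_zero h0 (sub_ne_zero.2 h1))
      (mul_ne_zero (mul_ne_zero hpow hGne) hz) (by fun_prop)
      ((dpow.differentiableAt.mul dG.differentiableAt).mul dz),
    logDeriv_mul (f := fun s : ℂ => (π:ℂ) ^ (-s / 2) * (Complex.Gamma (s / 2))) (g := riemannZeta) _ (mul_ne_zero hpow hGne) hz
      (dpow.differentiableAt.mul dG.differentiableAt) dz,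
    logDeriv_mul (f := fun s : ℂ => (π:ℂ) ^ (-s / 2)) (g := fun s : ℂ => Complex.Gamma (s / 2)) _ hpow hGne dpow.differentiableAt dG.differentiableAt,
    logDeriv_mul (f := fun s : ℂ => s) (g := fun s : ℂ => s - 1) _ h0 (sub_ne_zero.2 h1) (by fun_prop) (by fun_prop)]
  have l1 : logDeriv (fun s : ℂ => s) s = 1 / s := logDeriv_id' s
  have l2 : logDeriv (fun s : ℂ => s - 1) s = 1 / (s - 1) := by
    rw [logDeriv_apply]; simp
  have l3 : logDeriv (fun s : ℂ => (π:ℂ) ^ (-s / 2)) s = - Real.log π / 2 := by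
    rw [logDeriv_apply, dpow.deriv, Complex.ofReal_log Real.pi_pos.le]
    field_simp
  have l4 : logDeriv (fun s : ℂ => Complex.Gamma (s / 2)) s = digamma (s / 2) / 2 := by
    rw [logDeriv_apply, dG.deriv, digamma_def, logDeriv_apply]; ring
  have l5 : logDeriv riemannZeta s = - LSeries (fun n => (ArithmeticFunction.vonMangoldt n : ℂ)) s := by
    rw [ArithmeticFunction.LSeries_vonMangoldt_eq_deriv_riemannZeta_div hs, logDeriv_apply]; ring
  rw [l1, l2, l3, l4, l5]
  ring

end ZetaXi

/-! part P33 -/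

namespace Digam
open Filter Topology Complex

/-- log (1 + 1/(n+1)) -/
noncomputable def lg (n : ℕ) : ℝ := Real.log ((n + 2 : ℝ) / (n + 1))

lemma lg_le (n : ℕ) : lg n ≤ 1 / (n + 1 : ℝ) := by
  have := Real.log_le_sub_one_of_pos (x := (n + 2 : ℝ) / (n + 1)) (by positivity)
  have h : (n + 2 : ℝ) / (n + 1) - 1 = 1 / (n + 1) := by field_simp; ring
  unfold lg; linarith

lemma le_lg (n : ℕ) : 1 / (n + 2 : ℝ) ≤ lg n := by
  have := Real.one_sub_inv_le_log_of_pos (x := (n + 2 : ℝ) / (n + 1)) (by positivity)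
  have h : 1 - ((n + 2 : ℝ) / (n + 1))⁻¹ = 1 / (n + 2) := by field_simp; ring
  unfold lg; linarith

lemma sum_lg (N : ℕ) : ∑ n ∈ Finset.range N, lg n = Real.log (N + 1) := by
  induction N with
  | zero => simp
  | succ k ih =>
    rw [Finset.sum_range_succ, ih]
    unfold lg
    rw [Real.log_div (by positivity) (by positivity)]
    push_cast
    ring_nf

noncomputable def f (n : ℕ) (z : ℂ) : ℂ := z * (lg n : ℂ) - Complex.log (1 + z / (n + 1))

noncomputable def f' (n : ℕ) (z : ℂ) : ℂ := (lg n : ℂ) - 1 / (n + 1 + z)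

lemma f_one (n : ℕ) : f n 1 = 0 := by
  unfold f lg
  rw [Complex.ofReal_log (by positivity)]
  have : (1 : ℂ) + 1 / (n + 1) = (((n + 2 : ℝ) / (n + 1) : ℝ) : ℂ) := by
    have : (n + 1 : ℂ) ≠ 0 := by exact_mod_cast Nat.succ_ne_zero n
    push_cast; field_simp; ring
  rw [this]; ring

lemma re_pos_aux {z : ℂ} (hz : 0 < z.re) (n : ℕ) : 0 < (1 + z / (n + 1)).re := by
  have : z / (n + 1) = z / ((n + 1 : ℝ) : ℂ) := by push_cast; rfl
  rw [Complex.add_re, this, Complex.div_ofReal_re]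
  simp only [one_re]
  positivity

lemma ne_aux {z : ℂ} (hz : 0 < z.re) (n : ℕ) : (n + 1 + z : ℂ) ≠ 0 := by
  intro h
  have := congrArg Complex.re h
  simp at this
  have : (0:ℝ) ≤ n := by positivity
  linarith

lemma hasDerivAt_f (n : ℕ) {z : ℂ} (hz : 0 < z.re) : HasDerivAt (f n) (f' n z) z := by
  have h1 : HasDerivAt (fun z : ℂ => 1 + z / (n + 1)) (1 / (n + 1)) z :=
    ((hasDerivAt_id z).div_const _).const_add 1
  have h2 := h1.clog (Or.inl (re_pos_aux hz n))
  have h3 := ((hasDerivAt_id z).mul_const (lg n : ℂ)).sub h2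
  convert! h3 using 1
  have : (n + 1 : ℂ) ≠ 0 := by exact_mod_cast Nat.succ_ne_zero n
  have := ne_aux hz n
  have h5 : (1 + z / (n + 1) : ℂ) ≠ 0 := by
    intro h; have := re_pos_aux hz n; rw [h] at this; simp at this
  unfold f'
  field_simp

lemma norm_f'_le (n : ℕ) {z : ℂ} (hz : 0 < z.re) : ‖f' n z‖ ≤ (1 + ‖z‖) * (1 / (n + 1 : ℝ) ^ 2) := by
  have hn : (n + 1 : ℂ) ≠ 0 := by exact_mod_cast Nat.succ_ne_zero n
  have e : f' n z = ((lg n - 1 / (n + 1) : ℝ) : ℂ) + z / ((n + 1) * (n + 1 + z)) := by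
    have := ne_aux hz n
    unfold f'; push_cast; field_simp; ring
  rw [e]
  refine (norm_add_le _ _).trans ?_
  have a1 : ‖((lg n - 1 / (n + 1) : ℝ) : ℂ)‖ ≤ 1 / (n + 1 : ℝ) ^ 2 := by
    rw [Complex.norm_real, Real.norm_eq_abs, abs_le]
    have := lg_le n
    have := le_lg n
    have h : 1 / (n + 1 : ℝ) - 1 / (n + 2) ≤ 1 / (n + 1 : ℝ) ^ 2 := by
      rw [div_sub_div _ _ (by positivity) (by positivity), div_le_div_iff₀ (by positivity) (by positivity)]
      nlinarith [(Nat.cast_nonneg n : (0:ℝ) ≤ n)]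
    have : 0 ≤ 1 / (n + 1 : ℝ) ^ 2 := by positivity
    constructor <;> linarith
  have a2 : ‖z / ((n + 1) * (n + 1 + z))‖ ≤ ‖z‖ * (1 / (n + 1 : ℝ) ^ 2) := by
    rw [norm_div, norm_mul]
    have b1 : ‖(n + 1 : ℂ)‖ = n + 1 := by
      have := Complex.norm_natCast (n + 1); push_cast at this; exact this
    have b2 : (n + 1 : ℝ) ≤ ‖(n + 1 + z : ℂ)‖ := by
      refine le_trans ?_ (Complex.re_le_norm _)
      simp; linarith
    rw [b1, mul_one_div, pow_two]
    gcongr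
  linarith

lemma summable_u (C : ℝ) : Summable (fun n : ℕ => C * (1 / (n + 1 : ℝ) ^ 2)) := by
  refine Summable.mul_left _ ?_
  have := (summable_nat_add_iff 1).2 (Real.summable_one_div_nat_pow.2 (one_lt_two))
  simpa using this

lemma main_tsum {z : ℂ} (hz : 0 < z.re) :
    HasDerivAt (fun z => ∑' n, f n z) (∑' n, f' n z) z ∧ Summable (fun n => f n z) := by
  set R := 2 + ‖z‖
  set t : Set ℂ := {w | 0 < w.re} ∩ Metric.ball 0 R
  have ht : IsOpen t := (isOpen_lt continuous_const Complex.continuous_re).inter Metric.isOpen_ball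
  have hc : IsPreconnected t := by
    apply Convex.isPreconnected
    refine Convex.inter ?_ (convex_ball _ _)
    exact convex_halfSpace_re_gt 0
  have hb : ∀ n y, y ∈ t → ‖f' n y‖ ≤ (1 + R) * (1 / (n + 1 : ℝ) ^ 2) := by
    intro n y hy
    refine (norm_f'_le n hy.1).trans ?_
    have : ‖y‖ < R := by simpa using hy.2
    gcongr
  have h1 : (1:ℂ) ∈ t := by
    constructor
    · simp
    · simp only [Metric.mem_ball, dist_zero_right, norm_one, R]
      have := norm_nonneg z
      linarith
  have h2 : z ∈ t := ⟨hz, by simp [R]⟩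
  have h0 : Summable (fun n => f n 1) := by simp [f_one, summable_zero]
  exact ⟨hasDerivAt_tsum_of_isPreconnected (summable_u (1 + R)) ht hc
    (fun n y hy => hasDerivAt_f n hy.1) hb h1 h0 h2,
    summable_of_summable_hasDerivAt_of_isPreconnected (summable_u (1 + R)) ht hc
    (fun n y hy => hasDerivAt_f n hy.1) hb h1 h0 h2⟩

lemma exp_partial {z : ℂ} (hz : 0 < z.re) (N : ℕ) :
    Complex.exp (∑ n ∈ Finset.range N, f n z) = (N + 1 : ℂ) ^ z * N.factorial / ∏ j ∈ Finset.range N, (j + 1 + z) := by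
  unfold f
  rw [Finset.sum_sub_distrib, ← Finset.mul_sum, Complex.exp_sub, ← Complex.ofReal_sum, sum_lg,
    Complex.exp_sum]
  have h1 : ∀ j ∈ Finset.range N, Complex.exp (Complex.log (1 + z / (j + 1))) = (j + 1 + z) / (j + 1) := by
    intro j _
    rw [Complex.exp_log]
    · have hn : (j + 1 : ℂ) ≠ 0 := by exact_mod_cast Nat.succ_ne_zero j
      field_simp
    · intro h; have := re_pos_aux hz j; rw [h] at this; simp at this
  rw [Finset.prod_congr rfl h1, Finset.prod_div_distrib]
  have h2 : ∏ j ∈ Finset.range N, ((j : ℂ) + 1) = N.factorial := by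
    rw [← Finset.prod_range_add_one_eq_factorial]; push_cast; rfl
  rw [h2, Complex.cpow_def_of_ne_zero (by exact_mod_cast Nat.succ_ne_zero N), Complex.ofReal_log (by positivity)]
  push_cast
  rw [mul_comm z]
  field_simp

lemma exp_tsum {z : ℂ} (hz : 0 < z.re) : Complex.exp (∑' n, f n z) = Complex.Gamma (z + 1) := by
  have h1 : Tendsto (fun N => Complex.exp (∑ n ∈ Finset.range N, f n z)) atTop
      (𝓝 (Complex.exp (∑' n, f n z))) :=
    (Complex.continuous_exp.tendsto _).comp (main_tsum hz).2.hasSum.tendsto_sum_nat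
  have h2 : Tendsto (fun N : ℕ => Complex.GammaSeq z (N + 1) * (z * ((z + (N + 1 : ℕ)) / (N + 1 : ℕ)))) atTop
      (𝓝 (Complex.Gamma z * (z * 1))) := by
    refine ((Complex.GammaSeq_tendsto_Gamma z).comp (tendsto_add_atTop_nat 1)).mul ?_
    refine tendsto_const_nhds.mul ?_
    have : Tendsto (fun N : ℕ => z * (1 / ((N : ℂ) + 1)) + 1) atTop (𝓝 (z * 0 + 1)) :=
      (tendsto_const_nhds.mul tendsto_one_div_add_atTop_nhds_zero_nat).add tendsto_const_nhds
    rw [mul_zero, zero_add] at this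
    refine this.congr fun N => ?_
    have : (N + 1 : ℂ) ≠ 0 := by exact_mod_cast Nat.succ_ne_zero N
    push_cast; field_simp
  have hz0 : z ≠ 0 := fun h => by rw [h] at hz; simp at hz
  rw [Complex.Gamma_add_one z hz0]
  refine (tendsto_nhds_unique h1 (h2.congr fun N => ?_)).trans (by ring)
  rw [exp_partial hz]
  unfold Complex.GammaSeq
  have e : ∏ j ∈ Finset.range (N + 1 + 1), (z + (j : ℂ))
      = z * (∏ j ∈ Finset.range N, ((j:ℂ) + 1 + z)) * (z + (N + 1 : ℕ)) := by
    rw [Finset.prod_range_succ, Finset.prod_range_succ']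
    push_cast
    rw [add_zero]
    congr 1
    rw [mul_comm]
    congr 1
    exact Finset.prod_congr rfl fun j _ => by ring
  rw [e, Nat.factorial_succ]
  have : ((N + 1 : ℕ) : ℂ) ≠ 0 := by exact_mod_cast Nat.succ_ne_zero N
  have g : (z + (N + 1 : ℕ)) ≠ 0 := by
    have := ne_aux hz N; push_cast; convert! this using 1; ring
  have g2 : ∏ j ∈ Finset.range N, ((j:ℂ) + 1 + z) ≠ 0 := Finset.prod_ne_zero_iff.2 fun j _ => ne_aux hz j
  rw [Nat.cast_mul]
  field_simp
  push_cast
  ring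

lemma hasSum_digamma {z : ℂ} (hz : 0 < z.re) :
    HasSum (fun n : ℕ => (lg n : ℂ) - 1 / (n + 1 + z)) (Complex.digamma (z + 1)) := by
  have hs : Summable (fun n => f' n z) :=
    Summable.of_norm_bounded (summable_u (1 + ‖z‖)) fun n => norm_f'_le n hz
  have hd := (main_tsum hz).1.cexp
  have e : (fun z => Complex.exp (∑' n, f n z)) =ᶠ[𝓝 z] fun z => Complex.Gamma (z + 1) := by
    have hopen : {z : ℂ | 0 < z.re} ∈ 𝓝 z := (isOpen_lt continuous_const Complex.continuous_re).mem_nhds hz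
    filter_upwards [hopen] with w hw
    exact exp_tsum hw
  have hd2 : deriv Complex.Gamma (z + 1) = Complex.Gamma (z + 1) * ∑' n, f' n z := by
    rw [← deriv_comp_add_const, ← e.deriv_eq, hd.deriv, exp_tsum hz]
  have : Complex.digamma (z + 1) = ∑' n, f' n z := by
    rw [digamma_def, logDeriv_apply, hd2]
    have : Complex.Gamma (z + 1) ≠ 0 := Complex.Gamma_ne_zero_of_re_pos (by simp; linarith)
    field_simp
  rw [this]
  exact hs.hasSum

open ZetaXi in
/-- The basic formula for the log derivative of `Xi`. -/
lemma logDeriv_Xi {s : ℂ} (hs : 1 < s.re) :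
    HasSum (fun n : ℕ => (lg n / 2 : ℂ) - 1 / (2 * (n + 1) + s))
      (logDeriv Xi s - 1 / (s - 1) + Real.log π / 2 +
        LSeries (fun n => (ArithmeticFunction.vonMangoldt n : ℂ)) s) := by
  have hz : 0 < (s / 2).re := by simp; linarith
  have h := (hasSum_digamma hz).mul_left (1 / 2)
  have hs0 : s ≠ 0 := fun h => by rw [h] at hs; simp at hs; linarith
  rw [Complex.digamma_apply_add_one, ] at h
  · rw [logDeriv_Xi_eq hs]
    convert! h using 1
    · ext n
      have := ne_aux hz n
      have h2 : (2 * (n + 1) + s : ℂ) ≠ 0 := by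
        intro h; apply this; linear_combination h / 2
      field_simp
    · field_simp; ring
  · intro m h
    rw [h] at hz
    simp at hz
    have : (0:ℝ) ≤ m := by positivity
    linarith

end Digam

/-! part P34 -/

namespace Digam
open Filter Topology Complex

lemma hasSum_le_telescope {f A : ℕ → ℝ} {S : ℝ} (h : HasSum f S) (hA : ∀ n, f n ≤ A n - A (n + 1))
    (h0 : Tendsto A atTop (𝓝 0)) : S ≤ A 0 := by
  have h1 := h.tendsto_sum_nat
  have h2 : Tendsto (fun n => A 0 - A n) atTop (𝓝 (A 0 - 0)) := tendsto_const_nhds.sub h0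
  rw [sub_zero] at h2
  refine le_of_tendsto_of_tendsto' h1 h2 fun n => ?_
  calc _ ≤ ∑ i ∈ Finset.range n, (A i - A (i + 1)) := Finset.sum_le_sum fun i _ => hA i
    _ = _ := Finset.sum_range_sub' A n

lemma log_ratio_le {a : ℝ} (ha : 0 < a) : Real.log ((a + 1) / a) ≤ (1 / a + 1 / (a + 1)) / 2 := by
  set v := Real.log ((a + 1) / a) with hv
  have hv0 : 0 ≤ v / 2 := by
    rw [hv]
    have : 1 ≤ (a + 1) / a := by rw [le_div_iff₀ ha]; linarith
    have := Real.log_nonneg this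
    linarith
  have h1 : v ≤ Real.sinh v := Real.self_le_sinh_iff.2 (by linarith)
  rw [Real.sinh_eq, Real.exp_neg, hv, Real.exp_log (by positivity)] at h1
  refine h1.trans (le_of_eq ?_)
  field_simp
  ring

lemma tendsto_ratio (z : ℂ) :
    Tendsto (fun n : ℕ => ‖(n + z : ℂ) / (n + 1 : ℂ)‖) atTop (𝓝 1) := by
  have : Tendsto (fun N : ℕ => 1 + (z - 1) * (1 / ((N : ℂ) + 1))) atTop (𝓝 (1 + (z - 1) * 0)) :=
      tendsto_const_nhds.add (tendsto_const_nhds.mul tendsto_one_div_add_atTop_nhds_zero_nat)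
  rw [mul_zero, add_zero] at this
  have := this.norm
  rw [norm_one] at this
  refine this.congr fun N => ?_
  have : (N + 1 : ℂ) ≠ 0 := by exact_mod_cast Nat.succ_ne_zero N
  congr 1
  field_simp
  ring

lemma digamma_real_le {x : ℝ} (hx : 0 < x) :
    (Complex.digamma (x + 1)).re ≤ Real.log (1 + x) - 1 / (2 * (1 + x)) := by
  have h := (Complex.hasSum_iff _ _).1 (hasSum_digamma (z := x) (by simpa using hx)) |>.1
  have hterm : ∀ n : ℕ, (((lg n : ℂ) - 1 / (n + 1 + x)).re) = lg n - 1 / (n + 1 + x) := by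
    intro n
    have : ((lg n : ℂ) - 1 / (n + 1 + x)) = ((lg n - 1 / (n + 1 + x) : ℝ) : ℂ) := by push_cast; rfl
    rw [this, Complex.ofReal_re]
  simp_rw [hterm] at h
  have key := hasSum_le_telescope (A := fun n : ℕ =>
      Real.log ((n + 1 + x) / (n + 1)) - 1 / (2 * (n + 1 + x))) h ?_ ?_
  · simpa using key
  · intro n
    have hn : (0:ℝ) ≤ n := by positivity
    have := log_ratio_le (a := n + 1 + x) (by positivity)
    rw [Real.log_div (by positivity) (by positivity)] at this
    rw [Real.log_div (by positivity) (by positivity), Real.log_div (by positivity) (by positivity)]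
    unfold lg
    rw [Real.log_div (by positivity) (by positivity)]
    push_cast
    have e1 : (n : ℝ) + 1 + 1 + x = n + 1 + x + 1 := by ring
    have e2 : (n : ℝ) + 1 + 1 = n + 2 := by ring
    rw [e1, e2]
    have e3 : (1 / (n + 1 + x) + 1 / (n + 1 + x + 1)) / 2 = 1 / (2 * (n + 1 + x)) + 1 / (2 * (n + 1 + x + 1)) := by
      field_simp
    have e4 : 1 / (n + 1 + x) = 2 * (1 / (2 * (n + 1 + x))) := by field_simp
    rw [e4]
    linarith
  · have h1 := (tendsto_ratio (1 + x)).log one_ne_zero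
    rw [Real.log_one] at h1
    have h2 : Tendsto (fun n : ℕ => 1 / (2 * ((n : ℝ) + 1 + x))) atTop (𝓝 0) := by
      refine tendsto_const_nhds.div_atTop ?_
      refine Tendsto.const_mul_atTop two_pos ?_
      refine tendsto_atTop_add_const_right _ _ (tendsto_atTop_add_const_right _ _ tendsto_natCast_atTop_atTop)
    have h3 := h1.sub h2
    rw [sub_zero] at h3
    refine h3.congr fun n => ?_
    have : ((n : ℂ) + (1 + x)) / (n + 1) = (((n + 1 + x) / (n + 1) : ℝ) : ℂ) := by push_cast; ring
    rw [this, Complex.norm_real, Real.norm_eq_abs, abs_of_pos (by positivity)]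

lemma log_diff {w : ℂ} (hw : 2 ≤ ‖w‖) :
    Real.log ‖w + 1 / 2‖ - Real.log ‖w - 1 / 2‖ ≤ (1 / w).re + 1 / (9 * ‖w‖ ^ 3) := by
  have hw0 : w ≠ 0 := fun h => by rw [h] at hw; simp at hw; linarith
  set u := 1 / (2 * w) with hu
  have hun : ‖u‖ = 1 / (2 * ‖w‖) := by rw [hu]; simp
  have hu4 : ‖u‖ ≤ 1 / 4 := by
    rw [hun]; gcongr; linarith
  have e1 : ‖w + 1 / 2‖ = ‖w‖ * ‖1 + u‖ := by
    rw [← norm_mul]; congr 1; rw [hu]; field_simp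
  have e2 : ‖w - 1 / 2‖ = ‖w‖ * ‖1 + -u‖ := by
    rw [← norm_mul]; congr 1; rw [hu]; field_simp
    ring
  have hne : ∀ v : ℂ, ‖v‖ ≤ 1 / 4 → ‖1 + v‖ ≠ 0 := by
    intro v hv h
    rw [norm_eq_zero] at h
    have : v = -1 := by linear_combination h
    rw [this] at hv; norm_num at hv
  have hu4' : ‖-u‖ ≤ 1 / 4 := by rwa [norm_neg]
  rw [e1, e2, Real.log_mul (by positivity) (hne u hu4), Real.log_mul (by positivity) (hne (-u) hu4')]
  have t1 := Complex.norm_log_sub_logTaylor_le 2 (z := u) (by linarith)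
  have t2 := Complex.norm_log_sub_logTaylor_le 2 (z := -u) (by linarith)
  rw [norm_neg] at t2
  have hT : ∀ v : ℂ, Complex.logTaylor (2 + 1) v = v - v ^ 2 / 2 := by
    intro v
    simp [Complex.logTaylor, Finset.sum_range_succ]
    ring
  rw [hT] at t1 t2
  have hb : ‖u‖ ^ (2 + 1) * (1 - ‖u‖)⁻¹ / ((2:ℕ) + 1) ≤ ‖u‖ ^ 3 * (4 / 9) := by
    have : (1 - ‖u‖)⁻¹ ≤ 4 / 3 := by
      rw [inv_le_comm₀ (by linarith) (by norm_num)]; linarith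
    have h3 : 0 ≤ ‖u‖ ^ 3 := by positivity
    push_cast
    norm_num
    nlinarith
  have r1 := (Complex.re_le_norm _).trans (t1.trans hb)
  have r2 := (neg_le_abs _).trans ((Complex.abs_re_le_norm _).trans (t2.trans hb))
  simp only [Complex.sub_re, Complex.log_re, Complex.neg_re] at r1 r2
  have hre : (1 / w).re = 2 * u.re := by
    have : 1 / w = ((2:ℝ) : ℂ) * u := by rw [hu]; push_cast; field_simp
    rw [this, Complex.re_ofReal_mul]
  have h8 : 1 / (9 * ‖w‖ ^ 3) = 2 * (‖u‖ ^ 3 * (4 / 9)) := by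
    rw [hun]; field_simp; norm_num
  rw [hre, h8]
  have : ((-u) ^ 2 / 2).re = (u ^ 2 / 2).re := by rw [neg_sq]
  linarith

lemma re_digamma_le {z : ℂ} (hx : 1 / 2 ≤ z.re) (hy : 2 ≤ |z.im|) :
    (Complex.digamma (z + 1)).re ≤ Real.log ‖z + 1 / 2‖ + 1 / (9 * |z.im|) := by
  have hz : 0 < z.re := by linarith
  have h := (Complex.hasSum_iff _ _).1 (hasSum_digamma hz) |>.1
  have hpos : ∀ n : ℕ, 0 < ‖(n : ℂ) + (z + 1 / 2)‖ := by
    intro n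
    rw [norm_pos_iff]
    intro h
    have := congrArg Complex.re h
    simp at this
    have : (0:ℝ) ≤ n := by positivity
    linarith
  have key := hasSum_le_telescope (A := fun n : ℕ =>
      Real.log (‖((n:ℂ) + (z + 1 / 2)) / (n + 1)‖) + 1 / (9 * |z.im|) * (1 / ((n : ℝ) + 1))) h ?_ ?_
  · simpa using key
  · intro n
    have hn : (0:ℝ) ≤ n := by positivity
    set w : ℂ := n + 1 + z with hw
    have him : w.im = z.im := by simp [hw]
    have hre : w.re = n + 1 + z.re := by simp [hw]
    have hyw : |z.im| ≤ ‖w‖ := by rw [← him]; exact Complex.abs_im_le_norm w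
    have hxw : (n : ℝ) + 3 / 2 ≤ ‖w‖ := by
      refine le_trans ?_ (Complex.re_le_norm w); rw [hre]; linarith
    have hl := log_diff (w := w) (hy.trans hyw)
    have n1 : ‖(n + 1 : ℂ)‖ = n + 1 := by
      have := Complex.norm_natCast (n + 1); push_cast at this; exact this
    have n2 : ‖(((n + 1 : ℕ) : ℂ) + 1 : ℂ)‖ = n + 2 := by
      have := Complex.norm_natCast (n + 2); push_cast at this; push_cast
      have e : (n : ℂ) + 1 + 1 = n + 2 := by ring
      rw [e]; exact this
    rw [norm_div, norm_div, Real.log_div (hpos n).ne' (by rw [n1]; positivity),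
      Real.log_div (hpos (n+1)).ne' (by rw [n2]; positivity), n1, n2]
    have a1 : (n : ℂ) + (z + 1 / 2) = w - 1 / 2 := by rw [hw]; ring
    have a2 : ((n + 1 : ℕ) : ℂ) + (z + 1 / 2) = w + 1 / 2 := by rw [hw]; push_cast; ring
    rw [a1, a2]
    simp only [Complex.sub_re, Complex.ofReal_re]
    unfold lg
    rw [Real.log_div (by positivity) (by positivity)]
    have herr : 1 / (9 * ‖w‖ ^ 3) ≤ 1 / (9 * |z.im|) * (1 / ((n : ℝ) + 1)) - 1 / (9 * |z.im|) * (1 / ((n + 1 : ℕ) + 1)) := by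
      have hy0 : 0 < |z.im| := by linarith
      have : 1 / (9 * |z.im|) * (1 / ((n : ℝ) + 1)) - 1 / (9 * |z.im|) * (1 / ((n + 1 : ℕ) + 1))
        = 1 / (9 * (|z.im| * ((n + 1) * (n + 2)))) := by
        push_cast; field_simp; ring
      rw [this]
      have h2 : ((n : ℝ) + 1) * (n + 2) ≤ ‖w‖ ^ 2 := by nlinarith
      have : |z.im| * (((n : ℝ) + 1) * (n + 2)) ≤ ‖w‖ ^ 3 := by
        rw [pow_succ' ‖w‖ 2]; gcongr
      gcongr
    linarith
  · have h1 := (tendsto_ratio (z + 1 / 2)).log one_ne_zero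
    rw [Real.log_one] at h1
    have h2 : Tendsto (fun n : ℕ => 1 / (9 * |z.im|) * (1 / ((n : ℝ) + 1))) atTop (𝓝 (1 / (9 * |z.im|) * 0)) :=
      tendsto_const_nhds.mul tendsto_one_div_add_atTop_nhds_zero_nat
    have h3 := h1.add h2
    rw [mul_zero, add_zero] at h3
    exact h3

end Digam

/-! part P5 -/

namespace ZetaXi
open Complex Filter Topology

/-- Dirichlet series of von Mangoldt -/
noncomputable def VM (s : ℂ) : ℂ := LSeries (fun n => (ArithmeticFunction.vonMangoldt n : ℂ)) s

lemma H_re_eq {s : ℂ} (hs : 1 < s.re) :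
    (logDeriv Xi s).re = (1 / (s - 1)).re - Real.log π / 2 + (digamma (s / 2 + 1)).re / 2 - (VM s).re := by
  have hs0 : s ≠ 0 := fun h => by rw [h] at hs; simp at hs; linarith
  have h1 : digamma (s / 2 + 1) = digamma (s / 2) + (s / 2)⁻¹ := by
    apply digamma_apply_add_one
    intro m h
    have := congrArg Complex.re h
    simp at this
    have : (0:ℝ) ≤ m := by positivity
    linarith
  have h2 : logDeriv Xi s = 1 / (s - 1) - ((Real.log π / 2 : ℝ) : ℂ) + ((1 / 2 : ℝ) : ℂ) * digamma (s / 2 + 1) - VM s := by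
    rw [logDeriv_Xi_eq hs, h1, VM]
    push_cast
    field_simp
    ring
  rw [h2, Complex.sub_re, Complex.add_re, Complex.sub_re, Complex.re_ofReal_mul, Complex.ofReal_re]
  ring

lemma VM_re {σ t : ℝ} (hσ : 1 < σ) :
    HasSum (fun n : ℕ => ArithmeticFunction.vonMangoldt n * (n : ℝ) ^ (-σ) * Real.cos (t * Real.log n))
      (VM (σ + t * I)).re := by
  have hs := ArithmeticFunction.LSeriesSummable_vonMangoldt (s := σ + t * I) (by simpa using hσ)
  have h := Complex.hasSum_re hs.hasSum
  convert! h using 1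
  funext n
  rw [LSeries.term_def₀ (by simp)]
  rcases eq_or_ne n 0 with rfl | hn
  · simp
  have hn0 : (0:ℝ) < n := by exact_mod_cast Nat.pos_of_ne_zero hn
  rw [Complex.re_ofReal_mul, mul_assoc]
  congr 1
  have e : (n : ℂ) ^ (-(σ + t * I : ℂ)) = (((n : ℝ) ^ (-σ) : ℝ) : ℂ) * Complex.exp (((-(t * Real.log n) : ℝ) : ℂ) * I) := by
    rw [Complex.ofReal_cpow hn0.le, Complex.cpow_def_of_ne_zero (by exact_mod_cast hn),
      Complex.cpow_def_of_ne_zero (by exact_mod_cast hn), ← Complex.exp_add]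
    congr 1
    rw [Complex.ofReal_natCast, ← Complex.ofReal_natCast n, ← Complex.ofReal_log hn0.le]
    push_cast; ring
  rw [e, Complex.re_ofReal_mul, Complex.exp_ofReal_mul_I_re, Real.cos_neg]

lemma VM_re_nonneg {σ : ℝ} (hσ : 1 < σ) : 0 ≤ (VM σ).re := by
  have h := VM_re (t := 0) hσ
  simp only [Complex.ofReal_zero, zero_mul, add_zero, Real.cos_zero, mul_one] at h
  exact h.nonneg fun n => mul_nonneg ArithmeticFunction.vonMangoldt_nonneg (by positivity)

lemma term_nonneg {s z : ℂ} (hs : 1 ≤ s.re) :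
    0 ≤ (mu z : ℝ) * ((1 / (s - z)).re + (1 / (s - 1 + z)).re) := by
  by_cases hz : Xi z = 0
  · have := Hterm_re_nonneg hs hz
    exact mul_nonneg (by positivity) (by linarith)
  · rw [(mu_eq_zero_iff z).2 hz]; simp

lemma term_ge {s z : ℂ} (hs : 1 ≤ s.re) (hz : Xi z = 0) :
    (1 / (s - z)).re + (1 / (s - 1 + z)).re ≤ (mu z : ℝ) * ((1 / (s - z)).re + (1 / (s - 1 + z)).re) := by
  have := Hterm_re_nonneg hs hz
  have h1 : (1:ℝ) ≤ mu z := by exact_mod_cast mu_pos hz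
  nlinarith

lemma H_ge_finset {s : ℂ} (hs : 1 ≤ s.re) (S : Finset ℂ) (hS : ∀ z ∈ S, Xi z = 0) :
    ∑ z ∈ S, ((1 / (s - z)).re + (1 / (s - 1 + z)).re) ≤ 2 * (logDeriv Xi s).re := by
  refine le_trans (Finset.sum_le_sum fun z hz => term_ge hs (hS z hz)) ?_
  exact sum_le_hasSum S (fun z _ => term_nonneg hs) (hasSum_H_re hs)

lemma H_re_nonneg {s : ℂ} (hs : 1 ≤ s.re) : 0 ≤ (logDeriv Xi s).re := by
  have := (hasSum_H_re hs).nonneg fun z => term_nonneg hs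
  linarith

lemma Xi_zero_one_sub {z : ℂ} (hz : Xi z = 0) : Xi (1 - z) = 0 := by rw [Xi_one_sub, hz]

lemma H_real_le {σ : ℝ} (hσ : 1 < σ) :
    (logDeriv Xi σ).re ≤ 1 / (σ - 1) - Real.log π / 2 + (Real.log (1 + σ / 2) - 1 / (2 + σ)) / 2 := by
  rw [H_re_eq (by simpa using hσ)]
  have h1 := VM_re_nonneg hσ
  have h2 := Digam.digamma_real_le (x := σ / 2) (by linarith)
  have e : ((σ / 2 : ℝ) : ℂ) + 1 = (σ : ℂ) / 2 + 1 := by push_cast; ring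
  rw [e] at h2
  have h3 : ((1 : ℂ) / (σ - 1)).re = 1 / (σ - 1) := by
    have : (1 : ℂ) / (σ - 1) = ((1 / (σ - 1) : ℝ) : ℂ) := by push_cast; rfl
    rw [this, Complex.ofReal_re]
  have h4 : 1 / (2 * (1 + σ / 2)) = 1 / (2 + σ) := by congr 1; ring
  rw [h3]
  rw [h4] at h2
  linarith

lemma re_inv_eq (z : ℂ) : (1 / z).re = z.re / (z.re ^ 2 + z.im ^ 2) := by
  rw [one_div, Complex.inv_re, Complex.normSq_apply]; ring_nf

/-- all zeros have imaginary part at least 4 -/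
theorem zero_height {z : ℂ} (hz : Xi z = 0) : 4 ≤ |z.im| := by
  by_contra hlt
  push Not at hlt
  obtain ⟨h0, h1⟩ := Xi_zero_re hz
  have hH : (logDeriv Xi ((4:ℝ):ℂ)).re < 0.24 := by
    have h := H_real_le (σ := 4) (by norm_num)
    have h2 : Real.log (1 + 4 / 2) - Real.log π ≤ 3 / π - 1 := by
      rw [← Real.log_div (by norm_num) (by positivity)]
      have := Real.log_le_sub_one_of_pos (x := (1 + 4 / 2) / π) (by positivity)
      refine this.trans (le_of_eq ?_)
      norm_num
    have h3 : 3 / π < 3 / 3.14 := by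
      gcongr; exact Real.pi_gt_d2
    norm_num at h h2 h3 ⊢
    linarith
  have hbd : ∀ w : ℂ, w.re ≤ 4 → 3 ≤ w.re → |w.im| < 4 → 0.12 ≤ (1 / w).re := by
    intro w h4 h3 him
    rw [re_inv_eq, le_div_iff₀ (by nlinarith)]
    have : w.im ^ 2 ≤ 16 := by
      rw [← sq_abs]; nlinarith [abs_nonneg w.im]
    nlinarith
  by_cases him : z.im = 0
  · have h := H_ge_finset (s := ((4:ℝ):ℂ)) (by norm_num) {z} (by simpa using hz)
    rw [Finset.sum_singleton, re_inv_eq, re_inv_eq] at h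
    simp [him] at h
    have e1 : 1 / 4 ≤ (4 - z.re) / (4 - z.re) ^ 2 := by
      rw [div_le_div_iff₀ (by norm_num) (by nlinarith)]; nlinarith
    have e2 : 1 / 4 ≤ (4 - 1 + z.re) / (4 - 1 + z.re) ^ 2 := by
      rw [div_le_div_iff₀ (by norm_num) (by nlinarith)]; nlinarith
    have : (logDeriv Xi ((4:ℝ):ℂ)) = logDeriv Xi 4 := by norm_num
    rw [this] at hH
    linarith
  · have hne : z ≠ starRingEnd ℂ z := by
      intro h
      have := congrArg Complex.im h
      simp at this
      apply him; linarith
    have h := H_ge_finset (s := ((4:ℝ):ℂ)) (by norm_num) {z, starRingEnd ℂ z} (by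
      intro w hw
      rw [Finset.mem_insert, Finset.mem_singleton] at hw
      rcases hw with rfl | rfl
      · exact hz
      · exact Xi_conj_zero hz)
    rw [Finset.sum_pair hne] at h
    have b1 := hbd (((4:ℝ):ℂ) - z) (by simp; linarith) (by simp; linarith) (by simpa using hlt)
    have b2 := hbd (((4:ℝ):ℂ) - 1 + z) (by norm_num; linarith) (by norm_num; linarith) (by simpa using hlt)
    have b3 := hbd (((4:ℝ):ℂ) - starRingEnd ℂ z) (by simp; linarith) (by simp; linarith) (by simpa using hlt)
    have b4 := hbd (((4:ℝ):ℂ) - 1 + starRingEnd ℂ z) (by norm_num; linarith) (by norm_num; linarith) (by simpa using hlt)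
    linarith

lemma H_ge_four {ρ : ℂ} (hρ : Xi ρ = 0) (hβ : 1 / 2 < ρ.re) {σ : ℝ} (hσ : 1 < σ) :
    1 / (σ - ρ.re) + 1 / (σ - 1 + ρ.re) ≤ (logDeriv Xi (σ + ρ.im * I)).re := by
  obtain ⟨h0, h1⟩ := Xi_zero_re hρ
  have him : ρ.im ≠ 0 := by
    intro h; have := zero_height hρ; rw [h] at this; simp at this; linarith
  set c := starRingEnd ℂ ρ with hc
  have cre : c.re = ρ.re := by simp [hc]
  have cim : c.im = -ρ.im := by simp [hc]
  have hcz : Xi c = 0 := Xi_conj_zero hρ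
  have ne1 : ρ ≠ c := fun h => by
    have := congrArg Complex.im h; rw [cim] at this; apply him; linarith
  have ne2 : ρ ≠ 1 - c := fun h => by
    have := congrArg Complex.re h; simp [cre] at this; linarith
  have ne3 : ρ ≠ 1 - ρ := fun h => by
    have := congrArg Complex.re h; simp at this; linarith
  have ne4 : c ≠ 1 - c := fun h => by
    have := congrArg Complex.re h; simp [cre] at this; linarith
  have ne5 : c ≠ 1 - ρ := fun h => by
    have := congrArg Complex.re h; simp [cre] at this; linarith
  have ne6 : 1 - c ≠ 1 - ρ := fun h => by
    have := congrArg Complex.im h; simp [cim] at this; apply him; linarith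
  have hs : 1 ≤ (σ + ρ.im * I : ℂ).re := by simp; linarith
  have hS : ∀ z ∈ ({ρ, c, 1 - c, 1 - ρ} : Finset ℂ), Xi z = 0 := by
    intro w hw
    simp only [Finset.mem_insert, Finset.mem_singleton] at hw
    rcases hw with rfl | rfl | rfl | rfl
    · exact hρ
    · exact hcz
    · exact Xi_zero_one_sub hcz
    · exact Xi_zero_one_sub hρ
  have h := H_ge_finset hs _ hS
  rw [Finset.sum_insert (by simp [ne1, ne2, ne3]), Finset.sum_insert (by simp [ne4, ne5]),
    Finset.sum_insert (by simp [ne6]), Finset.sum_singleton] at h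
  have r1 := (Hterm_re_nonneg hs hρ).2
  have r2 := (Hterm_re_nonneg hs hcz).1
  have r3 := (Hterm_re_nonneg hs (Xi_zero_one_sub hcz)).2
  have r4 := (Hterm_re_nonneg hs (Xi_zero_one_sub hρ)).1
  have hofr : ∀ (w : ℂ) (x : ℝ), w = x → (1 / w).re = 1 / x := by
    intro w x h; rw [h, ← Complex.ofReal_one, ← Complex.ofReal_div, Complex.ofReal_re]
  have q1 : (1 / (σ + ρ.im * I - ρ)).re = 1 / (σ - ρ.re) :=
    hofr _ _ (by apply Complex.ext <;> simp)
  have q2 : (1 / (σ + ρ.im * I - 1 + c)).re = 1 / (σ - 1 + ρ.re) :=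
    hofr _ _ (by apply Complex.ext <;> simp [cre, cim])
  have q3 : (1 / (σ + ρ.im * I - (1 - c))).re = 1 / (σ - 1 + ρ.re) :=
    hofr _ _ (by apply Complex.ext <;> simp [cre, cim]; ring)
  have q4 : (1 / (σ + ρ.im * I - 1 + (1 - ρ))).re = 1 / (σ - ρ.re) :=
    hofr _ _ (by apply Complex.ext <;> simp)
  rw [q1, q2, q3, q4] at h
  linarith

end ZetaXi

/-! part P51 -/

namespace ZetaXi
open Complex Filter Topology

lemma trig_nonneg (θ : ℝ) : 0 ≤ 11.22218432 + 19.131392 * Real.cos θ + 11.7028 * Real.cos (2 * θ)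
    + 4.76 * Real.cos (3 * θ) + Real.cos (4 * θ) := by
  have h4 : Real.cos (4 * θ) = 2 * (2 * Real.cos θ ^ 2 - 1) ^ 2 - 1 := by
    rw [← Real.cos_two_mul, ← Real.cos_two_mul]; ring_nf
  rw [h4, Real.cos_three_mul, Real.cos_two_mul]
  have : 0 ≤ 8 * ((Real.cos θ + 0.91) * (Real.cos θ + 0.28)) ^ 2 := by positivity
  refine this.trans (le_of_eq ?_)
  ring

lemma VM_comb {σ t : ℝ} (hσ : 1 < σ) : 0 ≤ 11.22218432 * (VM σ).re + 19.131392 * (VM (σ + t * I)).re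
    + 11.7028 * (VM (σ + (2 * t : ℝ) * I)).re + 4.76 * (VM (σ + (3 * t : ℝ) * I)).re
    + (VM (σ + (4 * t : ℝ) * I)).re := by
  have h0 := VM_re (t := 0) hσ
  simp only [Complex.ofReal_zero, zero_mul, add_zero, Real.cos_zero, mul_one] at h0
  have h := ((((h0.mul_left 11.22218432).add ((VM_re (t := t) hσ).mul_left 19.131392)).add
    ((VM_re (t := 2 * t) hσ).mul_left 11.7028)).add ((VM_re (t := 3 * t) hσ).mul_left 4.76)).add
    (VM_re (t := 4 * t) hσ)
  refine h.nonneg fun n => ?_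
  have h1 := trig_nonneg (t * Real.log n)
  have h2 : 0 ≤ ArithmeticFunction.vonMangoldt n * (n : ℝ) ^ (-σ) :=
    mul_nonneg ArithmeticFunction.vonMangoldt_nonneg (by positivity)
  have := mul_nonneg h2 h1
  refine this.trans (le_of_eq ?_)
  rw [mul_assoc 2 t, mul_assoc 3 t, mul_assoc 4 t]
  ring

lemma pos_of_sq_pos_aux {a : ℝ} (h : 0 ≤ a) (h2 : 0 < a ^ 2) : 0 < a := by
  rcases h.lt_or_eq with h | h
  · exact h
  · rw [← h] at h2; norm_num at h2

lemma H_upper {σ v V : ℝ} (hσ : 1 < σ) (hσ2 : σ ≤ 1.17) (hv : 4 ≤ v) (hV : v ≤ V) :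
    (logDeriv Xi (σ + v * I)).re + (VM (σ + v * I)).re ≤
      0.17 / v ^ 2 - Real.log π / 2 + (Real.log (V / 2) + (2.17 / V) ^ 2 / 2 + 2 / (9 * v)) / 2 := by
  rw [H_re_eq (by simpa using hσ)]
  have h1 : (1 / ((σ : ℂ) + v * I - 1)).re ≤ 0.17 / v ^ 2 := by
    rw [re_inv_eq]
    simp
    gcongr
    · linarith
    · nlinarith
  have h2 := Digam.re_digamma_le (z := (σ + v * I : ℂ) / 2) (by simp; linarith)
    (by simp; rw [abs_of_pos (by linarith)]; linarith)
  have him : |((σ + v * I : ℂ) / 2).im| = v / 2 := by simp; linarith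
  rw [him] at h2
  have h3 : Real.log ‖(σ + v * I : ℂ) / 2 + 1 / 2‖ ≤ Real.log (V / 2) + (2.17 / V) ^ 2 / 2 := by
    have hn : ‖(σ + v * I : ℂ) / 2 + 1 / 2‖ ^ 2 = ((σ + 1) / 2) ^ 2 + (v / 2) ^ 2 := by
      rw [← Complex.normSq_eq_norm_sq, Complex.normSq_apply]; simp; ring
    have hn0 : 0 < ‖(σ + v * I : ℂ) / 2 + 1 / 2‖ := by
      have : 0 < ‖(σ + v * I : ℂ) / 2 + 1 / 2‖ ^ 2 := by rw [hn]; positivity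
      exact pos_of_sq_pos_aux (norm_nonneg _) this
    have hV0 : 0 < V := by linarith
    have hle : ‖(σ + v * I : ℂ) / 2 + 1 / 2‖ ^ 2 ≤ (V / 2) ^ 2 * (1 + (2.17 / V) ^ 2) := by
      rw [hn]
      have : (V / 2) ^ 2 * (1 + (2.17 / V) ^ 2) = (V / 2) ^ 2 + (2.17 / 2) ^ 2 := by field_simp
      rw [this, add_comm]
      gcongr
      linarith
    have := Real.log_le_log (by positivity) hle
    rw [Real.log_pow, Real.log_mul (by positivity) (by positivity), Real.log_pow] at this
    have h5 := Real.log_le_sub_one_of_pos (x := 1 + (2.17 / V) ^ 2) (by positivity)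
    push_cast at this
    linarith
  have h4 : 1 / (9 * (v / 2)) = 2 / (9 * v) := by field_simp
  linarith

lemma log3_le : Real.log 3 ≤ 1.1009 := by
  have h : Real.log (3 ^ 17) ≤ Real.log (2 ^ 27) := Real.log_le_log (by norm_num) (by norm_num)
  rw [Real.log_pow, Real.log_pow] at h
  have := Real.log_two_lt_d9
  push_cast at h
  linarith

lemma log3_ge : 1.0974 ≤ Real.log 3 := by
  have h : Real.log (2 ^ 19) ≤ Real.log (3 ^ 12) := Real.log_le_log (by norm_num) (by norm_num)
  rw [Real.log_pow, Real.log_pow] at h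
  have := Real.log_two_gt_d9
  push_cast at h
  linarith

lemma log13_le : Real.log 13 ≤ 2.5653 := by
  have h : Real.log (13 ^ 10) ≤ Real.log (2 ^ 37 * 1.0055) := Real.log_le_log (by norm_num) (by norm_num)
  rw [Real.log_pow, Real.log_mul (by norm_num) (by norm_num), Real.log_pow] at h
  have := Real.log_two_lt_d9
  have h2 := Real.log_le_sub_one_of_pos (x := 1.0055) (by norm_num)
  push_cast at h
  linarith

lemma log13_ge : 2.5645 ≤ Real.log 13 := by
  have h : Real.log (2 ^ 37) ≤ Real.log (13 ^ 10) := Real.log_le_log (by norm_num) (by norm_num)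
  rw [Real.log_pow, Real.log_pow] at h
  have := Real.log_two_gt_d9
  push_cast at h
  linarith

lemma logpi_ge : 1.142 ≤ Real.log π := by
  have h := Real.one_sub_inv_le_log_of_pos (x := π / 3) (by positivity)
  rw [Real.log_div (by positivity) (by norm_num), inv_div] at h
  have h3 : 3 / π < 3 / 3.1415 := by
    gcongr; exact Real.pi_gt_d4
  have := log3_ge
  norm_num at *
  linarith

lemma log1585 : Real.log 1.585 ≤ 0.4645 := by
  have h := Real.log_le_sub_one_of_pos (x := 1.585 / 1.5) (by norm_num)
  have e : Real.log 1.5 = Real.log 3 - Real.log 2 := by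
    rw [← Real.log_div (by norm_num) (by norm_num)]; norm_num
  rw [Real.log_div (by norm_num) (by norm_num), e] at h
  have := log3_le
  have := Real.log_two_gt_d9
  norm_num at *
  linarith

lemma small_aux {t T k : ℝ} (hg4 : 4 ≤ t) (hT : 40 ≤ T) (hk : 1 ≤ k) :
    0.17 / (k * t) ^ 2 + ((2.17 / (k * T)) ^ 2 / 2 + 2 / (9 * (k * t))) / 2 ≤ 0.0393 * (1 / k) := by
  have hk0 : 0 < k := by linarith
  have ht0 : 0 < t := by linarith
  have hT0 : 0 < T := by linarith
  have hk2 : k ≤ k ^ 2 := by nlinarith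
  have s1 : 0.17 / (k * t) ^ 2 ≤ 0.0107 * (1 / k) := by
    rw [mul_one_div, div_le_div_iff₀ (by positivity) (by positivity), mul_pow]
    have : 16 ≤ t ^ 2 := by nlinarith
    have : k * 16 ≤ k ^ 2 * t ^ 2 := mul_le_mul hk2 this (by norm_num) (by positivity)
    linarith
  have s2 : (2.17 / (k * T)) ^ 2 / 2 ≤ 0.0015 * (1 / k) := by
    rw [mul_one_div, div_pow, div_div, div_le_div_iff₀ (by positivity) (by positivity), mul_pow]
    have : 1600 ≤ T ^ 2 := by nlinarith
    have : k * 1600 ≤ k ^ 2 * T ^ 2 := mul_le_mul hk2 this (by norm_num) (by positivity)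
    linarith
  have s3 : 2 / (9 * (k * t)) ≤ 0.0556 * (1 / k) := by
    rw [mul_one_div, div_le_div_iff₀ (by positivity) (by positivity)]
    have : k * 4 ≤ k * t := by gcongr
    linarith
  have : 0 < 1 / k := by positivity
  linarith

lemma comb_bound {ρ : ℂ} (hρ : Xi ρ = 0) (hβ : 1 / 2 < ρ.re) (hγ : 0 < ρ.im) {σ T : ℝ} (hσ : 1 < σ)
    (hσ2 : σ ≤ 1.17) (hT : 40 ≤ T) (hT2 : ρ.im ≤ T) :
    19.131392 / (σ - ρ.re) ≤ 11.22218432 / (σ - 1) + 18.297096 * Real.log (T / 13) := by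
  obtain ⟨h0, h1⟩ := Xi_zero_re hρ
  have hg4 : 4 ≤ ρ.im := by have := zero_height hρ; rwa [abs_of_pos hγ] at this
  set t := ρ.im with ht
  have k0 : (logDeriv Xi σ).re + (VM σ).re ≤ 1 / (σ - 1) - Real.log π / 2 + (Real.log (1 + σ / 2) - 1 / (2 + σ)) / 2 := by
    rw [H_re_eq (by simpa using hσ)]
    have h2 := Digam.digamma_real_le (x := σ / 2) (by linarith)
    have e : ((σ / 2 : ℝ) : ℂ) + 1 = (σ : ℂ) / 2 + 1 := by push_cast; ring
    rw [e] at h2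
    have h3 : ((1 : ℂ) / (σ - 1)).re = 1 / (σ - 1) := by
      have : (1 : ℂ) / (σ - 1) = ((1 / (σ - 1) : ℝ) : ℂ) := by push_cast; rfl
      rw [this, Complex.ofReal_re]
    have h4 : 1 / (2 * (1 + σ / 2)) = 1 / (2 + σ) := by congr 1; ring
    rw [h3]
    rw [h4] at h2
    linarith
  have k1 := H_upper (σ := σ) (v := t) (V := T) hσ hσ2 hg4 hT2
  have k2 := H_upper (σ := σ) (v := 2 * t) (V := 2 * T) hσ hσ2 (by linarith) (by linarith)
  have k3 := H_upper (σ := σ) (v := 3 * t) (V := 3 * T) hσ hσ2 (by linarith) (by linarith)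
  have k4 := H_upper (σ := σ) (v := 4 * t) (V := 4 * T) hσ hσ2 (by linarith) (by linarith)
  have hz0 := H_re_nonneg (s := σ) (by simp; linarith)
  have hz1 := H_ge_four hρ hβ hσ
  rw [← ht] at hz1
  have hz2 := H_re_nonneg (s := σ + (2 * t : ℝ) * I) (by simp; linarith)
  have hz3 := H_re_nonneg (s := σ + (3 * t : ℝ) * I) (by simp; linarith)
  have hz4 := H_re_nonneg (s := σ + (4 * t : ℝ) * I) (by simp; linarith)
  have hvm := VM_comb (t := t) hσ
  have hm : 0.854 ≤ 1 / (σ - 1 + ρ.re) := by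
    rw [le_div_iff₀ (by linarith)]; linarith
  have hT0 : 0 < T := by linarith
  have l1 : Real.log (T / 2) = Real.log T - Real.log 2 := Real.log_div (by positivity) (by norm_num)
  have l2 : Real.log (2 * T / 2) = Real.log T := by congr 1; ring
  have l3 : Real.log (3 * T / 2) = Real.log T + Real.log 3 - Real.log 2 := by
    rw [Real.log_div (by positivity) (by norm_num), Real.log_mul (by norm_num) (by positivity)]; ring
  have l4 : Real.log (4 * T / 2) = Real.log T + Real.log 2 := by
    rw [show 4 * T / 2 = T * 2 by ring, Real.log_mul (by positivity) (by norm_num)]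
  have l13 : Real.log (T / 13) = Real.log T - Real.log 13 := Real.log_div (by positivity) (by norm_num)
  have lσ : Real.log (1 + σ / 2) ≤ 0.4645 := le_trans (Real.log_le_log (by linarith) (by linarith)) log1585
  have lσ2 : 0.315 ≤ 1 / (2 + σ) := by rw [le_div_iff₀ (by linarith)]; linarith
  have m1 := small_aux (k := 1) hg4 hT (by norm_num)
  have m2 := small_aux (k := 2) hg4 hT (by norm_num)
  have m3 := small_aux (k := 3) hg4 hT (by norm_num)
  have m4 := small_aux (k := 4) hg4 hT (by norm_num)
  rw [one_mul, one_mul] at m1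
  rw [l1] at k1; rw [l2] at k2; rw [l3] at k3; rw [l4] at k4; rw [l13]
  have n1 := log3_le
  have n2 := log13_le
  have n3 := logpi_ge
  have n4 := Real.log_two_gt_d9
  have e1 : 19.131392 / (σ - ρ.re) = 19.131392 * (1 / (σ - ρ.re)) := by ring
  have e2 : 11.22218432 / (σ - 1) = 11.22218432 * (1 / (σ - 1)) := by ring
  rw [e1, e2]
  clear_value t
  generalize (logDeriv Xi (σ + (4 * t : ℝ) * I)).re = H4 at *
  generalize (logDeriv Xi (σ + (3 * t : ℝ) * I)).re = H3 at *
  generalize (logDeriv Xi (σ + (2 * t : ℝ) * I)).re = H2 at *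
  generalize (logDeriv Xi (σ + t * I)).re = H1 at *
  generalize (logDeriv Xi σ).re = H0 at *
  have k1' : H1 + (VM (σ + t * I)).re ≤ - Real.log π / 2 + (Real.log T - Real.log 2) / 2 + 0.0393 := by
    linarith
  have k2' : H2 + (VM (σ + (2 * t : ℝ) * I)).re ≤ - Real.log π / 2 + (Real.log T) / 2 + 0.0393 / 2 := by
    linarith
  have k3' : H3 + (VM (σ + (3 * t : ℝ) * I)).re ≤ - Real.log π / 2 + (Real.log T + Real.log 3 - Real.log 2) / 2 + 0.0393 / 3 := by
    linarith
  have k4' : H4 + (VM (σ + (4 * t : ℝ) * I)).re ≤ - Real.log π / 2 + (Real.log T + Real.log 2) / 2 + 0.0393 / 4 := by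
    linarith
  clear k1 k2 k3 k4 m1 m2 m3 m4 l1 l2 l3 l4 l13 e1 e2
  linarith

/-- the zero-free region -/
theorem zero_free {z : ℂ} (hz : Xi z = 0) {T : ℝ} (hT : 40 ≤ T) (hT2 : |z.im| ≤ T) :
    1 / (17.46 * Real.log (T / 13)) ≤ 1 - z.re := by
  have hl : 1.12 ≤ Real.log (T / 13) := by
    have h : Real.log (40 / 13) ≤ Real.log (T / 13) := Real.log_le_log (by norm_num) (by linarith)
    refine le_trans ?_ h
    rw [Real.log_div (by norm_num) (by norm_num)]
    have e : Real.log 40 = 3 * Real.log 2 + Real.log 5 := by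
      rw [show (40:ℝ) = 2 ^ 3 * 5 by norm_num, Real.log_mul (by norm_num) (by norm_num), Real.log_pow]; norm_num
    have h5 : Real.log (2 ^ 65) ≤ Real.log (5 ^ 28) := Real.log_le_log (by norm_num) (by norm_num)
    rw [Real.log_pow, Real.log_pow] at h5
    have := Real.log_two_gt_d9
    have := log13_le
    push_cast at h5
    rw [e]
    linarith
  have hL0 : 0 < Real.log (T / 13) := by linarith
  by_cases hβ : z.re ≤ 1 / 2
  · have : 1 / (17.46 * Real.log (T / 13)) ≤ 1 / 2 := by
      gcongr; linarith
    linarith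
  push Not at hβ
  have main : ∀ ρ : ℂ, Xi ρ = 0 → 1 / 2 < ρ.re → 0 < ρ.im → ρ.im ≤ T →
      1 / (17.46 * Real.log (T / 13)) ≤ 1 - ρ.re := by
    intro ρ hρ hb hg hgT
    obtain ⟨h0, h1⟩ := Xi_zero_re hρ
    set B := 18.297096 * Real.log (T / 13) with hB
    have hB20 : 20.4 ≤ B := by rw [hB]; linarith
    have h := comb_bound hρ hb hg (σ := 1 + 3.42 / B) (by simp; positivity)
      (by
        have : 3.42 / B ≤ 3.42 / 20.4 := by gcongr
        norm_num at *; linarith) hT hgT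
    rw [← hB, add_sub_cancel_left, div_div_eq_mul_div, div_le_iff₀ (by
      have : 0 < 3.42 / B := by positivity
      linarith)] at h
    have hB0 : B ≠ 0 := by positivity
    have h2 : 19.131392 ≤ (11.22218432 / 3.42 + 1) * (B * (1 - ρ.re)) + (11.22218432 + 3.42) := by
      refine h.trans (le_of_eq ?_)
      field_simp
      ring
    have h3 : 1.0485 ≤ B * (1 - ρ.re) := by
      norm_num at h2 ⊢
      linarith
    rw [div_le_iff₀ (by positivity)]
    have : B = 18.297096 * Real.log (T / 13) := hB
    rw [this] at h3
    nlinarith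
  rcases lt_or_ge 0 z.im with hp | hp
  · exact main z hz hβ hp (by rwa [abs_of_pos hp] at hT2)
  · have hne : z.im ≠ 0 := by
      intro h; have := zero_height hz; rw [h] at this; simp at this; linarith
    have hp' : z.im < 0 := lt_of_le_of_ne hp hne
    have := main (starRingEnd ℂ z) (Xi_conj_zero hz) (by simpa using hβ) (by simpa using hp')
      (by rw [abs_of_neg hp'] at hT2; simpa using hT2)
    simpa using this

end ZetaXi

/-! part P6 -/

namespace Expl
open Complex Filter Topology MeasureTheory Set

lemma norm_exp_neg (s : ℂ) (a : ℝ) : ‖cexp (-s * a)‖ = Real.exp (-s.re * a) := by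
  rw [Complex.norm_exp]; simp

lemma lap_integrableOn {f : ℝ → ℂ} (hf : Continuous f) {C : ℝ}
    (hC : ∀ a, 0 ≤ a → ‖f a‖ ≤ C * Real.exp (2 * a)) {s : ℂ} (hs : s.re = 3) :
    IntegrableOn (fun a : ℝ => f a * cexp (-s * a)) (Ioi 0) := by
  have h1 : IntegrableOn (fun a : ℝ => C * Real.exp (-1 * a)) (Ioi 0) :=
    (integrableOn_exp_mul_Ioi (by norm_num) 0).const_mul C
  refine Integrable.mono' h1 ?_ ?_
  · exact (Continuous.aestronglyMeasurable (by fun_prop))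
  · refine (ae_restrict_iff' measurableSet_Ioi).2 (ae_of_all _ fun a ha => ?_)
    rw [norm_mul, norm_exp_neg, hs]
    calc _ ≤ C * Real.exp (2 * a) * Real.exp (-3 * a) := by
          gcongr; exact hC a (le_of_lt ha)
      _ = _ := by rw [mul_assoc, ← Real.exp_add]; ring_nf

lemma lap_prim {f g : ℝ → ℂ} {s : ℂ} (hs : s.re = 3) (hg : ∀ a, HasDerivAt g (f a) a) (g0 : g 0 = 0)
    (hf : Continuous f) {C D : ℝ} (hC : ∀ a, 0 ≤ a → ‖f a‖ ≤ C * Real.exp (2 * a))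
    (hD : ∀ a, 0 ≤ a → ‖g a‖ ≤ D * Real.exp (2 * a)) :
    ∫ a in Ioi (0:ℝ), g a * cexp (-s * a) = (∫ a in Ioi (0:ℝ), f a * cexp (-s * a)) / s := by
  have hs0 : s ≠ 0 := fun h => by rw [h] at hs; simp at hs
  have hgc : Continuous g := continuous_iff_continuousAt.2 fun a => (hg a).continuousAt
  have i1 := lap_integrableOn hf hC hs
  have i2 := lap_integrableOn hgc hD hs
  have hd : ∀ a : ℝ, HasDerivAt (fun a : ℝ => g a * cexp (-s * a))
      (f a * cexp (-s * a) - s * (g a * cexp (-s * a))) a := by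
    intro a
    have h1 : HasDerivAt (fun a : ℝ => cexp (-s * a)) (cexp (-s * a) * (-s * 1)) a := by
      exact ((Complex.ofRealCLM.hasDerivAt (x := a)).const_mul (-s)).cexp
    convert! (hg a).mul h1 using 1
    ring
  have ht : Tendsto (fun a : ℝ => g a * cexp (-s * a)) atTop (𝓝 0) := by
    have h1 : Tendsto (fun a : ℝ => D * Real.exp (-a)) atTop (𝓝 (D * 0)) :=
      tendsto_const_nhds.mul Real.tendsto_exp_neg_atTop_nhds_zero
    rw [mul_zero] at h1
    refine squeeze_zero_norm' ?_ h1
    filter_upwards [eventually_ge_atTop 0] with a ha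
    rw [norm_mul, norm_exp_neg, hs]
    calc _ ≤ D * Real.exp (2 * a) * Real.exp (-3 * a) := by
          gcongr; exact hD a ha
      _ = _ := by rw [mul_assoc, ← Real.exp_add]; ring_nf
  have key := integral_Ioi_of_hasDerivAt_of_tendsto (a := 0) (m := 0) (hd 0).continuousAt.continuousWithinAt
    (fun x _ => hd x) (i1.sub (i2.const_mul s)) ht
  rw [g0, zero_mul, sub_zero, integral_sub i1 (i2.const_mul s), integral_const_mul] at key
  rw [eq_div_iff hs0]
  linear_combination -key

/-- `Good g G`: `g` is supported on `[0,∞)`, continuous, with Laplace transform `G` on `Re s = 3`. -/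
structure Good (g : ℝ → ℂ) (G : ℂ → ℂ) : Prop where
  cont : Continuous g
  zero : ∀ a ≤ 0, g a = 0
  bound : ∃ C, ∀ a, 0 ≤ a → ‖g a‖ ≤ C * Real.exp (2 * a)
  lap : ∀ s : ℂ, s.re = 3 → ∫ a in Ioi (0:ℝ), g a * cexp (-s * a) = G s

lemma Good.integrableOn {g G} (h : Good g G) {s : ℂ} (hs : s.re = 3) :
    IntegrableOn (fun a : ℝ => g a * cexp (-s * a)) (Ioi 0) := by
  obtain ⟨C, hC⟩ := h.bound
  exact lap_integrableOn h.cont hC hs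

lemma Good.add {g g' G G'} (h : Good g G) (h' : Good g' G') :
    Good (fun a => g a + g' a) (fun s => G s + G' s) := by
  obtain ⟨C, hC⟩ := h.bound
  obtain ⟨D, hD⟩ := h'.bound
  refine ⟨h.cont.add h'.cont, fun a ha => by rw [h.zero a ha, h'.zero a ha, add_zero],
    ⟨C + D, fun a ha => (norm_add_le _ _).trans ?_⟩, fun s hs => ?_⟩
  · rw [add_mul]; exact add_le_add (hC a ha) (hD a ha)
  · simp_rw [add_mul]
    rw [integral_add (h.integrableOn hs) (h'.integrableOn hs), h.lap s hs, h'.lap s hs]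

lemma Good.const_mul {g G} (h : Good g G) (k : ℂ) :
    Good (fun a => k * g a) (fun s => k * G s) := by
  obtain ⟨C, hC⟩ := h.bound
  refine ⟨continuous_const.mul h.cont, fun a ha => by rw [h.zero a ha, mul_zero],
    ⟨‖k‖ * C, fun a ha => ?_⟩, fun s hs => ?_⟩
  · rw [norm_mul, mul_assoc]; gcongr; exact hC a ha
  · simp_rw [mul_assoc]
    rw [integral_const_mul, h.lap s hs]

lemma Good.congr {g G G'} (h : Good g G) (e : ∀ s : ℂ, s.re = 3 → G s = G' s) : Good g G' :=
  ⟨h.cont, h.zero, h.bound, fun s hs => by rw [h.lap s hs, e s hs]⟩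

lemma Good.congr_left {g g' G} (h : Good g G) (e : ∀ a, g a = g' a) : Good g' G := by
  rwa [← funext e]

lemma Good.tsum {ι : Type} {g : ι → ℝ → ℂ} {G : ι → ℂ → ℂ} {u : ι → ℝ} (h : ∀ i, Good (g i) (G i))
    (hu : Summable u) (hb : ∀ i a, 0 ≤ a → ‖g i a‖ ≤ u i * Real.exp (2 * a)) :
    Good (fun a => ∑' i, g i a) (fun s => ∑' i, G i s) := by
  have hb' : ∀ i a, ‖g i a‖ ≤ u i * Real.exp (2 * a) := by
    intro i a
    rcases le_total 0 a with ha | ha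
    · exact hb i a ha
    · rw [(h i).zero a ha, norm_zero]
      have := (norm_nonneg _).trans (hb i 0 le_rfl)
      rw [mul_zero, Real.exp_zero, mul_one] at this
      positivity
  have hsum : ∀ a, Summable (fun i => g i a) := fun a =>
    Summable.of_norm_bounded (hu.mul_right _) (fun i => hb' i a)
  have hu0 : ∀ i, 0 ≤ u i := fun i => by
    have := (norm_nonneg _).trans (hb i 0 le_rfl)
    rwa [mul_zero, Real.exp_zero, mul_one] at this
  refine ⟨?_, fun a ha => ?_, ⟨∑' i, u i, fun a ha => ?_⟩, fun s hs => ?_⟩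
  · have h1 : Continuous (fun a : ℝ => ∑' i, g i a * cexp (-2 * a)) := by
      refine continuous_tsum (fun i => (h i).cont.mul (by fun_prop)) hu fun i a => ?_
      rw [norm_mul, norm_exp_neg]
      calc _ ≤ u i * Real.exp (2 * a) * Real.exp (-(2:ℂ).re * a) := by
            gcongr; exact hb' i a
        _ = _ := by rw [mul_assoc, ← Real.exp_add]; simp
    have h2 : Continuous (fun a : ℝ => (∑' i, g i a * cexp (-2 * a)) * cexp (2 * a)) :=
      h1.mul (by fun_prop)
    convert! h2 using 1
    funext a
    rw [tsum_mul_right, mul_assoc, ← Complex.exp_add]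
    simp
  · simp [fun i => (h i).zero a ha]
  · refine (norm_tsum_le_tsum_norm (hsum a).norm).trans ?_
    rw [← tsum_mul_right]
    exact (hsum a).norm.tsum_le_tsum (fun i => hb i a ha) (hu.mul_right _)
  · have hcount : Countable (Function.support u) := hu.countable_support.to_subtype
    have hz : ∀ i, i ∉ Function.support u → ∀ a, g i a = 0 := by
      intro i hi a
      rw [Function.notMem_support] at hi
      have := hb' i a
      rw [hi, zero_mul] at this
      exact norm_le_zero_iff.1 this
    have hGz : ∀ i, i ∉ Function.support u → G i s = 0 := by
      intro i hi
      rw [← (h i).lap s hs]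
      simp [hz i hi]
    have e1 : ∀ a, ∑' i, g i a = ∑' i : Function.support u, g i a := fun a =>
      (tsum_subtype_eq_of_support_subset (by
        intro i hi; by_contra h'; exact hi (hz i h' a))).symm
    have e2 : ∑' i, G i s = ∑' i : Function.support u, G i s :=
      (tsum_subtype_eq_of_support_subset (by
        intro i hi; by_contra h'; exact hi (hGz i h'))).symm
    have husub : Summable (fun i : Function.support u => u i) := hu.subtype _
    have key := hasSum_integral_of_dominated_convergence (μ := volume.restrict (Ioi (0:ℝ)))
      (F := fun (i : Function.support u) (a : ℝ) => g i a * cexp (-s * a))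
      (f := fun a => (∑' i, g i a) * cexp (-s * a))
      (fun i a => u i * Real.exp (-1 * a))
      (fun i => ((h i).cont.mul (by fun_prop)).aestronglyMeasurable)
      (fun i => ?_) (ae_of_all _ fun a => husub.mul_right _) ?_ (ae_of_all _ fun a => ?_)
    · rw [← key.tsum_eq, e2]
      exact tsum_congr fun i => (h i).lap s hs
    · refine (ae_restrict_iff' measurableSet_Ioi).2 (ae_of_all _ fun a ha => ?_)
      rw [norm_mul, norm_exp_neg, hs]
      calc _ ≤ u i * Real.exp (2 * a) * Real.exp (-3 * a) := by
            gcongr; exact hb' i a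
        _ = _ := by rw [mul_assoc, ← Real.exp_add]; ring_nf
    · simp_rw [tsum_mul_right]
      exact (integrableOn_exp_mul_Ioi (by norm_num) 0).const_mul _
    · rw [e1]
      exact ((hsum a).subtype _).hasSum.mul_right _

open FourierTransform in
theorem Good.unique {g g' G} (h : Good g G) (h' : Good g' G) : g = g' := by
  have hd : Good (fun a => g a + (-1) * g' a) (fun s => G s + (-1) * G s) := h.add (h'.const_mul (-1))
  set F : ℝ → ℂ := fun a => (g a + (-1) * g' a) * cexp (-3 * a) with hF
  have hFc : Continuous F := hd.cont.mul (by fun_prop)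
  have hsupp : ∀ a, a ∉ Ioi (0:ℝ) → F a = 0 := by
    intro a ha
    simp only [mem_Ioi, not_lt] at ha
    have := hd.zero a ha
    rw [hF]; simp only; rw [this, zero_mul]
  have hi : Integrable F := by
    have := hd.integrableOn (s := 3) (by simp)
    exact (integrableOn_iff_integrable_of_support_subset (fun a ha => by
      by_contra h2; exact ha (hsupp a h2))).1 this
  have hFT : 𝓕 F = 0 := by
    funext w
    rw [Real.fourier_real_eq_integral_exp_smul]
    have e : ∀ a : ℝ, cexp (((-2 * π * a * w : ℝ) : ℂ) * I) • F a
        = (g a + (-1) * g' a) * cexp (-(3 + 2 * π * w * I : ℂ) * a) := by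
      intro a
      rw [hF, smul_eq_mul]
      simp only
      rw [mul_comm, mul_assoc, ← Complex.exp_add]
      congr 2
      push_cast; ring
    have := hd.lap (3 + 2 * π * w * I) (by simp)
    rw [← setIntegral_eq_integral_of_forall_compl_eq_zero (s := Ioi (0:ℝ))]
    · simp_rw [e]
      rw [this]; simp
    · intro a ha
      rw [hsupp a ha, smul_zero]
  have := hFc.fourierInv_fourier_eq hi (by rw [hFT]; exact integrable_zero _ _ _)
  rw [hFT] at this
  funext a
  have h2 : F a = 0 := by
    rw [← this, Real.fourierInv_eq]
    simp
  rw [hF] at h2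
  have h3 := (mul_eq_zero.1 h2).resolve_right (Complex.exp_ne_zero _)
  linear_combination h3

end Expl

/-! part P61 -/

namespace Expl
open Complex Filter Topology MeasureTheory Set

noncomputable def e1 (c : ℂ) (a : ℝ) : ℂ := (cexp (c * a) - 1) / c
noncomputable def e2 (c : ℂ) (a : ℝ) : ℂ := (e1 c a - a) / c
noncomputable def e3 (c : ℂ) (a : ℝ) : ℂ := (e2 c a - a ^ 2 / 2) / c
noncomputable def Lf (c : ℂ) (a : ℝ) : ℂ := e3 c (max a 0)
noncomputable def Q (a : ℝ) : ℂ := ((max a 0 : ℝ) : ℂ) ^ 2 / 2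

lemma hd0 (c : ℂ) (a : ℝ) : HasDerivAt (fun a : ℝ => cexp (c * a)) (c * cexp (c * a)) a := by
  have h1 : HasDerivAt (fun a : ℝ => cexp (c * a)) (cexp (c * a) * (c * 1)) a := by
    exact ((Complex.ofRealCLM.hasDerivAt (x := a)).const_mul c).cexp
  convert! h1 using 1; ring

lemma hdid (a : ℝ) : HasDerivAt (fun a : ℝ => (a : ℂ)) 1 a := Complex.ofRealCLM.hasDerivAt

lemma hdsq (a : ℝ) : HasDerivAt (fun a : ℝ => (a : ℂ) ^ 2 / 2) (a : ℂ) a := by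
  convert! ((hdid a).pow 2).div_const 2 using 1; simp

lemma hd1 {c : ℂ} (hc : c ≠ 0) (a : ℝ) : HasDerivAt (e1 c) (cexp (c * a)) a := by
  convert! ((hd0 c a).sub_const 1).div_const c using 1; field_simp

lemma hd2 {c : ℂ} (hc : c ≠ 0) (a : ℝ) : HasDerivAt (e2 c) (e1 c a) a := by
  convert! ((hd1 hc a).sub (hdid a)).div_const c using 1

lemma hd3 {c : ℂ} (hc : c ≠ 0) (a : ℝ) : HasDerivAt (e3 c) (e2 c a) a := by
  convert! ((hd2 hc a).sub (hdsq a)).div_const c using 1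

lemma le_exp_two {a : ℝ} : a ≤ Real.exp (2 * a) / 2 := by
  have := Real.add_one_le_exp (2 * a); linarith

lemma sq_le_exp_two {a : ℝ} (ha : 0 ≤ a) : a ^ 2 / 2 ≤ Real.exp (2 * a) / 2 := by
  have := Real.quadratic_le_exp_of_nonneg (x := 2 * a) (by linarith); nlinarith

lemma norm_e0 {c : ℂ} (hc : c.re ≤ 1) {a : ℝ} (ha : 0 ≤ a) : ‖cexp (c * a)‖ ≤ 1 * Real.exp (2 * a) := by
  rw [Complex.norm_exp]; simp; nlinarith

lemma one_le_e {a : ℝ} (ha : 0 ≤ a) : 1 ≤ Real.exp (2 * a) := Real.one_le_exp (by linarith)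

lemma norm_e1 {c : ℂ} (hc : c.re ≤ 1) {a : ℝ} (ha : 0 ≤ a) :
    ‖e1 c a‖ ≤ 2 / ‖c‖ * Real.exp (2 * a) := by
  rw [e1, norm_div, div_mul_eq_mul_div]
  gcongr
  refine (norm_sub_le _ _).trans ?_
  have := norm_e0 hc ha; have := one_le_e ha
  simp only [norm_one]; linarith

lemma norm_e2 {c : ℂ} (hc : c.re ≤ 1) {a : ℝ} (ha : 0 ≤ a) :
    ‖e2 c a‖ ≤ (2 / ‖c‖ + 1) / ‖c‖ * Real.exp (2 * a) := by
  rw [e2, norm_div, div_mul_eq_mul_div]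
  gcongr
  refine (norm_sub_le _ _).trans ?_
  have := norm_e1 hc ha; have := le_exp_two (a := a); have := one_le_e ha
  rw [Complex.norm_real, Real.norm_of_nonneg ha]; linarith

lemma norm_sq_half {a : ℝ} (ha : 0 ≤ a) : ‖(a : ℂ) ^ 2 / 2‖ = a ^ 2 / 2 := by
  rw [norm_div, norm_pow, Complex.norm_real, Real.norm_of_nonneg ha]; simp

lemma norm_e3 {c : ℂ} (hc : c.re ≤ 1) {a : ℝ} (ha : 0 ≤ a) :
    ‖e3 c a‖ ≤ ((2 / ‖c‖ + 1) / ‖c‖ + 1) / ‖c‖ * Real.exp (2 * a) := by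
  rw [e3, norm_div, div_mul_eq_mul_div]
  gcongr
  refine (norm_sub_le _ _).trans ?_
  have := norm_e2 hc ha; have := sq_le_exp_two ha; have := one_le_e ha
  rw [norm_sq_half ha]; linarith

lemma lap_exp {c s : ℂ} (hc : c.re ≤ 1) (hs : s.re = 3) :
    ∫ a in Ioi (0:ℝ), cexp (c * a) * cexp (-s * a) = 1 / (s - c) := by
  have h := integral_exp_mul_complex_Ioi (a := c - s) (by simp [hs]; linarith) 0
  simp only [← Complex.exp_add, ← add_mul, ← sub_eq_add_neg]
  rw [h]; simp
  rw [← neg_sub, neg_div_neg_eq, one_div]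

lemma ne_zero_of_re3 {s : ℂ} (hs : s.re = 3) : s ≠ 0 := fun h => by rw [h] at hs; simp at hs

lemma good_Lf {c : ℂ} (hc0 : c ≠ 0) (hc : c.re ≤ 1) : Good (Lf c) (fun s => 1 / ((s - c) * s ^ 3)) := by
  have hc3 : Continuous (e3 c) := continuous_iff_continuousAt.2 fun a => (hd3 hc0 a).continuousAt
  have hc2 : Continuous (e2 c) := continuous_iff_continuousAt.2 fun a => (hd2 hc0 a).continuousAt
  have hc1 : Continuous (e1 c) := continuous_iff_continuousAt.2 fun a => (hd1 hc0 a).continuousAt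
  refine ⟨hc3.comp (by fun_prop), fun a ha => by simp [Lf, max_eq_right ha, e3, e2, e1],
    ⟨((2 / ‖c‖ + 1) / ‖c‖ + 1) / ‖c‖, fun a ha => ?_⟩, fun s hs => ?_⟩
  · rw [Lf, max_eq_left ha]; exact norm_e3 hc ha
  · have : ∫ a in Ioi (0:ℝ), Lf c a * cexp (-s * a) = ∫ a in Ioi (0:ℝ), e3 c a * cexp (-s * a) :=
      setIntegral_congr_fun measurableSet_Ioi fun a ha => by
        rw [mem_Ioi] at ha
        simp only [Lf]; rw [max_eq_left ha.le]
    rw [this, lap_prim hs (hd3 hc0) (by simp [e3, e2, e1]) hc2 (fun a => norm_e2 hc) (fun a => norm_e3 hc),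
      lap_prim hs (hd2 hc0) (by simp [e2, e1]) hc1 (fun a => norm_e1 hc) (fun a => norm_e2 hc),
      lap_prim hs (hd1 hc0) (by simp [e1]) (by fun_prop) (fun a => norm_e0 hc) (fun a => norm_e1 hc),
      lap_exp hc hs]
    have := ne_zero_of_re3 hs
    field_simp

lemma norm_Q_le {a : ℝ} (ha : 0 ≤ a) : ‖Q a‖ ≤ 1 * Real.exp (2 * a) := by
  rw [Q, max_eq_left ha, norm_sq_half ha]
  have := sq_le_exp_two ha; have := one_le_e ha; linarith

lemma good_Q : Good Q (fun s => 1 / s ^ 3) := by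
  refine ⟨by unfold Q; fun_prop, fun a ha => by simp [Q, max_eq_right ha], ⟨1, fun a ha => norm_Q_le ha⟩, fun s hs => ?_⟩
  have : ∫ a in Ioi (0:ℝ), Q a * cexp (-s * a) = ∫ a in Ioi (0:ℝ), ((a:ℂ)^2/2) * cexp (-s * a) :=
    setIntegral_congr_fun measurableSet_Ioi fun a ha => by
      rw [mem_Ioi] at ha
      simp only [Q]; rw [max_eq_left ha.le]
  have b1 : ∀ a : ℝ, 0 ≤ a → ‖(a:ℂ)‖ ≤ 1 * Real.exp (2 * a) := fun a ha => by
    rw [Complex.norm_real, Real.norm_of_nonneg ha]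
    have := le_exp_two (a := a); have := one_le_e ha; linarith
  rw [this, lap_prim hs hdsq (by simp) (by fun_prop) b1 (fun a ha => by
      have := norm_Q_le ha; rwa [Q, max_eq_left ha] at this),
    lap_prim hs hdid (by simp) (by fun_prop) (C := 1) (fun a ha => by simpa using ha) b1]
  have := lap_exp (c := 0) (by simp) hs
  simp only [zero_mul, Complex.exp_zero, sub_zero] at this
  rw [this]
  have := ne_zero_of_re3 hs
  field_simp

lemma Good.shift {g G} (h : Good g G) {t : ℝ} (ht : 0 ≤ t) :
    Good (fun a => g (a - t)) (fun s => cexp (-s * t) * G s) := by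
  obtain ⟨C, hC⟩ := h.bound
  have hC0 : 0 ≤ C := by simpa using (norm_nonneg _).trans (hC 0 le_rfl)
  have full : ∀ s : ℂ, ∀ g : ℝ → ℂ, (∀ a ≤ 0, g a = 0) →
      ∫ a in Ioi (0:ℝ), g a * cexp (-s * a) = ∫ a, g a * cexp (-s * a) := by
    intro s g hg
    refine setIntegral_eq_integral_of_forall_compl_eq_zero fun a ha => ?_
    rw [mem_Ioi, not_lt] at ha
    rw [hg a ha, zero_mul]
  have z : ∀ a ≤ 0, g (a - t) = 0 := fun a ha => h.zero _ (by linarith)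
  refine ⟨h.cont.comp (by fun_prop), z, ⟨C, fun a ha => ?_⟩, fun s hs => ?_⟩
  · rcases le_total a t with h1 | h1
    · rw [h.zero _ (by linarith), norm_zero]; positivity
    · refine (hC _ (by linarith)).trans ?_
      gcongr; linarith
  · rw [full s _ z, ← h.lap s hs, full s g h.zero, ← integral_const_mul,
      ← integral_sub_right_eq_self (fun a : ℝ => cexp (-s * t) * (g a * cexp (-s * a))) t]
    congr 1; funext a
    rw [mul_left_comm, ← Complex.exp_add]
    push_cast; ring_nf

end Expl

/-! part P62 -/

namespace Expl
open Complex Filter Topology MeasureTheory Set ZetaXi Digam ArithmeticFunction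

lemma norm_Q_le' (a : ℝ) : ‖Q a‖ ≤ Real.exp (2 * a) := by
  rcases le_total 0 a with h | h
  · simpa using norm_Q_le h
  · rw [good_Q.zero a h, norm_zero]; positivity

/-! Λ-side -/
lemma vm_bound (n : ℕ) (a : ℝ) :
    ‖(vonMangoldt n : ℂ) * Q (a - Real.log n)‖ ≤ (vonMangoldt n / (n:ℝ) ^ 2) * Real.exp (2 * a) := by
  rcases Nat.eq_zero_or_pos n with h | h
  · subst h; simp
  · rw [norm_mul, Complex.norm_real, Real.norm_of_nonneg vonMangoldt_nonneg]
    have h0 : (0:ℝ) < n := by exact_mod_cast h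
    have := norm_Q_le' (a - Real.log n)
    have e : Real.exp (2 * (a - Real.log n)) = Real.exp (2 * a) / (n:ℝ) ^ 2 := by
      rw [mul_sub, Real.exp_sub, mul_comm 2 (Real.log n), Real.exp_mul (Real.log n), Real.exp_log h0]; norm_num
    rw [e] at this
    calc _ ≤ vonMangoldt n * (Real.exp (2 * a) / (n:ℝ) ^ 2) := by
            gcongr
      _ = _ := by ring

lemma vm_summable : Summable (fun n : ℕ => vonMangoldt n / (n:ℝ) ^ 2) := by
  have h := LSeriesSummable_vonMangoldt (s := 2) (by norm_num)
  have h2 := h.norm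
  refine h2.congr fun n => ?_
  rcases Nat.eq_zero_or_pos n with h | h
  · subst h; simp
  · rw [LSeries.term_of_ne_zero h.ne', norm_div, Complex.norm_real, Real.norm_of_nonneg vonMangoldt_nonneg]
    congr 1
    norm_num

lemma good_vm_term (n : ℕ) : Good (fun a => (vonMangoldt n : ℂ) * Q (a - Real.log n))
    (fun s => LSeries.term (fun n => (vonMangoldt n : ℂ)) s n * (1 / s ^ 3)) := by
  have h := (good_Q.shift (t := Real.log n) (Real.log_natCast_nonneg n)).const_mul (vonMangoldt n : ℂ)
  refine h.congr fun s hs => ?_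
  rcases Nat.eq_zero_or_pos n with h | h
  · subst h; simp
  · rw [LSeries.term_of_ne_zero h.ne', Complex.cpow_def_of_ne_zero (by exact_mod_cast h.ne'), div_eq_mul_inv _ (cexp _),
      ← Complex.exp_neg, ← Complex.natCast_log, mul_assoc]
    congr 3
    ring

noncomputable def WL (a : ℝ) : ℂ := ∑' n : ℕ, (vonMangoldt n : ℂ) * Q (a - Real.log n)

lemma good_WL : Good WL (fun s => VM s * (1 / s ^ 3)) := by
  have := Good.tsum good_vm_term vm_summable (fun n a _ => vm_bound n a)
  exact this.congr fun s hs => by rw [tsum_mul_right]; rfl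

/-! trivial zeros -/
noncomputable def tc (n : ℕ) : ℂ := -(2 * (n + 1))

lemma tc_ne (n : ℕ) : tc n ≠ 0 := by
  unfold tc
  have : (n + 1 : ℂ) ≠ 0 := by exact_mod_cast n.succ_ne_zero
  simpa using this

lemma tc_re (n : ℕ) : (tc n).re = -(2 * (n + 1)) := by simp [tc]

lemma tc_norm (n : ℕ) : ‖tc n‖ = 2 * (n + 1) := by
  have : tc n = ((-(2 * (n + 1)) : ℝ) : ℂ) := by simp [tc]
  rw [this, Complex.norm_real, Real.norm_eq_abs, abs_neg, abs_of_nonneg (by positivity)]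

noncomputable def triv (n : ℕ) (a : ℝ) : ℂ := (lg n / 2 : ℂ) * Q a + (-1) * Lf (tc n) a

lemma Lf_expand {c : ℂ} (hc : c ≠ 0) {a : ℝ} (ha : 0 ≤ a) :
    Lf c a = (cexp (c * a) - 1) / c ^ 3 - a / c ^ 2 - a ^ 2 / 2 / c := by
  rw [Lf, max_eq_left ha, e3, e2, e1]; field_simp

lemma Q_eq {a : ℝ} (ha : 0 ≤ a) : Q a = (a:ℂ) ^ 2 / 2 := by rw [Q, max_eq_left ha]

lemma triv_expand (n : ℕ) {a : ℝ} (ha : 0 ≤ a) :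
    triv n a = ((lg n / 2 - 1 / (2 * (n + 1)) : ℝ) : ℂ) * (a ^ 2 / 2) - (cexp (tc n * a) - 1) / (tc n) ^ 3
      + a / (tc n) ^ 2 := by
  rw [triv, Lf_expand (tc_ne n) ha, Q_eq ha]
  have : ((1 / (2 * (n + 1)) : ℝ) : ℂ) = - (1 / tc n) := by
    simp [tc, neg_inv]
  push_cast at this ⊢
  rw [this]
  ring

lemma k_bound (n : ℕ) : |lg n / 2 - 1 / (2 * (n + 1))| ≤ 1 / (n + 1 : ℝ) ^ 2 := by
  have h1 := lg_le n
  have h2 := le_lg n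
  have e : 1 / (2 * (n + 1) : ℝ) = (1 / (n + 1)) / 2 := by field_simp
  have h3 : 1 / (n + 1 : ℝ) - 1 / (n + 2) ≤ 1 / (n + 1 : ℝ) ^ 2 := by
    rw [div_sub_div _ _ (by positivity) (by positivity), div_le_div_iff₀ (by positivity) (by positivity)]
    nlinarith [(Nat.cast_nonneg n : (0:ℝ) ≤ n)]
  have h4 : 0 ≤ 1 / (n + 1 : ℝ) ^ 2 := by positivity
  rw [e, abs_le]; constructor <;> linarith

lemma triv_bound (n : ℕ) {a : ℝ} (ha : 0 ≤ a) : ‖triv n a‖ ≤ (3 * (1 / (n + 1 : ℝ) ^ 2)) * Real.exp (2 * a) := by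
  rw [triv_expand n ha]
  refine (norm_add_le _ _).trans ?_
  refine (add_le_add_left (norm_sub_le _ _) _).trans ?_
  have hn : (1:ℝ) ≤ n + 1 := by linarith [(Nat.cast_nonneg n : (0:ℝ) ≤ n)]
  have E := one_le_e ha
  have t1 : ‖((lg n / 2 - 1 / (2 * (n + 1)) : ℝ) : ℂ) * ((a:ℂ) ^ 2 / 2)‖ ≤ (1 / (n + 1 : ℝ) ^ 2) * Real.exp (2 * a) := by
    rw [norm_mul, norm_sq_half ha, Complex.norm_real]
    have := sq_le_exp_two ha
    exact mul_le_mul (k_bound n) (by linarith) (by positivity) (by positivity)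
  have t2 : ‖(cexp (tc n * a) - 1) / (tc n) ^ 3‖ ≤ (1 / (n + 1 : ℝ) ^ 2) * Real.exp (2 * a) := by
    rw [norm_div, norm_pow, tc_norm, div_le_iff₀ (by positivity)]
    have h1 : ‖cexp (tc n * a) - 1‖ ≤ 2 * Real.exp (2 * a) := by
      refine (norm_sub_le _ _).trans ?_
      have := norm_e0 (c := tc n) (by rw [tc_re]; linarith) ha
      simp only [norm_one]; linarith
    refine h1.trans ?_
    have : 1 / (n + 1 : ℝ) ^ 2 * Real.exp (2 * a) * (2 * (n + 1)) ^ 3 = 8 * (n + 1) * Real.exp (2 * a) := by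
      field_simp; norm_num
    rw [this]
    nlinarith
  have t3 : ‖(a:ℂ) / (tc n) ^ 2‖ ≤ (1 / (n + 1 : ℝ) ^ 2) * Real.exp (2 * a) := by
    rw [norm_div, norm_pow, tc_norm, div_le_iff₀ (by positivity), Complex.norm_real, Real.norm_of_nonneg ha]
    have : 1 / (n + 1 : ℝ) ^ 2 * Real.exp (2 * a) * (2 * (n + 1)) ^ 2 = 4 * Real.exp (2 * a) := by
      field_simp; norm_num
    rw [this]
    have := le_exp_two (a := a); linarith
  linarith

lemma good_triv_term (n : ℕ) : Good (triv n) (fun s => ((lg n / 2 : ℂ) - 1 / (2 * (n + 1) + s)) * (1 / s ^ 3)) := by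
  refine ((good_Q.const_mul _).add ((good_Lf (tc_ne n) (by rw [tc_re]; linarith [(Nat.cast_nonneg n : (0:ℝ) ≤ n)])).const_mul (-1))).congr
    fun s hs => ?_
  have : s - tc n = 2 * (n + 1) + s := by rw [tc]; ring
  rw [this, ← one_div_mul_one_div]
  ring

lemma good_triv : Good (fun a => ∑' n, triv n a)
    (fun s => (logDeriv Xi s - 1/(s-1) + Real.log π/2 + VM s) * (1 / s ^ 3)) := by
  refine (Good.tsum good_triv_term (summable_u 3) (fun n a ha => triv_bound n ha)).congr fun s hs => ?_
  rw [tsum_mul_right, (Digam.logDeriv_Xi (s := s) (by rw [hs]; norm_num)).tsum_eq]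
  rfl

/-! nontrivial zeros -/
noncomputable def zt (z : ℂ) (a : ℝ) : ℂ := (mu z : ℂ) * (Lf z a + Lf (1 - z) a)

lemma zero_ne {z : ℂ} (hz : Xi z = 0) : z ≠ 0 ∧ 1 - z ≠ 0 := by
  obtain ⟨h1, h2⟩ := Xi_zero_re hz
  constructor
  · intro h; rw [h] at h1; simp at h1
  · intro h
    have : z = 1 := by linear_combination -h
    rw [this] at h2; simp at h2

lemma zt_expand {z : ℂ} (hz : Xi z = 0) {a : ℝ} (ha : 0 ≤ a) :
    Lf z a + Lf (1 - z) a = (cexp (z * a) - 1) / z ^ 3 + (cexp ((1 - z) * a) - 1) / (1 - z) ^ 3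
      - a / z ^ 2 - a / (1 - z) ^ 2 - a ^ 2 / 2 / (z * (1 - z)) := by
  obtain ⟨h1, h2⟩ := zero_ne hz
  rw [Lf_expand h1 ha, Lf_expand h2 ha]
  have : (a:ℂ) ^ 2 / 2 / (z * (1 - z)) = a ^ 2 / 2 / z + a ^ 2 / 2 / (1 - z) := by
    field_simp; ring
  rw [this]; ring

lemma im_le_norm {z : ℂ} : |z.im| ≤ ‖z‖ ∧ |z.im| ≤ ‖1 - z‖ := by
  refine ⟨Complex.abs_im_le_norm z, ?_⟩
  simpa using Complex.abs_im_le_norm (1 - z)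

lemma zt_bound (z : ℂ) {a : ℝ} (ha : 0 ≤ a) :
    ‖zt z a‖ ≤ (4 * ((mu z : ℝ) / (1 + ‖z‖ ^ 2))) * Real.exp (2 * a) := by
  by_cases hz : Xi z = 0
  swap
  · have : mu z = 0 := (mu_eq_zero_iff z).2 hz
    simp [zt, this]
  have hg := zero_height hz
  obtain ⟨r0, r1⟩ := Xi_zero_re hz
  obtain ⟨n1, n2⟩ := im_le_norm (z := z)
  set t := |z.im| with ht
  have E := one_le_e ha
  have t0 : 0 < t := by linarith
  have hN : ‖z‖ ^ 2 = z.re ^ 2 + t ^ 2 := by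
    rw [← Complex.normSq_eq_norm_sq, Complex.normSq_apply, ht, sq_abs]; ring
  have b1 : ∀ c : ℂ, c.re ≤ 1 → t ≤ ‖c‖ → ‖(cexp (c * a) - 1) / c ^ 3‖ ≤ 1 / t ^ 2 / 2 * Real.exp (2 * a) := by
    intro c hc hcn
    rw [norm_div, norm_pow]
    have h1 : ‖cexp (c * a) - 1‖ ≤ 2 * Real.exp (2 * a) := by
      refine (norm_sub_le _ _).trans ?_
      have := norm_e0 hc ha
      simp only [norm_one]; linarith
    calc _ ≤ 2 * Real.exp (2 * a) / t ^ 3 := by gcongr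
      _ ≤ 2 * Real.exp (2 * a) / (4 * t ^ 2) := by
          gcongr
          nlinarith [sq_nonneg t]
      _ = _ := by ring
  have b2 : ∀ c : ℂ, t ≤ ‖c‖ → ‖(a:ℂ) / c ^ 2‖ ≤ 1 / t ^ 2 / 2 * Real.exp (2 * a) := by
    intro c hcn
    rw [norm_div, norm_pow, Complex.norm_real, Real.norm_of_nonneg ha]
    calc _ ≤ (Real.exp (2 * a) / 2) / t ^ 2 := by gcongr; exact le_exp_two
      _ = _ := by ring
  have b3 : ‖(a:ℂ) ^ 2 / 2 / (z * (1 - z))‖ ≤ 1 / t ^ 2 / 2 * Real.exp (2 * a) := by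
    rw [norm_div, norm_sq_half ha, norm_mul]
    calc _ ≤ (Real.exp (2 * a) / 2) / (t * t) := by gcongr ?_ / (?_ * ?_); exact sq_le_exp_two ha
      _ = _ := by field_simp
  have tot : ‖Lf z a + Lf (1 - z) a‖ ≤ 5 / 2 / t ^ 2 * Real.exp (2 * a) := by
    rw [zt_expand hz ha]
    refine (norm_sub_le _ _).trans ?_
    refine (add_le_add_left ((norm_sub_le _ _).trans (add_le_add_left ((norm_sub_le _ _).trans
      (add_le_add_left (norm_add_le _ _) _)) _)) _).trans ?_
    have := b1 z r1.le n1
    have := b1 (1 - z) (by simp; linarith) n2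
    have := b2 z n1
    have := b2 (1 - z) n2
    have e : 5 / 2 / t ^ 2 * Real.exp (2 * a) = 5 * (1 / t ^ 2 / 2 * Real.exp (2 * a)) := by ring
    rw [e]; linarith
  rw [zt, norm_mul, Complex.norm_natCast]
  calc _ ≤ (mu z : ℝ) * (5 / 2 / t ^ 2 * Real.exp (2 * a)) := by gcongr
    _ ≤ (mu z : ℝ) * (4 / (1 + ‖z‖ ^ 2) * Real.exp (2 * a)) := by
        gcongr (mu z : ℝ) * (?_ * _)
        rw [div_le_div_iff₀ (by positivity) (by positivity), hN]
        nlinarith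
    _ = _ := by ring

lemma good_zt (z : ℂ) : Good (zt z) (fun s => ((mu z:ℂ)*(1/(s-z)+1/(s-1+z))) * (1 / s ^ 3)) := by
  by_cases hz : Xi z = 0
  swap
  · have : mu z = 0 := (mu_eq_zero_iff z).2 hz
    have h0 := good_Q.const_mul 0
    refine (h0.congr_left fun a => ?_).congr fun s hs => ?_ <;> simp [zt, this]
  obtain ⟨r0, r1⟩ := Xi_zero_re hz
  obtain ⟨h1, h2⟩ := zero_ne hz
  refine (((good_Lf h1 r1.le).add (good_Lf h2 (by simp; linarith))).const_mul (mu z : ℂ)).congr fun s hs => ?_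
  have : s - (1 - z) = s - 1 + z := by ring
  rw [this, ← one_div_mul_one_div, ← one_div_mul_one_div]
  ring

lemma summable_zt_bound : Summable (fun z : ℂ => 4 * ((mu z : ℝ) / (1 + ‖z‖ ^ 2))) := summable_mu.mul_left 4

lemma good_zeros : Good (fun a => ∑' z, zt z a) (fun s => 2 * logDeriv Xi s * (1 / s ^ 3)) := by
  refine (Good.tsum good_zt summable_zt_bound (fun z a ha => zt_bound z ha)).congr fun s hs => ?_
  rw [tsum_mul_right, (hasSum_H (Xi_ne_zero_of_one_le_re (by rw [hs]; norm_num))).tsum_eq]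

theorem explicit (a : ℝ) : WL a = Lf 1 a + (-(Real.log π/2)) * Q a + ∑' n, triv n a + (-(1/2)) * ∑' z, zt z a := by
  have h := ((good_Lf (c := 1) one_ne_zero (by simp)).add (good_Q.const_mul (-(Real.log π/2)))).add good_triv |>.add
    (good_zeros.const_mul (-(1/2)))
  refine congrFun (good_WL.unique (h.congr fun s hs => ?_)) a
  have hs0 := ne_zero_of_re3 hs
  have hs1 : s - 1 ≠ 0 := fun h => by
    have : (s - 1).re = 0 := by rw [h]; simp
    simp [hs] at this
    norm_num at this
  field_simp
  ring

end Expl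

/-! part P7 -/

namespace Expl
open Complex Filter Topology MeasureTheory Set ZetaXi Digam ArithmeticFunction

noncomputable def dd (f : ℝ → ℂ) (u h : ℝ) : ℂ := f (u + 2 * h) - 2 * f (u + h) + f u

lemma dd_Q {u h : ℝ} (hu : 0 ≤ u) (hh : 0 ≤ h) : dd Q u h = h ^ 2 := by
  rw [dd, Q_eq hu, Q_eq (by linarith), Q_eq (by linarith)]; push_cast; ring

lemma dd_Lf {c : ℂ} (hc : c ≠ 0) {u h : ℝ} (hu : 0 ≤ u) (hh : 0 ≤ h) :
    dd (Lf c) u h = cexp (c * u) * (cexp (c * h) - 1) ^ 2 / c ^ 3 - h ^ 2 / c := by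
  rw [dd, Lf_expand hc hu, Lf_expand hc (by linarith), Lf_expand hc (by linarith)]
  have e1 : cexp (c * ↑(u + 2 * h)) = cexp (c * u) * cexp (c * h) ^ 2 := by
    rw [← Complex.exp_nat_mul, ← Complex.exp_add]; push_cast; ring_nf
  have e2 : cexp (c * ↑(u + h)) = cexp (c * u) * cexp (c * h) := by
    rw [← Complex.exp_add]; push_cast; ring_nf
  rw [e1, e2]; push_cast; field_simp; ring

lemma hasSum_dd {ι : Type} {f : ι → ℝ → ℂ} (hf : ∀ a, 0 ≤ a → Summable fun i => f i a) {u h : ℝ} (hu : 0 ≤ u)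
    (hh : 0 ≤ h) : HasSum (fun i => dd (f i) u h) (dd (fun a => ∑' i, f i a) u h) :=
  ((hf _ (by linarith)).hasSum.sub ((hf _ (by linarith)).hasSum.mul_left 2)).add (hf _ hu).hasSum

lemma summable_triv {a : ℝ} (ha : 0 ≤ a) : Summable fun n => triv n a :=
  Summable.of_norm_bounded ((summable_u 3).mul_right _) fun n => triv_bound n ha

lemma summable_zt {a : ℝ} (ha : 0 ≤ a) : Summable fun z => zt z a :=
  Summable.of_norm_bounded (summable_zt_bound.mul_right _) fun z => zt_bound z ha

lemma summable_vm (a : ℝ) : Summable fun n : ℕ => (vonMangoldt n : ℂ) * Q (a - Real.log n) :=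
  Summable.of_norm_bounded (vm_summable.mul_right _) fun n => vm_bound n a

lemma qconv (b h : ℝ) (hh : 0 ≤ h) :
    0 ≤ (max (b + 2 * h) 0) ^ 2 / 2 - 2 * ((max (b + h) 0) ^ 2 / 2) + (max b 0) ^ 2 / 2 := by
  rcases le_total 0 b with h1 | h1
  · rw [max_eq_left (by linarith), max_eq_left (by linarith), max_eq_left h1]; nlinarith
  rw [max_eq_right h1]
  rcases le_total 0 (b + h) with h2 | h2
  · rw [max_eq_left (by linarith), max_eq_left h2]; nlinarith
  rw [max_eq_right h2]; nlinarith [sq_nonneg (max (b + 2 * h) 0)]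

lemma Q_re (a : ℝ) : (Q a).re = (max a 0) ^ 2 / 2 := by
  have : Q a = (((max a 0) ^ 2 / 2 : ℝ) : ℂ) := by rw [Q]; push_cast; rfl
  rw [this, Complex.ofReal_re]

lemma dd_vm (n : ℕ) (u h : ℝ) : (dd (fun a => (vonMangoldt n : ℂ) * Q (a - Real.log n)) u h).re =
    vonMangoldt n * ((max ((u - Real.log n) + 2 * h) 0) ^ 2 / 2 - 2 * ((max ((u - Real.log n) + h) 0) ^ 2 / 2)
      + (max (u - Real.log n) 0) ^ 2 / 2) := by
  rw [dd, show u + 2 * h - Real.log n = (u - Real.log n) + 2 * h by ring,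
    show u + h - Real.log n = (u - Real.log n) + h by ring]
  simp only [Complex.add_re, Complex.sub_re, Complex.re_ofReal_mul]
  have : ∀ z : ℂ, (2 * z).re = 2 * z.re := fun z => by simp
  rw [this, Complex.re_ofReal_mul, Q_re, Q_re, Q_re]; ring

lemma psi_le_dd {u h : ℝ} (hu : 0 ≤ u) (hh : 0 ≤ h) : h ^ 2 * Chebyshev.psi (Real.exp u) ≤ (dd WL u h).re := by
  have hs := hasSum_dd (fun a _ => summable_vm a) hu hh
  have hs2 := Complex.hasSum_re hs
  have := sum_le_hasSum (Finset.Ioc 0 ⌊Real.exp u⌋₊) (fun n _ => by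
    rw [dd_vm]; exact mul_nonneg vonMangoldt_nonneg (qconv _ _ hh)) hs2
  refine le_trans (le_of_eq ?_) this
  rw [Chebyshev.psi, Finset.mul_sum]
  refine Finset.sum_congr rfl fun n hn => ?_
  rw [Finset.mem_Ioc] at hn
  have h0 : (0:ℝ) < n := by exact_mod_cast hn.1
  have : Real.log n ≤ u := by
    rw [Real.log_le_iff_le_exp h0]
    exact (Nat.le_floor_iff (by positivity)).1 hn.2
  rw [dd_vm, max_eq_left (by linarith), max_eq_left (by linarith), max_eq_left (by linarith)]; ring

lemma dd_triv_le (n : ℕ) {u h : ℝ} (hu : 0 ≤ u) (hh : 0 ≤ h) : (dd (triv n) u h).re ≤ 1 / 8 * (1 / (n + 1 : ℝ) ^ 2) := by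
  have e : dd (triv n) u h = (lg n / 2 : ℂ) * dd Q u h - dd (Lf (tc n)) u h := by
    simp only [dd, triv]; ring
  rw [e, dd_Q hu hh, dd_Lf (tc_ne n) hu hh]
  have hn : (1:ℝ) ≤ n + 1 := by linarith [(Nat.cast_nonneg n : (0:ℝ) ≤ n)]
  set c : ℝ := -(2 * (n + 1)) with hc
  have hcc : tc n = (c : ℂ) := by simp [tc, hc]
  have hc0 : c ≠ 0 := by rw [hc]; have : (0:ℝ) < n + 1 := by linarith
                         intro h; linarith
  have r : (lg n / 2 : ℂ) * h ^ 2 - (cexp (tc n * u) * (cexp (tc n * h) - 1) ^ 2 / tc n ^ 3 - h ^ 2 / tc n)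
     = ((lg n / 2 * h ^ 2 - (Real.exp (c * u) * (Real.exp (c * h) - 1) ^ 2 / c ^ 3 - h ^ 2 / c) : ℝ) : ℂ) := by
    rw [hcc]; push_cast; rfl
  rw [r, Complex.ofReal_re]
  have c1 : c ^ 3 = -(8 * (n + 1) ^ 3) := by rw [hc]; ring
  have c2 : h ^ 2 / c = - (h ^ 2 * (1 / (n + 1)) / 2) := by rw [hc]; field_simp
  have h1 := lg_le n
  have x1 : Real.exp (c * u) ≤ 1 := Real.exp_le_one_iff.2 (by rw [hc]; nlinarith)
  have x2 : Real.exp (c * h) ≤ 1 := Real.exp_le_one_iff.2 (by rw [hc]; nlinarith)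
  have x3 := Real.exp_pos (c * h)
  have x4 := Real.exp_pos (c * u)
  have key : Real.exp (c * u) * (Real.exp (c * h) - 1) ^ 2 ≤ 1 := by
    have : (Real.exp (c * h) - 1) ^ 2 ≤ 1 := by nlinarith
    nlinarith [sq_nonneg (Real.exp (c * h) - 1)]
  have k2 : Real.exp (c * u) * (Real.exp (c * h) - 1) ^ 2 / (8 * (n + 1 : ℝ) ^ 3) ≤ 1 / 8 * (1 / (n + 1 : ℝ) ^ 2) := by
    rw [div_le_iff₀ (by positivity)]
    have : 1 / 8 * (1 / (n + 1 : ℝ) ^ 2) * (8 * (n + 1) ^ 3) = n + 1 := by field_simp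
    rw [this]; linarith
  rw [c1, c2, div_neg]
  nlinarith [sq_nonneg h]

lemma dd_triv_tsum {u h : ℝ} (hu : 0 ≤ u) (hh : 0 ≤ h) : (dd (fun a => ∑' n, triv n a) u h).re ≤ 1 := by
  have hs := Complex.hasSum_re (hasSum_dd (f := triv) (fun a ha => summable_triv ha) hu hh)
  have hz := hasSum_zeta_two
  have h2 : HasSum (fun n : ℕ => 1 / 8 * (1 / (n + 1 : ℝ) ^ 2)) (1 / 8 * (π ^ 2 / 6)) := by
    have := (hasSum_nat_add_iff' (f := fun n : ℕ => 1 / (n : ℝ) ^ 2) 1).2 hz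
    simp only [Finset.range_one, Finset.sum_singleton, Nat.cast_zero, ne_eq, OfNat.ofNat_ne_zero, not_false_eq_true,
      zero_pow, div_zero, sub_zero, Nat.cast_add, Nat.cast_one] at this
    exact this.mul_left _
  refine (hasSum_le (fun n => dd_triv_le n hu hh) hs h2).trans ?_
  have := Real.pi_lt_four
  nlinarith [Real.pi_pos]

theorem psi_main {u h : ℝ} (hu : 0 ≤ u) (hh : 0 ≤ h) : h ^ 2 * Chebyshev.psi (Real.exp u) ≤
    Real.exp u * (Real.exp h - 1) ^ 2 + 1 + 1 / 2 * ‖∑' z, dd (zt z) u h‖ := by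
  refine (psi_le_dd hu hh).trans ?_
  have e : dd WL u h = dd (Lf 1) u h + (-(Real.log π/2)) * dd Q u h + dd (fun a => ∑' n, triv n a) u h
      + (-(1/2)) * dd (fun a => ∑' z, zt z a) u h := by
    simp only [dd, explicit]; ring
  rw [e, ← (hasSum_dd (f := zt) (fun a ha => summable_zt ha) hu hh).tsum_eq, dd_Lf one_ne_zero hu hh, dd_Q hu hh]
  have e1 : cexp (1 * u) * (cexp (1 * h) - 1) ^ 2 / 1 ^ 3 - (h:ℂ) ^ 2 / 1 + (-(Real.log π/2)) * (h:ℂ) ^ 2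
      = ((Real.exp u * (Real.exp h - 1) ^ 2 - h ^ 2 - Real.log π / 2 * h ^ 2 : ℝ) : ℂ) := by
    push_cast; simp; ring
  rw [e1, Complex.add_re, Complex.add_re, Complex.ofReal_re]
  have t1 := dd_triv_tsum hu hh
  have t2 : ((-(1/2)) * ∑' z, dd (zt z) u h : ℂ).re ≤ 1 / 2 * ‖∑' z, dd (zt z) u h‖ := by
    refine (Complex.re_le_norm _).trans ?_
    rw [norm_mul]; norm_num
  have := logpi_ge
  nlinarith [sq_nonneg h]

end Expl

/-! part P71 -/

namespace Expl
open Complex Filter Topology MeasureTheory Set ZetaXi Digam ArithmeticFunction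

lemma norm_main {c : ℂ} (h0 : 0 ≤ c.re) (h1 : c.re ≤ 1) {u h t : ℝ} (hh : 0 ≤ h) (ht : 0 < t) (htc : t ≤ ‖c‖) :
    ‖cexp (c * u) * (cexp (c * h) - 1) ^ 2 / c ^ 3‖ ≤ (1 + Real.exp h) ^ 2 * Real.exp (c.re * u) / t ^ 3 := by
  rw [norm_div, norm_mul, norm_pow, norm_pow, Complex.norm_exp]
  have e : (c * (u:ℂ)).re = c.re * u := by simp
  have e2 : ‖cexp (c * h) - 1‖ ≤ 1 + Real.exp h := by
    refine (norm_sub_le _ _).trans ?_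
    rw [Complex.norm_exp, norm_one, add_comm]
    have : (c * (h:ℂ)).re = c.re * h := by simp
    rw [this]
    gcongr
    nlinarith
  rw [e, mul_comm]
  gcongr

noncomputable def dl (t : ℝ) : ℝ := 1 / (17.46 * Real.log (max t 40 / 13))

lemma dd_zt_le {z : ℂ} (hz : Xi z = 0) {u h : ℝ} (hu : 0 ≤ u) (hh : 0 ≤ h) (hh1 : h ≤ 1) :
    ‖dd (zt z) u h‖ ≤ (mu z : ℝ) * ((1 + Real.exp h) ^ 2 * Real.exp u *
      ((Real.exp (-(u * dl |z.im|)) + Real.exp (-(u / 2))) / |z.im| ^ 3 + Real.exp (-u) / |z.im| ^ 2)) := by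
  obtain ⟨n1, n2⟩ := zero_ne hz
  obtain ⟨r0, r1⟩ := Xi_zero_re hz
  obtain ⟨m1, m2⟩ := im_le_norm (z := z)
  have hg := zero_height hz
  have f1 : dl |z.im| ≤ 1 - z.re := zero_free hz (le_max_right _ _) (le_max_left _ _)
  have f2 : dl |z.im| ≤ z.re := by
    have := zero_free (Xi_zero_one_sub hz) (T := max |z.im| 40) (le_max_right _ _) (by simp)
    simpa [dl] using this
  set t := |z.im| with ht
  have t0 : 0 < t := by linarith
  have e : dd (zt z) u h = (mu z : ℂ) * (cexp (z * u) * (cexp (z * h) - 1) ^ 2 / z ^ 3 +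
      cexp ((1 - z) * u) * (cexp ((1 - z) * h) - 1) ^ 2 / (1 - z) ^ 3 - h ^ 2 / (z * (1 - z))) := by
    have e1 : dd (zt z) u h = (mu z : ℂ) * (dd (Lf z) u h + dd (Lf (1 - z)) u h) := by
      simp only [dd, zt]; ring
    have e3 : (h:ℂ) ^ 2 / (z * (1 - z)) = h ^ 2 / z + h ^ 2 / (1 - z) := by
      field_simp; ring
    rw [e1, dd_Lf n1 hu hh, dd_Lf n2 hu hh, e3]; ring
  rw [e, norm_mul, Complex.norm_natCast]
  gcongr
  refine (norm_sub_le _ _).trans ?_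
  refine (add_le_add_left (norm_add_le _ _) _).trans ?_
  have b1 := norm_main (u := u) r0.le r1.le hh t0 m1
  have b2 := norm_main (c := 1 - z) (u := u) (by simp; linarith) (by simp; linarith) hh t0 m2
  have b3 : ‖(h:ℂ) ^ 2 / (z * (1 - z))‖ ≤ (1 + Real.exp h) ^ 2 / t ^ 2 := by
    rw [norm_div, norm_pow, norm_mul, Complex.norm_real, Real.norm_of_nonneg hh, pow_two t]
    gcongr
    have := Real.exp_pos h; linarith
  have re1 : (1 - z).re = 1 - z.re := by simp
  rw [re1] at b2
  have key : Real.exp (z.re * u) + Real.exp ((1 - z.re) * u) ≤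
      Real.exp u * (Real.exp (-(u * dl t)) + Real.exp (-(u / 2))) := by
    rw [mul_add, ← Real.exp_add, ← Real.exp_add]
    rcases le_total z.re (1/2) with hβ | hβ
    · rw [add_comm]
      gcongr <;> nlinarith
    · gcongr <;> nlinarith
  have k2 : (1 + Real.exp h) ^ 2 * Real.exp (z.re * u) / t ^ 3 + (1 + Real.exp h) ^ 2 * Real.exp ((1 - z.re) * u) / t ^ 3
      ≤ (1 + Real.exp h) ^ 2 * (Real.exp u * (Real.exp (-(u * dl t)) + Real.exp (-(u / 2)))) / t ^ 3 := by
    rw [← add_div, ← mul_add]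
    gcongr
  have e4 : (1 + Real.exp h) ^ 2 * Real.exp u *
      ((Real.exp (-(u * dl t)) + Real.exp (-(u / 2))) / t ^ 3 + Real.exp (-u) / t ^ 2)
      = (1 + Real.exp h) ^ 2 * (Real.exp u * (Real.exp (-(u * dl t)) + Real.exp (-(u / 2)))) / t ^ 3
        + (1 + Real.exp h) ^ 2 / t ^ 2 := by
    rw [Real.exp_neg u]; field_simp
  rw [e4]; linarith

/-! numeric estimates -/
lemma T1 {y t : ℝ} (hy : 4.786 ≤ y) (ht : 40 ≤ t) :
    Real.exp (-(17.46 * y ^ 2 * dl t)) * (((13 * Real.exp (0.732 * y)) ^ 2 + t ^ 2) / t ^ 3) ≤ 2 / 13 * Real.exp (-2 * y) := by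
  rw [dl, max_eq_left ht]
  set l := Real.log (t / 13) with hl
  have hl0 : 0 < l := Real.log_pos (by rw [lt_div_iff₀ (by norm_num)]; linarith)
  have te : t = 13 * Real.exp l := by rw [hl, Real.exp_log (by positivity)]; field_simp
  have e1 : 17.46 * y ^ 2 * (1 / (17.46 * l)) = y ^ 2 / l := by field_simp
  have e2 : ((13 * Real.exp (0.732 * y)) ^ 2 + t ^ 2) / t ^ 3 = 1 / 13 * (Real.exp (1.464 * y - 3 * l) + Real.exp (-l)) := by
    have a1 : Real.exp (1.464 * y - 3 * l) = Real.exp (0.732 * y) ^ 2 / Real.exp l ^ 3 := by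
      rw [← Real.exp_nat_mul, ← Real.exp_nat_mul, ← Real.exp_sub]; push_cast; congr 1; ring
    rw [a1, Real.exp_neg, te]
    field_simp; 
  have q1 : y ^ 2 / l + 3 * l ≥ 3.464 * y := by
    have : y ^ 2 / l + 3 * l - 3.464 * y = (y ^ 2 + 3 * l ^ 2 - 3.464 * y * l) / l := by field_simp
    have h2 : 0 ≤ (y ^ 2 + 3 * l ^ 2 - 3.464 * y * l) / l := by
      apply div_nonneg _ hl0.le
      nlinarith [sq_nonneg (y - 1.732 * l), sq_nonneg l]
    linarith
  have q2 : y ^ 2 / l + l ≥ 2 * y := by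
    have : y ^ 2 / l + l - 2 * y = (y - l) ^ 2 / l := by field_simp; ring
    have h2 : 0 ≤ (y - l) ^ 2 / l := by positivity
    linarith
  rw [e1, e2, mul_left_comm, mul_add, ← Real.exp_add, ← Real.exp_add]
  have x1 : Real.exp (-(y ^ 2 / l) + (1.464 * y - 3 * l)) ≤ Real.exp (-2 * y) := Real.exp_le_exp.2 (by linarith)
  have x2 : Real.exp (-(y ^ 2 / l) + -l) ≤ Real.exp (-2 * y) := Real.exp_le_exp.2 (by linarith)
  linarith

lemma log40_13 : Real.log (40 / 13) ≤ 1.125 := by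
  rw [Real.log_le_iff_le_exp (by norm_num)]
  have h := Real.sum_le_exp_of_nonneg (x := 1.125) (by norm_num) 8
  refine le_trans ?_ h
  norm_num [Finset.sum_range_succ, Nat.factorial]

lemma T2 {y t : ℝ} (hy : 4.786 ≤ y) (ht4 : 4 ≤ t) (ht : t ≤ 40) :
    Real.exp (-(17.46 * y ^ 2 * dl t)) * (((13 * Real.exp (0.732 * y)) ^ 2 + t ^ 2) / t ^ 3) ≤ 2 / 13 * Real.exp (-2 * y) := by
  rw [dl, max_eq_right ht]
  set l := Real.log (40 / 13) with hl
  have hl0 : 0 < l := Real.log_pos (by norm_num)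
  have hl1 : l ≤ 1.125 := log40_13
  have e1 : 17.46 * y ^ 2 * (1 / (17.46 * l)) = y ^ 2 / l := by field_simp
  have q1 : 4.25 * y ≤ y ^ 2 / l := by
    rw [le_div_iff₀ hl0]; nlinarith
  have q2 : ((13 * Real.exp (0.732 * y)) ^ 2 + t ^ 2) / t ^ 3 ≤ 3 * Real.exp (1.464 * y) := by
    have a1 : Real.exp (1.464 * y) = Real.exp (0.732 * y) ^ 2 := by
      rw [← Real.exp_nat_mul]; push_cast; congr 1; ring
    have a2 : 1 ≤ Real.exp (1.464 * y) := Real.one_le_exp (by linarith)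
    rw [mul_pow, ← a1, div_le_iff₀ (by positivity)]
    have : (64:ℝ) ≤ t ^ 3 := by nlinarith [sq_nonneg t]
    have : 4 * t ^ 2 ≤ t ^ 3 := by nlinarith [sq_nonneg t]
    nlinarith
  rw [e1]
  have q3 : Real.exp (-(0.786 * y)) ≤ 1 / 30 := by
    rw [Real.exp_neg, ← one_div]
    apply one_div_le_one_div_of_le (by norm_num)
    have : Real.exp 3.76 ≤ Real.exp (0.786 * y) := Real.exp_le_exp.2 (by linarith)
    refine le_trans ?_ this
    have h := Real.sum_le_exp_of_nonneg (x := 3.76) (by norm_num) 8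
    refine le_trans ?_ h
    norm_num [Finset.sum_range_succ, Nat.factorial]
  calc _ ≤ Real.exp (-(4.25 * y)) * (3 * Real.exp (1.464 * y)) := by gcongr
    _ = 3 * (Real.exp (-(0.786 * y)) * Real.exp (-2 * y)) := by
        rw [mul_left_comm, ← Real.exp_add, ← Real.exp_add]; ring_nf
    _ ≤ _ := by
        have := Real.exp_pos (-2 * y)
        nlinarith

lemma T3 {y t : ℝ} (hy : 4.786 ≤ y) (ht4 : 4 ≤ t) :
    (Real.exp (-(17.46 * y ^ 2 / 2)) / t ^ 3 + Real.exp (-(17.46 * y ^ 2)) / t ^ 2) * ((13 * Real.exp (0.732 * y)) ^ 2 + t ^ 2)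
      ≤ 0.00015 * Real.exp (-2 * y) := by
  have t0 : 0 < t := by linarith
  have a1 : Real.exp (1.464 * y) = Real.exp (0.732 * y) ^ 2 := by
    rw [← Real.exp_nat_mul]; push_cast; congr 1; ring
  have a2 : 1 ≤ Real.exp (1.464 * y) := Real.one_le_exp (by linarith)
  have b1 : Real.exp (-(17.46 * y ^ 2 / 2)) / t ^ 3 ≤ Real.exp (-(41.5 * y)) / t ^ 2 := by
    gcongr
    · nlinarith
    · linarith
    · norm_num
  have b2 : Real.exp (-(17.46 * y ^ 2)) / t ^ 2 ≤ Real.exp (-(41.5 * y)) / t ^ 2 := by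
    gcongr ?_ / _
    exact Real.exp_le_exp.2 (by nlinarith)
  have c1 : ((13 * Real.exp (0.732 * y)) ^ 2 + t ^ 2) / t ^ 2 ≤ 12 * Real.exp (1.464 * y) := by
    rw [mul_pow, ← a1, div_le_iff₀ (by positivity)]
    have : 16 ≤ t ^ 2 := by nlinarith
    nlinarith
  have d : Real.exp (-(38 * y)) ≤ 0.00015 / 24 := by
    have h := Real.pow_div_factorial_le_exp (38 * y) (by linarith) 3
    have h2 : (180:ℝ) ^ 3 / 6 ≤ (38 * y) ^ 3 / (Nat.factorial 3 : ℝ) := by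
      have : (180:ℝ) ≤ 38 * y := by linarith
      rw [show ((Nat.factorial 3 : ℕ) : ℝ) = 6 by norm_num [Nat.factorial]]
      gcongr
    rw [Real.exp_neg, inv_le_comm₀ (Real.exp_pos _) (by norm_num)]
    refine le_trans ?_ (h2.trans h)
    norm_num
  calc _ ≤ (Real.exp (-(41.5 * y)) / t ^ 2 + Real.exp (-(41.5 * y)) / t ^ 2) * ((13 * Real.exp (0.732 * y)) ^ 2 + t ^ 2) := by
        gcongr
    _ = 2 * Real.exp (-(41.5 * y)) * (((13 * Real.exp (0.732 * y)) ^ 2 + t ^ 2) / t ^ 2) := by ring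
    _ ≤ 2 * Real.exp (-(41.5 * y)) * (12 * Real.exp (1.464 * y)) := by gcongr
    _ = 24 * Real.exp (-(40.036 * y)) := by
        rw [show -(40.036 * y) = -(41.5 * y) + 1.464 * y by ring, Real.exp_add]; ring
    _ ≤ 24 * (Real.exp (-(38 * y)) * Real.exp (-2 * y)) := by
        rw [← Real.exp_add]
        gcongr
        linarith
    _ ≤ _ := by
        have := Real.exp_pos (-2 * y)
        nlinarith

lemma Tall {y t : ℝ} (hy : 4.786 ≤ y) (ht4 : 4 ≤ t) :
    (Real.exp (-(17.46 * y ^ 2 * dl t)) + Real.exp (-(17.46 * y ^ 2 / 2))) / t ^ 3 + Real.exp (-(17.46 * y ^ 2)) / t ^ 2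
      ≤ 0.154 * Real.exp (-2 * y) * (1 / ((13 * Real.exp (0.732 * y)) ^ 2 + t ^ 2)) := by
  have t0 : 0 < t := by linarith
  rw [mul_one_div, le_div_iff₀ (by positivity)]
  have h1 : Real.exp (-(17.46 * y ^ 2 * dl t)) * (((13 * Real.exp (0.732 * y)) ^ 2 + t ^ 2) / t ^ 3) ≤ 2 / 13 * Real.exp (-2 * y) := by
    rcases le_total t 40 with h | h
    · exact T2 hy ht4 h
    · exact T1 hy h
  have h3 := T3 hy ht4
  have := Real.exp_pos (-2 * y)
  have e : ((Real.exp (-(17.46 * y ^ 2 * dl t)) + Real.exp (-(17.46 * y ^ 2 / 2))) / t ^ 3 + Real.exp (-(17.46 * y ^ 2)) / t ^ 2)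
      * ((13 * Real.exp (0.732 * y)) ^ 2 + t ^ 2) =
     Real.exp (-(17.46 * y ^ 2 * dl t)) * (((13 * Real.exp (0.732 * y)) ^ 2 + t ^ 2) / t ^ 3) +
     (Real.exp (-(17.46 * y ^ 2 / 2)) / t ^ 3 + Real.exp (-(17.46 * y ^ 2)) / t ^ 2) * ((13 * Real.exp (0.732 * y)) ^ 2 + t ^ 2) := by
    ring
  rw [e]
  nlinarith

/-! density -/
lemma density {s : ℝ} (hs : 1 < s) (z : ℂ) :
    (mu z : ℝ) * (2 * ((s - 1) * (1 / (s ^ 2 + |z.im| ^ 2)))) ≤ (mu z:ℝ)*((1/((s:ℂ)-z)).re+(1/((s:ℂ)-1+z)).re) := by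
  by_cases hz : Xi z = 0
  swap
  · rw [(mu_eq_zero_iff z).2 hz]; simp
  obtain ⟨r0, r1⟩ := Xi_zero_re hz
  have t0 : 0 < |z.im| := by have := zero_height hz; linarith
  gcongr
  have aux : ∀ b : ℝ, s - 1 ≤ b → b ≤ s → (s - 1) * (1 / (s ^ 2 + |z.im| ^ 2)) ≤ b / (b ^ 2 + z.im ^ 2) := by
    intro b h1 h2
    rw [sq_abs, mul_one_div]
    have : 0 < z.im ^ 2 := by rw [← sq_abs]; positivity
    have : b ^ 2 ≤ s ^ 2 := by nlinarith
    gcongr <;> nlinarith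
  rw [re_inv_eq, re_inv_eq]
  have a1 := aux (s - z.re) (by linarith) (by linarith)
  have a2 := aux (s - 1 + z.re) (by linarith) (by linarith)
  simp only [Complex.sub_re, Complex.add_re, Complex.ofReal_re, Complex.one_re, Complex.sub_im, Complex.add_im,
    Complex.ofReal_im, Complex.one_im, zero_sub, sub_zero, zero_add, neg_sq]
  linarith

theorem zeros_bound {y h : ℝ} (hy : 4.786 ≤ y) (hh : 0 ≤ h) (hh1 : h ≤ 1) :
    ‖∑' z, dd (zt z) (17.46 * y ^ 2) h‖ ≤ (1 + Real.exp h) ^ 2 * Real.exp (17.46 * y ^ 2) *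
      (0.154 * Real.exp (-2 * y)) * ((logDeriv Xi ((13 * Real.exp (0.732 * y) : ℝ) : ℂ)).re / (13 * Real.exp (0.732 * y) - 1)) := by
  set s := 13 * Real.exp (0.732 * y) with hs
  have hs1 : 13 < s := by
    have : 1 < Real.exp (0.732 * y) := Real.one_lt_exp_iff.2 (by linarith)
    rw [hs]; linarith
  set K := (1 + Real.exp h) ^ 2 * Real.exp (17.46 * y ^ 2) * (0.154 * Real.exp (-2 * y)) with hK
  have hsum := (hasSum_H_re (s := (s:ℂ)) (by simp; linarith)).mul_left (K / (2 * (s - 1)))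
  have hle : ∀ z, ‖dd (zt z) (17.46 * y ^ 2) h‖ ≤
      K / (2 * (s - 1)) * ((mu z:ℝ)*((1/((s:ℂ)-z)).re+(1/((s:ℂ)-1+z)).re)) := by
    intro z
    have hd := density (s := s) (by linarith) z
    by_cases hz : Xi z = 0
    swap
    · have : mu z = 0 := (mu_eq_zero_iff z).2 hz
      simp [dd, zt, this]
    have h1 := dd_zt_le hz (u := 17.46 * y ^ 2) (by positivity) hh hh1
    have h2 := Tall hy (zero_height hz)
    refine h1.trans ?_
    calc _ ≤ (mu z : ℝ) * ((1 + Real.exp h) ^ 2 * Real.exp (17.46 * y ^ 2) *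
            (0.154 * Real.exp (-2 * y) * (1 / (s ^ 2 + |z.im| ^ 2)))) := by gcongr
      _ = K / (2 * (s - 1)) * ((mu z : ℝ) * (2 * ((s - 1) * (1 / (s ^ 2 + |z.im| ^ 2))))) := by
          have : s - 1 ≠ 0 := by linarith
          have : 0 < s ^ 2 + |z.im| ^ 2 := by positivity
          rw [hK]; field_simp
      _ ≤ _ := by
          have : 0 ≤ K / (2 * (s - 1)) := by
            apply div_nonneg <;> [positivity; linarith]
          gcongr
  refine (tsum_of_norm_bounded hsum hle).trans (le_of_eq ?_)
  have : s - 1 ≠ 0 := by linarith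
  field_simp

end Expl

/-! part P72 -/

namespace Expl
open Complex Filter Topology MeasureTheory Set ZetaXi Digam ArithmeticFunction

lemma H_final {y : ℝ} (hy : 4.786 ≤ y) :
    (logDeriv Xi ((13 * Real.exp (0.732 * y) : ℝ) : ℂ)).re / (13 * Real.exp (0.732 * y) - 1) ≤ 0.0343 * y * Real.exp (-(0.732 * y)) := by
  set E := Real.exp (0.732 * y) with hE
  have hE33 : 33 ≤ E := by
    have : Real.exp 3.5 ≤ E := Real.exp_le_exp.2 (by linarith)
    refine le_trans ?_ this
    have h := Real.sum_le_exp_of_nonneg (x := 3.5) (by norm_num) 11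
    refine le_trans ?_ h
    norm_num [Finset.sum_range_succ, Nat.factorial]
  have h := H_real_le (σ := 13 * E) (by linarith)
  have l1 : Real.log (1 + 13 * E / 2) ≤ 1.877 + 0.732 * y := by
    have : 1 + 13 * E / 2 ≤ 13 / 2 * E * 1.0047 := by linarith
    refine (Real.log_le_log (by positivity) this).trans ?_
    rw [Real.log_mul (by positivity) (by norm_num), Real.log_mul (by norm_num) (by positivity),
      Real.log_div (by norm_num) (by norm_num), hE, Real.log_exp]
    have := log13_le
    have := Real.log_two_gt_d9
    have := Real.log_le_sub_one_of_pos (x := 1.0047) (by norm_num)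
    linarith
  have l2 := logpi_ge
  have l3 : 1 / (13 * E - 1) ≤ 0.00234 := by
    rw [div_le_iff₀ (by linarith)]; linarith
  have l4 : 0 ≤ 1 / (2 + 13 * E) := by positivity
  have hH : (logDeriv Xi ((13 * E : ℝ) : ℂ)).re ≤ 0.4443 * y := by linarith
  rw [div_le_iff₀ (by linarith), Real.exp_neg, ← hE]
  refine hH.trans ?_
  have : 0.0343 * y * E⁻¹ * (13 * E - 1) = 0.0343 * y * (13 - 1 / E) := by
    field_simp
  rw [this]
  have : 1 / E ≤ 1 / 33 := one_div_le_one_div_of_le (by norm_num) hE33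
  nlinarith

lemma y7 {y : ℝ} (hy : 4.786 ≤ y) : y ^ 7 * Real.exp (-(2.732 * y)) ≤ 0.15 := by
  set v := y / 4.786 with hv
  have yv : y = 4.786 * v := by rw [hv]; field_simp
  have hv1 : 1 ≤ v := by rw [hv, le_div_iff₀ (by norm_num)]; linarith
  have h1 : v ^ 7 ≤ Real.exp (7 * (v - 1)) := by
    have : v ≤ Real.exp (v - 1) := by have := Real.add_one_le_exp (v - 1); linarith
    calc v ^ 7 ≤ Real.exp (v - 1) ^ 7 := by gcongr
      _ = _ := by rw [← Real.exp_nat_mul]; norm_num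
  have h2 : (4.786:ℝ) ^ 7 * Real.exp (-13.07) ≤ 0.15 := by
    have : (0.15:ℝ)⁻¹ * 4.786 ^ 7 ≤ Real.exp 13.07 := by
      have e : Real.exp 13.07 = Real.exp 1 ^ 13 * Real.exp 0.07 := by
        rw [← Real.exp_nat_mul, ← Real.exp_add]; norm_num
      rw [e]
      have a := Real.exp_one_gt_d9
      have b := Real.add_one_le_exp (0.07:ℝ)
      calc _ ≤ (2.718:ℝ) ^ 13 * 1 := by norm_num
        _ ≤ _ := by
          gcongr
          · linarith
          · linarith
    rw [Real.exp_neg, ← div_eq_mul_inv, div_le_iff₀ (Real.exp_pos _)]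
    linarith
  rw [yv, mul_pow]
  calc _ ≤ (4.786:ℝ) ^ 7 * Real.exp (7 * (v - 1)) * Real.exp (-(2.732 * (4.786 * v))) := by gcongr
    _ = (4.786:ℝ) ^ 7 * Real.exp (7 * (v - 1) + -(2.732 * (4.786 * v))) := by rw [Real.exp_add]; ring
    _ ≤ (4.786:ℝ) ^ 7 * Real.exp (-13.07) := by
        gcongr
        linarith
    _ ≤ _ := h2

theorem psi_large {u : ℝ} (hu : 400 ≤ u) : Chebyshev.psi (Real.exp u) ≤ Real.exp u * (1 + 4.5 / u) := by
  set y := √(u / 17.46) with hy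
  have hy2 : y ^ 2 = u / 17.46 := Real.sq_sqrt (by positivity)
  have hyu : 17.46 * y ^ 2 = u := by rw [hy2]; field_simp
  have hy0 : 4.786 ≤ y := by
    apply Real.le_sqrt_of_sq_le
    rw [le_div_iff₀ (by norm_num)]; norm_num; linarith
  set h := 2.25 / u with hh
  have u0 : 0 < u := by linarith
  have h0 : 0 < h := by positivity
  have h1 : h ≤ 0.005625 := by rw [hh, div_le_iff₀ u0]; linarith
  have main := psi_main (u := u) (h := h) (by linarith) h0.le
  have zb := zeros_bound hy0 h0.le (by linarith)
  rw [hyu] at zb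
  have hf := H_final hy0
  have ex : Real.exp h ≤ 1 + h + h ^ 2 / 2 + h ^ 3 * (2/9) := by
    have := Real.exp_bound' h0.le (by linarith) (n := 3) (by norm_num)
    norm_num [Finset.sum_range_succ, Nat.factorial] at this
    linarith
  have ex1 : 1 ≤ Real.exp h := Real.one_le_exp h0.le
  have ex2 : Real.exp h - 1 ≤ h * (1 + 0.502 * h) := by nlinarith [sq_nonneg h, mul_nonneg (sq_nonneg h) (sub_nonneg.2 h1)]
  have ex3 : (Real.exp h - 1) ^ 2 ≤ h ^ 2 * (1 + 1.006 * h) := by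
    calc _ ≤ (h * (1 + 0.502 * h)) ^ 2 := by gcongr
      _ = h ^ 2 * (1 + 0.502 * h) ^ 2 := by ring
      _ ≤ _ := by gcongr; nlinarith
  have ex4 : (1 + Real.exp h) ^ 2 ≤ 4.03 := by nlinarith
  have S : (0.154 * Real.exp (-2 * y)) * (0.0343 * y * Real.exp (-(0.732 * y))) ≤ 0.371 * h ^ 3 := by
    have e : (0.154 * Real.exp (-2 * y)) * (0.0343 * y * Real.exp (-(0.732 * y)))
        = 0.154 * 0.0343 * (y ^ 7 * Real.exp (-(2.732 * y))) / y ^ 6 := by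
      have : Real.exp (-(2.732 * y)) = Real.exp (-2 * y) * Real.exp (-(0.732 * y)) := by
        rw [← Real.exp_add]; ring_nf
      have y0 : y ≠ 0 := by linarith
      rw [this]; field_simp
    have e2 : h ^ 3 = 2.25 ^ 3 / 17.46 ^ 3 / y ^ 6 := by
      have y0 : y ≠ 0 := by linarith
      rw [hh, ← hyu]; field_simp
    rw [e, e2]
    have := y7 hy0
    have y6 : 0 < y ^ 6 := by positivity
    rw [div_le_iff₀ y6]
    have e3 : 0.371 * (2.25 ^ 3 / 17.46 ^ 3 / y ^ 6) * y ^ 6 = 0.371 * (2.25 ^ 3 / 17.46 ^ 3) := by field_simp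
    rw [e3]; norm_num; linarith
  have eu : 1 ≤ Real.exp u * (0.2 * h ^ 3) := by
    have := Real.pow_div_factorial_le_exp u u0.le 4
    have e : h ^ 3 = 11.390625 / u ^ 3 := by rw [hh, div_pow]; norm_num
    rw [show ((Nat.factorial 4 : ℕ) : ℝ) = 24 by norm_num [Nat.factorial]] at this
    calc (1:ℝ) ≤ u ^ 4 / 24 * (0.2 * h ^ 3) := by
          rw [e]
          have : u ^ 4 / 24 * (0.2 * (11.390625 / u ^ 3)) = u * (0.2 * 11.390625 / 24) := by field_simp
          rw [this]; linarith
      _ ≤ _ := by gcongr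
  have eu0 := Real.exp_pos u
  have zb2 : ‖∑' z, dd (zt z) u h‖ ≤ Real.exp u * (4.03 * (0.371 * h ^ 3)) := by
    refine zb.trans ?_
    calc _ ≤ (1 + Real.exp h) ^ 2 * Real.exp u * (0.154 * Real.exp (-2 * y)) * (0.0343 * y * Real.exp (-(0.732 * y))) := by gcongr
      _ = (1 + Real.exp h) ^ 2 * Real.exp u * ((0.154 * Real.exp (-2 * y)) * (0.0343 * y * Real.exp (-(0.732 * y)))) := by ring
      _ ≤ 4.03 * Real.exp u * (0.371 * h ^ 3) := by gcongr
      _ = _ := by ring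
  have fin : h ^ 2 * Chebyshev.psi (Real.exp u) ≤ h ^ 2 * (Real.exp u * (1 + 2 * h)) := by
    refine main.trans ?_
    have a1 : Real.exp u * (Real.exp h - 1) ^ 2 ≤ Real.exp u * (h ^ 2 * (1 + 1.006 * h)) := by gcongr
    have h3 : 0 < Real.exp u * h ^ 3 := by positivity
    nlinarith
  have := le_of_mul_le_mul_left fin (by positivity)
  have e : 4.5 / u = 2 * h := by rw [hh]; ring
  rw [e]; exact this

end Expl

/-! part P20 -/

namespace Elem
open Finset ArithmeticFunction

/-- step function -/
def sS : List (ℕ × ℕ) → ℕ → ℕ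
  | [], _ => 0
  | s :: L, m => (if s.1 ≤ m then s.2 else 0) + sS L m

/-- weighted sum of psi -/
noncomputable def sP : List (ℕ × ℕ) → ℕ → ℝ
  | [], _ => 0
  | s :: L, X => (s.2 : ℝ) * Chebyshev.psi ((X / s.1 : ℕ) : ℝ) + sP L X

lemma psi_nat (X : ℕ) : Chebyshev.psi (X : ℝ) = ∑ n ∈ Ioc 0 X, vonMangoldt n := by
  simp [Chebyshev.psi]

lemma log_fact (M : ℕ) : Real.log (M.factorial : ℝ) = ∑ n ∈ Ioc 0 M, vonMangoldt n * ((M / n : ℕ) : ℝ) := by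
  induction M with
  | zero => simp
  | succ M ih =>
    rw [Nat.factorial_succ, Nat.cast_mul, Real.log_mul (by positivity) (by positivity), ih]
    have h1 : ∑ n ∈ Ioc 0 M, vonMangoldt n * ((M / n : ℕ) : ℝ) =
        ∑ n ∈ Ioc 0 (M+1), vonMangoldt n * ((M / n : ℕ) : ℝ) := by
      rw [Finset.sum_Ioc_succ_top (by omega)]
      rw [Nat.div_eq_of_lt (by omega : M < M + 1)]; simp
    rw [h1, ← vonMangoldt_sum (n := M + 1)]
    have h2 : (M+1).divisors = (Ioc 0 (M+1)).filter (fun n => n ∣ M + 1) := by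
      ext x; simp only [Nat.mem_divisors, mem_filter, mem_Ioc]
      constructor
      · rintro ⟨h, -⟩; exact ⟨⟨Nat.pos_of_dvd_of_pos h (by omega), Nat.le_of_dvd (by omega) h⟩, h⟩
      · rintro ⟨h, h'⟩; exact ⟨h', by omega⟩
    rw [h2, Finset.sum_filter, ← Finset.sum_add_distrib]
    refine Finset.sum_congr rfl fun n hn => ?_
    rw [Nat.succ_div]
    split_ifs <;> push_cast <;> ring

lemma log_fact_bounds (n : ℕ) (hn : 1 ≤ n) :
    n * Real.log n - n + 1 ≤ Real.log (n.factorial : ℝ) ∧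
    Real.log (n.factorial : ℝ) ≤ n * Real.log n - n + 1 + Real.log n := by
  induction n, hn using Nat.le_induction with
  | base => simp
  | succ n hn ih =>
    have hn0 : (0:ℝ) < n := by exact_mod_cast hn
    rw [Nat.factorial_succ, Nat.cast_mul, Real.log_mul (by positivity) (by positivity)]
    have hd : Real.log ((n+1 : ℕ):ℝ) - Real.log n = Real.log (((n:ℝ)+1)/n) := by
      rw [Real.log_div (by positivity) (by positivity)]; push_cast; ring
    have h1 : Real.log (((n:ℝ)+1)/n) ≤ 1 / n := by
      have := Real.log_le_sub_one_of_pos (show 0 < ((n:ℝ)+1)/n by positivity)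
      have h : ((n:ℝ)+1)/n - 1 = 1/n := by field_simp; ring
      linarith
    have h2 : 1 / ((n:ℝ)+1) ≤ Real.log (((n:ℝ)+1)/n) := by
      have := Real.one_sub_inv_le_log_of_pos (show 0 < ((n:ℝ)+1)/n by positivity)
      have h : 1 - (((n:ℝ)+1)/n)⁻¹ = 1/((n:ℝ)+1) := by field_simp; ring
      linarith
    rw [← hd] at h1 h2
    have h1' : (n:ℝ) * (Real.log ((n+1 : ℕ):ℝ) - Real.log n) ≤ 1 := by
      calc _ ≤ (n:ℝ) * (1/n) := by gcongr
        _ = 1 := by field_simp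
    have h2' : 1 ≤ ((n:ℝ)+1) * (Real.log ((n+1 : ℕ):ℝ) - Real.log n) := by
      calc (1:ℝ) = ((n:ℝ)+1) * (1/((n:ℝ)+1)) := by field_simp
        _ ≤ _ := by gcongr
    push_cast at *
    constructor <;> nlinarith [ih.1, ih.2]

lemma floor_fact (X d : ℕ) (hd : 1 ≤ d) (h : d ≤ X) :
    |Real.log ((X / d).factorial : ℝ) - ((X:ℝ)/d * Real.log ((X:ℝ)/d) - (X:ℝ)/d)| ≤ Real.log X + 1 := by
  have hd0 : (0:ℝ) < d := by exact_mod_cast hd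
  have hn1 : 1 ≤ X / d := by rw [Nat.one_le_div_iff (by omega)]; exact h
  obtain ⟨b1, b2⟩ := log_fact_bounds (X/d) hn1
  obtain ⟨n, hn⟩ : ∃ n, X / d = n := ⟨_, rfl⟩
  rw [hn] at hn1 b1 b2 ⊢
  set y := (X:ℝ)/d with hy
  have hny : (n:ℝ) ≤ y := by rw [← hn, hy]; exact Nat.cast_div_le
  have hyn : y < n + 1 := by
    rw [hy, div_lt_iff₀ hd0, ← hn]
    have := Nat.lt_div_mul_add (a := X) (b := d) (by omega)
    have h2 : X < (X/d + 1) * d := by rw [Nat.add_mul, one_mul]; exact this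
    exact_mod_cast h2
  have hn0 : (1:ℝ) ≤ n := by exact_mod_cast hn1
  have hyX : y ≤ X := by
    rw [hy]; apply div_le_self (by positivity); exact_mod_cast hd
  have hlX : Real.log y ≤ Real.log X := Real.log_le_log (by linarith) hyX
  have hln : Real.log n ≤ Real.log y := Real.log_le_log (by linarith) hny
  have hl0 : 0 ≤ Real.log n := Real.log_nonneg hn0
  -- mean value
  have hd1 : Real.log y - Real.log n ≤ (y - n)/n := by
    rw [← Real.log_div (by linarith) (by linarith)]
    have := Real.log_le_sub_one_of_pos (show 0 < y/n by apply div_pos <;> linarith)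
    have h : y/n - 1 = (y-n)/n := by field_simp
    linarith
  have hd1' : n * (Real.log y - Real.log n) ≤ y - n := by
    calc n * (Real.log y - Real.log n) ≤ n * ((y-n)/n) := by gcongr
      _ = y - n := by field_simp
  have hd2 : y - n ≤ y * (Real.log y - Real.log n) := by
    rw [← Real.log_div (by linarith) (by linarith)]
    have := Real.one_sub_inv_le_log_of_pos (show 0 < y/n by apply div_pos <;> linarith)
    have hy0 : 0 < y := by linarith
    calc y - n = y * (1 - (y/n)⁻¹) := by field_simp
      _ ≤ _ := by gcongr
  rw [abs_le]
  constructor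
  · have : (y - n) * Real.log y ≤ 1 * Real.log y := by
      apply mul_le_mul_of_nonneg_right <;> linarith
    nlinarith
  · have : 0 ≤ (y - n) * Real.log n := mul_nonneg (by linarith) hl0
    nlinarith

lemma step_sum (L : List (ℕ × ℕ)) (hL : ∀ s ∈ L, 1 ≤ s.1) (X : ℕ) :
    ∑ n ∈ Ioc 0 X, vonMangoldt n * (sS L (X / n) : ℝ) = sP L X := by
  induction L with
  | nil => simp [sS, sP]
  | cons s L ih =>
    simp only [sS, sP, Nat.cast_add, mul_add, Finset.sum_add_distrib]
    rw [ih (fun t ht => hL t (List.mem_cons_of_mem _ ht))]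
    congr 1
    have hs : 1 ≤ s.1 := hL s List.mem_cons_self
    rw [psi_nat, Finset.mul_sum]
    have : Ioc 0 (X / s.1) = (Ioc 0 X).filter (fun n => s.1 ≤ X / n) := by
      ext n
      simp only [mem_Ioc, mem_filter]
      constructor
      · rintro ⟨h1, h2⟩
        rw [Nat.le_div_iff_mul_le (by omega)] at h2
        refine ⟨⟨h1, by nlinarith⟩, ?_⟩
        rw [Nat.le_div_iff_mul_le h1]; linarith
      · rintro ⟨⟨h1, -⟩, h2⟩
        rw [Nat.le_div_iff_mul_le h1] at h2
        refine ⟨h1, ?_⟩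
        rw [Nat.le_div_iff_mul_le (by omega)]; linarith
    rw [this, Finset.sum_filter]
    refine Finset.sum_congr rfl fun n hn => ?_
    split_ifs <;> simp [mul_comm]

theorem generic (D : ℕ) (b : ℕ → ℝ) (q : ℝ) (L : List (ℕ × ℕ)) (hL : ∀ s ∈ L, 1 ≤ s.1)
    (hb : ∑ d ∈ Icc 1 D, b d / d = 0)
    (h : ∀ m : ℕ, 1 ≤ m → q ≤ (sS L m : ℝ) + ∑ d ∈ Icc 1 D, b d * ((m / d : ℕ) : ℝ))
    (X : ℕ) (hX : D ≤ X) :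
    q * Chebyshev.psi X ≤ (-∑ d ∈ Icc 1 D, b d / d * Real.log d) * X
      + (∑ d ∈ Icc 1 D, |b d|) * (Real.log X + 1) + sP L X := by
  have e1 : ∑ d ∈ Icc 1 D, b d * Real.log ((X / d).factorial : ℝ) =
      ∑ n ∈ Ioc 0 X, vonMangoldt n * ∑ d ∈ Icc 1 D, b d * ((X / n / d : ℕ) : ℝ) := by
    simp_rw [Finset.mul_sum]
    rw [Finset.sum_comm]
    refine Finset.sum_congr rfl fun d hd => ?_
    rw [log_fact, Finset.mul_sum]
    have hsub : Ioc 0 (X / d) ⊆ Ioc 0 X := by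
      apply Finset.Ioc_subset_Ioc_right; exact Nat.div_le_self _ _
    rw [← Finset.sum_subset hsub (f := fun n => vonMangoldt n * (b d * ((X / n / d : ℕ) : ℝ)))]
    · refine Finset.sum_congr rfl fun n hn => ?_
      rw [Nat.div_div_eq_div_mul, Nat.div_div_eq_div_mul, mul_comm d n]; ring
    · intro n hn hn2
      simp only [mem_Ioc, not_and, not_le] at hn hn2
      have := hn2 hn.1
      have : X / n / d = 0 := by
        rw [Nat.div_div_eq_div_mul, mul_comm, ← Nat.div_div_eq_div_mul]
        exact Nat.div_eq_of_lt this
      simp [this]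
  have e2 : q * Chebyshev.psi X ≤ sP L X + ∑ d ∈ Icc 1 D, b d * Real.log ((X / d).factorial : ℝ) := by
    rw [e1, ← step_sum L hL, ← Finset.sum_add_distrib, psi_nat, Finset.mul_sum]
    apply Finset.sum_le_sum
    intro n hn
    simp only [mem_Ioc] at hn
    have := h (X / n) (by rw [Nat.one_le_div_iff (by omega)]; omega)
    have hv : 0 ≤ vonMangoldt n := vonMangoldt_nonneg
    nlinarith
  have e3 : ∑ d ∈ Icc 1 D, b d * Real.log ((X / d).factorial : ℝ) ≤
      ∑ d ∈ Icc 1 D, (b d * ((X:ℝ)/d * Real.log ((X:ℝ)/d) - (X:ℝ)/d) + |b d| * (Real.log X + 1)) := by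
    apply Finset.sum_le_sum
    intro d hd
    simp only [mem_Icc] at hd
    have h1 := floor_fact X d hd.1 (by omega)
    have h2 : b d * (Real.log ((X / d).factorial : ℝ) - ((X:ℝ)/d * Real.log ((X:ℝ)/d) - (X:ℝ)/d)) ≤
        |b d| * (Real.log X + 1) := by
      refine (le_abs_self _).trans ?_
      rw [abs_mul]; gcongr
    linarith
  have e4 : ∑ d ∈ Icc 1 D, b d * ((X:ℝ)/d * Real.log ((X:ℝ)/d) - (X:ℝ)/d) =
      (X * Real.log X - X) * ∑ d ∈ Icc 1 D, b d / d + (-∑ d ∈ Icc 1 D, b d / d * Real.log d) * X := by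
    rw [neg_mul, Finset.sum_mul, ← Finset.sum_neg_distrib, Finset.mul_sum, ← Finset.sum_add_distrib]
    refine Finset.sum_congr rfl fun d hd => ?_
    simp only [mem_Icc] at hd
    have hd0 : (d:ℝ) ≠ 0 := by norm_cast; omega
    have hX0 : (X:ℝ) ≠ 0 := by norm_cast; omega
    rw [Real.log_div hX0 hd0]; ring
  rw [Finset.sum_add_distrib, e4, hb, ← Finset.sum_mul] at e3
  linarith

end Elem

/-! part P21 -/

namespace Elem
open Finset

/-- binary-splitting sum over `Ico lo (lo+2^k)` -/
def bsum (f : ℕ → ℕ) : ℕ → ℕ → ℕ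
  | 0, lo => f lo
  | k+1, lo => bsum f k lo + bsum f k (lo + 2^k)

lemma bsum_eq (f : ℕ → ℕ) (k lo : ℕ) : bsum f k lo = ∑ d ∈ Ico lo (lo + 2^k), f d := by
  induction k generalizing lo with
  | zero => simp [bsum]
  | succ k ih =>
    rw [bsum, ih, ih, pow_succ, mul_two, ← add_assoc, Finset.sum_Ico_consecutive] <;> exact Nat.le_add_right _ _

lemma bsum_Icc (f : ℕ → ℕ) (k : ℕ) : bsum f k 1 = ∑ d ∈ Icc 1 (2^k), f d := by
  rw [bsum_eq]; congr 1; ext; simp; omega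

/-- repetition number: powers `2^(w*(j*d-r))` over multiples `j*d` of `d` in `(r, r+n)` -/
def Gd (w r n d : ℕ) : ℕ :=
  2^(w*(d*(r/d+1)-r)) * (2^(w*d*((r+(n-1))/d - r/d)) / (2^(w*d) - 1))

def sC : List (ℕ × ℕ) → ℕ
  | [] => 0
  | s :: L => s.2 + sC L

def sB (w r n : ℕ) : List (ℕ × ℕ) → ℕ
  | [] => 0
  | s :: L => s.2 * 2^(w*(min (s.1 - r) n)) + sB w r n L

def gterm (w r n : ℕ) (b : ℕ → ℕ) (d : ℕ) : ℕ := if b d = 0 then 0 else b d * Gd w r n d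

def laneX (w r n k q : ℕ) (bp bn : ℕ → ℕ) (L : List (ℕ × ℕ)) : ℕ :=
  ((2^(w*n) * (bsum (fun d => bp d * ((r+(n-1))/d)) k 1 + sC L + (2^(w-1) - q)) + (bsum (gterm w r n bn) k 1 + bsum (fun d => bn d * (r/d)) k 1))
   - (bsum (gterm w r n bp) k 1 + bsum (fun d => bp d * (r/d)) k 1 + sB w r n L + (2^(w-1) - q) + 2^(w*n) * bsum (fun d => bn d * ((r+(n-1))/d)) k 1))
   / (2^w - 1)

def laneM (w n : ℕ) : ℕ := 2^(w-1) * ((2^(w*n) - 1) / (2^w - 1))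

def allLe (N : ℕ) : List (ℕ × ℕ) → Bool
  | [] => true
  | s :: L => Nat.ble 1 s.1 && Nat.ble s.1 N && allLe N L

def land' (x y : ℕ) : Bool := Nat.beq (Nat.land x y) y

/-- check of the lanes `r ≤ m < r + n` -/
def laneCheck (w r n k q : ℕ) (bp bn : ℕ → ℕ) (L : List (ℕ × ℕ)) : Bool :=
  land' (laneX w r n k q bp bn L) (laneM w n)

def pack (B : ℕ) (x : ℕ → ℕ) (N : ℕ) : ℕ := ∑ m ∈ range N, x m * B^m

lemma pack_lt {B : ℕ} {x : ℕ → ℕ} (N : ℕ) (hx : ∀ m < N, x m < B) : pack B x N < B ^ N := by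
  induction N with
  | zero => simp [pack]
  | succ N ih =>
    have h1 := ih (fun m hm => hx m (by omega))
    have h2 := hx N (by omega)
    rw [pack, Finset.sum_range_succ, ← pack, pow_succ]
    have : x N * B^N + B^N ≤ B * B^N := by
      rw [← Nat.succ_mul]; exact Nat.mul_le_mul_right _ h2
    linarith

lemma pack_lane {B : ℕ} (hB : 0 < B) {x : ℕ → ℕ} (N : ℕ) (hx : ∀ m < N, x m < B) (m : ℕ) (hm : m < N) :
    pack B x N / B^m % B = x m := by
  induction N with
  | zero => omega
  | succ N ih =>
    rw [pack, Finset.sum_range_succ, ← pack]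
    rcases Nat.lt_succ_iff_lt_or_eq.mp hm with h | h
    · obtain ⟨j, rfl⟩ : ∃ j, N = m + 1 + j := ⟨N - (m+1), by omega⟩
      have : x (m+1+j) * B^(m+1+j) = B^m * (B * (x (m+1+j) * B^j)) := by ring
      rw [this, Nat.add_mul_div_left _ _ (by positivity), Nat.add_mul_mod_self_left]
      exact ih (fun m hm => hx m (by omega)) h
    · subst h
      rw [Nat.add_mul_div_right _ _ (by positivity), Nat.div_eq_of_lt (pack_lt m (fun i hi => hx i (by omega))),
        zero_add, Nat.mod_eq_of_lt (hx m (by omega))]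

lemma pack_add (B : ℕ) (x y : ℕ → ℕ) (N : ℕ) : pack B (fun m => x m + y m) N = pack B x N + pack B y N := by
  simp [pack, Finset.sum_add_distrib, add_mul]

lemma pack_smul (B c : ℕ) (x : ℕ → ℕ) (N : ℕ) : pack B (fun m => c * x m) N = c * pack B x N := by
  simp [pack, Finset.mul_sum, mul_assoc]

lemma pack_sum (B : ℕ) (s : Finset ℕ) (x : ℕ → ℕ → ℕ) (N : ℕ) :
    pack B (fun m => ∑ d ∈ s, x d m) N = ∑ d ∈ s, pack B (x d) N := by
  simp only [pack, Finset.sum_mul]; rw [Finset.sum_comm]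

lemma pack_one (B : ℕ) (hB : 1 ≤ B) (N : ℕ) : (B-1) * pack B (fun _ => 1) N + 1 = B^N := by
  obtain ⟨b, rfl⟩ : ∃ b, B = b + 1 := ⟨B-1, by omega⟩
  induction N with
  | zero => simp [pack]
  | succ N ih =>
    rw [pack, Finset.sum_range_succ, ← pack]
    simp only [Nat.add_sub_cancel] at *
    rw [pow_succ]; nlinarith

lemma pack_step (B : ℕ) (hB : 1 ≤ B) (s N : ℕ) (h : s ≤ N) :
    (B-1) * pack B (fun m => if s ≤ m then 1 else 0) N + B^s = B^N := by
  obtain ⟨b, rfl⟩ : ∃ b, B = b + 1 := ⟨B-1, by omega⟩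
  induction N, h using Nat.le_induction with
  | base =>
    have : pack (b+1) (fun m => if s ≤ m then 1 else 0) s = 0 := by
      apply Finset.sum_eq_zero
      intro m hm; simp only [mem_range] at hm
      simp; omega
    rw [this]; simp
  | succ N hN ih =>
    rw [pack, Finset.sum_range_succ, ← pack, if_pos hN]
    simp only [Nat.add_sub_cancel] at *
    rw [pow_succ]; nlinarith

lemma pack_div (B : ℕ) (hB : 1 ≤ B) (d r n : ℕ) :
    (B-1) * pack B (fun i => (r+i) / d) (n+1) + (∑ i ∈ range ((r+n)/d - r/d), B^((d*(r/d+1)-r)+d*i) + r/d)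
      = ((r+n)/d) * B^(n+1) := by
  obtain ⟨b, rfl⟩ : ∃ b, B = b + 1 := ⟨B-1, by omega⟩
  induction n with
  | zero => simp [pack]; ring
  | succ n ih =>
    rw [pack, Finset.sum_range_succ, ← pack]
    simp only [Nat.add_sub_cancel] at *
    rw [← add_assoc r n 1, Nat.succ_div]
    have hmon : r / d ≤ (r+n)/d := Nat.div_le_div_right (by omega)
    split_ifs with hdv
    · rw [show (r+n)/d + 1 - r/d = ((r+n)/d - r/d) + 1 by omega, Finset.sum_range_succ]
      have h1 : d * ((r+n)/d + 1) = r + n + 1 := by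
        have := Nat.succ_div_of_dvd hdv
        rw [← this]; exact Nat.mul_div_cancel' hdv
      have h2 : d*(r/d+1)-r + d * ((r+n)/d - r/d) = n + 1 := by
        have hd0 : 0 < d := by
          rcases Nat.eq_zero_or_pos d with h | h
          · subst h; simp at h1
          · exact h
        have h3 : r < d*(r/d+1) := by
          have := Nat.lt_mul_div_succ r hd0
          exact this
        obtain ⟨c, hc⟩ : ∃ c, (r+n)/d = r/d + c := ⟨(r+n)/d - r/d, by omega⟩
        rw [hc] at h1 ⊢
        have h4 : d*(r/d+1) + d * c = r + n + 1 := by rw [← h1]; ring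
        rw [Nat.add_sub_cancel_left]
        omega
      rw [h2, pow_succ _ (n+1)]; nlinarith
    · rw [add_zero, pow_succ _ (n+1)]; nlinarith

lemma Gd_eq (w r n d : ℕ) (hw : 2 ≤ w) (hd : 1 ≤ d) :
    Gd w r n d = ∑ i ∈ range ((r+(n-1))/d - r/d), (2^w)^((d*(r/d+1)-r)+d*i) := by
  rw [Gd]
  generalize (r+(n-1))/d - r/d = k
  generalize d*(r/d+1)-r = e
  have : ∑ i ∈ range k, (2^w)^(e+d*i) = 2^(w*e) * ∑ i ∈ range k, 2^(w*d*i) := by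
    rw [Finset.mul_sum]
    refine Finset.sum_congr rfl fun i _ => ?_
    rw [← pow_mul, ← pow_add]; ring_nf
  rw [this]
  clear this
  congr 1
  · have h1 : 1 ≤ 2^(w*d) := Nat.one_le_two_pow
    have key : (∑ i ∈ range k, 2^(w*d*i)) * (2^(w*d) - 1) + 1 = 2^(w*d*k) := by
      induction k with
      | zero => simp
      | succ k ih =>
        rw [Finset.sum_range_succ, add_mul]
        have h2 : 2^(w*d*(k+1)) = 2^(w*d*k) * 2^(w*d) := by rw [← pow_add]; ring_nf
        rw [h2]
        obtain ⟨y, hy⟩ : ∃ y, 2^(w*d) = y + 1 := ⟨2^(w*d)-1, by omega⟩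
        rw [hy] at ih ⊢
        simp only [Nat.add_sub_cancel] at *
        rw [← ih]; ring
    have h4 : 2^2 ≤ 2^(w*d) := Nat.pow_le_pow_right (by norm_num) (by nlinarith)
    rw [← key, add_comm, Nat.add_mul_div_right _ _ (by omega), Nat.div_eq_of_lt (by omega), zero_add]

lemma pack_congr {B : ℕ} {x y : ℕ → ℕ} {n : ℕ} (h : ∀ i < n, x i = y i) : pack B x n = pack B y n := by
  apply Finset.sum_congr rfl
  intro i hi
  rw [h i (mem_range.mp hi)]

lemma sS_pack (w r n : ℕ) (L : List (ℕ × ℕ)) :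
    (2^w-1) * pack (2^w) (fun i => sS L (r+i)) n + sB w r n L = 2^(w*n) * sC L := by
  induction L with
  | nil => simp [sS, sB, sC, pack]
  | cons s L ih =>
    have h2 := pack_step (2^w) Nat.one_le_two_pow (min (s.1 - r) n) n (min_le_right _ _)
    have h3 : pack (2^w) (fun i => sS (s::L) (r+i)) n
        = s.2 * pack (2^w) (fun m => if min (s.1 - r) n ≤ m then 1 else 0) n
        + pack (2^w) (fun i => sS L (r+i)) n := by
      rw [← pack_smul, ← pack_add]
      apply pack_congr
      intro i hi
      simp only [sS]
      congr 1
      have : s.1 ≤ r + i ↔ min (s.1 - r) n ≤ i := by omega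
      simp [this]
    rw [h3, sB, sC, mul_add, mul_add, ← ih, pow_mul, pow_mul, ← h2]; ring

lemma F_pack (w r n k : ℕ) (hw : 2 ≤ w) (hn : 1 ≤ n) (b : ℕ → ℕ) :
    (2^w-1) * pack (2^w) (fun i => ∑ d ∈ Icc 1 (2^k), b d * ((r+i)/d)) n +
      (bsum (gterm w r n b) k 1 + bsum (fun d => b d * (r/d)) k 1)
      = 2^(w*n) * bsum (fun d => b d * ((r+(n-1))/d)) k 1 := by
  rw [bsum_Icc, bsum_Icc, bsum_Icc, pack_sum, Finset.mul_sum, Finset.mul_sum, ← Finset.sum_add_distrib,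
    ← Finset.sum_add_distrib]
  refine Finset.sum_congr rfl fun d hd => ?_
  simp only [mem_Icc] at hd
  have h1 : gterm w r n b d = b d * Gd w r n d := by
    rw [gterm]; split_ifs with h <;> simp [h]
  rw [h1, Gd_eq w r n d hw hd.1, pack_smul]
  have := pack_div (2^w) Nat.one_le_two_pow d r (n-1)
  rw [Nat.sub_add_cancel hn, ← pow_mul] at this
  have e : ∀ P G K : ℕ, (2^w-1) * P + G = K → (2^w-1) * (b d * P) + b d * G = b d * K := by
    intro P G K h; rw [← h]; ring
  have e2 := e _ _ _ this
  rw [mul_add] at e2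
  rw [e2]; ring

lemma sS_le (L : List (ℕ × ℕ)) (m : ℕ) : sS L m ≤ sC L := by
  induction L with
  | nil => simp [sS]
  | cons s L ih => simp only [sS, sC]; split_ifs <;> omega

lemma sS_mono (L : List (ℕ × ℕ)) {m n : ℕ} (h : m ≤ n) : sS L m ≤ sS L n := by
  induction L with
  | nil => simp [sS]
  | cons s L ih => simp only [sS]; split_ifs <;> omega

lemma sS_all (L : List (ℕ × ℕ)) (N : ℕ) (hL : allLe N L = true) : sS L N = sC L := by
  induction L with
  | nil => simp [sS, sC]
  | cons s L ih =>
    simp only [allLe, Bool.and_eq_true, Nat.ble_eq] at hL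
    simp only [sS, sC, if_pos hL.1.2, ih hL.2]

lemma allLe_pos (L : List (ℕ × ℕ)) (N : ℕ) (hL : allLe N L = true) : ∀ s ∈ L, 1 ≤ s.1 := by
  induction L with
  | nil => simp
  | cons s L ih =>
    simp only [allLe, Bool.and_eq_true, Nat.ble_eq] at hL
    intro t ht
    rcases List.mem_cons.mp ht with rfl | h
    · exact hL.1.1
    · exact ih hL.2 t h

theorem lane (w r n k q lo hi : ℕ) (hq : 1 ≤ q) (hw : 2 ≤ w) (hn1 : 1 ≤ n) (bp bn : ℕ → ℕ) (L : List (ℕ × ℕ))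
    (hlo : lo + q ≤ 2^(w-1)) (hhi : hi + sC L ≤ 2^(w-1))
    (hlo' : ∀ m, m < r + n → ∑ d ∈ Icc 1 (2^k), bn d * (m/d) ≤ ∑ d ∈ Icc 1 (2^k), bp d * (m/d) + lo)
    (hhi' : ∀ m, m < r + n → ∑ d ∈ Icc 1 (2^k), bp d * (m/d) ≤ ∑ d ∈ Icc 1 (2^k), bn d * (m/d) + hi)
    (hc : laneCheck w r n k q bp bn L = true) (m : ℕ) (hm : r ≤ m) (hmN : m < r + n) :
    q + ∑ d ∈ Icc 1 (2^k), bn d * (m/d) ≤ ∑ d ∈ Icc 1 (2^k), bp d * (m/d) + sS L m := by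
  simp only [laneCheck, land', Nat.beq_eq] at hc
  have hX := hc
  set H := 2^(w-1) with hH
  set B := 2^w with hB
  have hBH : B = 2 * H := by
    rw [hB, hH, ← pow_succ']; congr 1; omega
  have hH1 : 1 ≤ H := Nat.one_le_two_pow
  set Fp : ℕ → ℕ := fun i => ∑ d ∈ Icc 1 (2^k), bp d * ((r+i)/d) with hFp
  set Fn : ℕ → ℕ := fun i => ∑ d ∈ Icc 1 (2^k), bn d * ((r+i)/d) with hFn
  set S : ℕ → ℕ := fun i => sS L (r+i) with hS
  set x : ℕ → ℕ := fun m => Fp m + S m + (H - q) - Fn m with hx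
  have hxe : ∀ m < n, x m + Fn m = Fp m + S m + (H - q) := by
    intro m hm
    have h1 : Fn m ≤ Fp m + lo := hlo' (r+m) (by omega)
    simp only [hx]
    omega
  have hxB : ∀ m < n, x m < B := by
    intro m hm
    have h1 : Fp m ≤ Fn m + hi := hhi' (r+m) (by omega)
    have h2 : S m ≤ sC L := sS_le L (r+m)
    simp only [hx]
    omega
  have hpk : pack B x n + pack B Fn n = pack B Fp n + pack B S n + (H-q) * pack B (fun _ => 1) n := by
    rw [← pack_smul, ← pack_add, ← pack_add, ← pack_add]
    apply pack_congr
    intro m hm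
    have := hxe m hm
    simp only [mul_one]
    rw [this]
  have hXe : laneX w r n k q bp bn L = pack B x n := by
    rw [laneX]
    apply Nat.div_eq_of_eq_mul_left
    · have : 2 ≤ B := by omega
      omega
    · have e1 := F_pack w r n k hw hn1 bp
      have e2 := F_pack w r n k hw hn1 bn
      have e3 := sS_pack w r n L
      have e4 := pack_one B Nat.one_le_two_pow n
      rw [← pow_mul] at e4
      rw [mul_add, mul_add, ← e1, ← e2, ← e3, ← e4]
      simp only [← hH, ← hB]
      have h5 : (B-1) * (pack B x n + pack B Fn n) = (B-1) * (pack B Fp n + pack B S n + (H-q) * pack B (fun _ => 1) n) := by rw [hpk]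
      have h6 : (B-1) * pack B Fn n = (B-1) * pack B (fun i => ∑ d ∈ Icc 1 (2^k), bn d * ((r+i)/d)) n := rfl
      have h7 : (B-1) * pack B Fp n = (B-1) * pack B (fun i => ∑ d ∈ Icc 1 (2^k), bp d * ((r+i)/d)) n := rfl
      have h9 : (B-1) * pack B S n = (B-1) * pack B (fun i => sS L (r+i)) n := rfl
      rw [← h6, ← h7, ← h9]
      rw [mul_comm (pack B x n)]
      rw [mul_add, mul_add, mul_add] at h5
      have h8 : ((B-1) * pack B (fun _ => 1) n + 1) * (H-q) = (B-1) * ((H-q) * pack B (fun _ => 1) n) + (H-q) := by ring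
      rw [h8]
      omega
  set h : ℕ → ℕ := fun _ => H with hh
  have hhB : ∀ m < n, h m < B := by
    intro m _; simp only [hh]; omega
  have hMe : laneM w n = pack B h n := by
    rw [laneM]
    have e := pack_one B Nat.one_le_two_pow n
    rw [hB, ← pow_mul, ← hB] at e
    have : (2^(w*n) - 1) / (B - 1) = pack B (fun _ => 1) n := by
      apply Nat.div_eq_of_eq_mul_left
      · have : 2 ≤ B := by omega
        omega
      · have hcm := mul_comm (B-1) (pack B (fun _ => 1) n)
        omega
    rw [this, ← pack_smul]
    simp [hh, hH]
  rw [hXe, hMe] at hX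
  change pack B x n &&& pack B h n = pack B h n at hX
  obtain ⟨i, rfl⟩ : ∃ i, m = r + i := ⟨m - r, by omega⟩
  have hin : i < n := by omega
  have key : x i &&& H = H := by
    have e1 := pack_lane (by omega : 0 < B) n hxB i hin
    have e2 := pack_lane (by omega : 0 < B) n hhB i hin
    have hhm : h i = H := rfl
    rw [hhm] at e2
    conv_rhs => rw [← e2, ← hX]
    rw [hB, ← pow_mul, Nat.and_div_two_pow, Nat.and_mod_two_pow, pow_mul, ← hB, e1, e2]
  have hle : H ≤ x i := by
    calc H = x i &&& H := key.symm
      _ ≤ x i := Nat.and_le_left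
  have := hxe i hin
  change q + Fn i ≤ Fp i + S i
  omega

end Elem

/-! part P22 -/

namespace Elem
open Finset

lemma frac_bound (m d : ℕ) (hd : 1 ≤ d) : ((m/d : ℕ):ℝ) ≤ m/d ∧ (m:ℝ)/d ≤ ((m/d : ℕ):ℝ) + 1 := by
  have hd0 : (0:ℝ) < d := by exact_mod_cast hd
  refine ⟨Nat.cast_div_le, ?_⟩
  rw [div_le_iff₀ hd0]
  have h2 : m ≤ (m/d + 1) * d := by
    have := Nat.lt_div_mul_add (a := m) (b := d) (by omega)
    rw [Nat.add_mul, one_mul]; omega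
  exact_mod_cast h2

lemma F_bounds (D : ℕ) (bp bn : ℕ → ℕ) (m : ℕ) :
    (∑ d ∈ Icc 1 D, (bp d:ℝ) * ((m/d : ℕ):ℝ)) - ∑ d ∈ Icc 1 D, (bn d:ℝ) * ((m/d : ℕ):ℝ) ≤
      -(m:ℝ) * (∑ d ∈ Icc 1 D, ((bn d:ℝ) - bp d)/d) + ∑ d ∈ Icc 1 D, (bn d:ℝ) ∧
    -(m:ℝ) * (∑ d ∈ Icc 1 D, ((bn d:ℝ) - bp d)/d) - ∑ d ∈ Icc 1 D, (bp d:ℝ) ≤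
      (∑ d ∈ Icc 1 D, (bp d:ℝ) * ((m/d : ℕ):ℝ)) - ∑ d ∈ Icc 1 D, (bn d:ℝ) * ((m/d : ℕ):ℝ) := by
  rw [Finset.mul_sum, ← Finset.sum_sub_distrib, ← Finset.sum_add_distrib, ← Finset.sum_sub_distrib]
  constructor
  · apply Finset.sum_le_sum
    intro d hd
    obtain ⟨h1, h2⟩ := frac_bound m d (mem_Icc.mp hd).1
    have h3 : -(m:ℝ) * (((bn d:ℝ) - bp d)/d) = (bp d) * ((m:ℝ)/d) - bn d * ((m:ℝ)/d) := by ring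
    have h4 : (0:ℝ) ≤ bp d := by positivity
    have h5 : (0:ℝ) ≤ bn d := by positivity
    nlinarith
  · apply Finset.sum_le_sum
    intro d hd
    obtain ⟨h1, h2⟩ := frac_bound m d (mem_Icc.mp hd).1
    have h3 : -(m:ℝ) * (((bn d:ℝ) - bp d)/d) = (bp d) * ((m:ℝ)/d) - bn d * ((m:ℝ)/d) := by ring
    have h4 : (0:ℝ) ≤ bp d := by positivity
    have h5 : (0:ℝ) ≤ bn d := by positivity
    nlinarith

theorem generic2 (D N q : ℕ) (hD : 1 ≤ D) (bp bn : ℕ → ℕ) (L : List (ℕ × ℕ)) (hL : allLe N L = true)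
    (h0 : 0 ≤ ∑ d ∈ Icc 1 D, ((bn d:ℝ) - bp d)/d)
    (h1 : D * ∑ d ∈ Icc 1 D, ((bn d:ℝ) - bp d)/d ≤ 1)
    (hc : ∀ m, 1 ≤ m → m < N →
      q + ∑ d ∈ Icc 1 D, bn d * (m/d) ≤ ∑ d ∈ Icc 1 D, bp d * (m/d) + sS L m)
    (ht : q + ∑ d ∈ Icc 1 D, bp d + 1 ≤ sC L)
    (X : ℕ) (hX : D ≤ X) :
    q * Chebyshev.psi X ≤ (∑ d ∈ Icc 1 D, ((bn d:ℝ) - bp d)/d * Real.log d) * X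
      + (∑ d ∈ Icc 1 D, ((bp d:ℝ) + bn d) + 1) * (Real.log X + 1) + sP L X := by
  set η := ∑ d ∈ Icc 1 D, ((bn d:ℝ) - bp d)/d with hη
  set c : ℕ → ℝ := fun d => if d = D then D * η else 0 with hcdef
  set b : ℕ → ℝ := fun d => (bp d:ℝ) - bn d + c d with hb
  have hD0 : (0:ℝ) < D := by exact_mod_cast hD
  have hc0 : ∀ d, 0 ≤ c d := by
    intro d; simp only [hcdef]; split_ifs
    · positivity
    · exact le_rfl
  have hsc : ∀ f : ℕ → ℝ, ∑ d ∈ Icc 1 D, c d * f d = D * η * f D := by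
    intro f
    simp only [hcdef, ite_mul, zero_mul]
    rw [Finset.sum_ite_eq' (Icc 1 D) D (fun d => D * η * f d)]
    simp [hD]
  have hbz : ∑ d ∈ Icc 1 D, b d / d = 0 := by
    have e : ∀ d ∈ Icc 1 D, b d / d = -(((bn d:ℝ) - bp d)/d) + c d * (1/d) := by
      intro d _; simp only [hb]; ring
    rw [Finset.sum_congr rfl e, Finset.sum_add_distrib, hsc, Finset.sum_neg_distrib, ← hη]
    field_simp; ring
  have hlow : ∀ m : ℕ, (∑ d ∈ Icc 1 D, (bp d:ℝ) * ((m/d : ℕ):ℝ)) - ∑ d ∈ Icc 1 D, (bn d:ℝ) * ((m/d : ℕ):ℝ)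
      + D * η * ((m/D : ℕ):ℝ) = ∑ d ∈ Icc 1 D, b d * ((m/d : ℕ):ℝ) := by
    intro m
    rw [← hsc (fun d => ((m/d : ℕ):ℝ)), ← Finset.sum_sub_distrib, ← Finset.sum_add_distrib]
    refine Finset.sum_congr rfl fun d _ => ?_
    simp only [hb]; ring
  have key : ∀ m : ℕ, 1 ≤ m → (q:ℝ) ≤ (sS L m : ℝ) + ∑ d ∈ Icc 1 D, b d * ((m / d : ℕ) : ℝ) := by
    intro m hm
    rw [← hlow]
    rcases lt_or_ge m N with h | h
    · have := hc m hm h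
      have h2 : ((q + ∑ d ∈ Icc 1 D, bn d * (m/d) : ℕ):ℝ) ≤ ((∑ d ∈ Icc 1 D, bp d * (m/d) + sS L m : ℕ):ℝ) := by
        exact_mod_cast this
      push_cast at h2
      have h3 : 0 ≤ D * η * ((m/D : ℕ):ℝ) := by positivity
      linarith
    · have h2 := (F_bounds D bp bn m).2
      rw [← hη] at h2
      have h3 : sC L ≤ sS L m := by rw [← sS_all L N hL]; exact sS_mono L h
      have h4 : ((q + ∑ d ∈ Icc 1 D, bp d + 1 : ℕ):ℝ) ≤ (sS L m:ℝ) := by exact_mod_cast ht.trans h3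
      push_cast at h4
      have h5 := (frac_bound m D hD).2
      have h6 : D * η * ((m:ℝ)/D) ≤ D * η * (((m/D : ℕ):ℝ) + 1) := by gcongr
      have h7 : D * η * ((m:ℝ)/D) = m * η := by field_simp
      nlinarith
  have g := generic D b q L (allLe_pos L N hL) hbz key X hX
  have hlogX : 0 ≤ Real.log X := Real.log_natCast_nonneg X
  have hA : -∑ d ∈ Icc 1 D, b d / d * Real.log d ≤ ∑ d ∈ Icc 1 D, ((bn d:ℝ) - bp d)/d * Real.log d := by
    rw [← Finset.sum_neg_distrib]
    apply Finset.sum_le_sum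
    intro d _
    have : 0 ≤ c d / d * Real.log d :=
      mul_nonneg (div_nonneg (hc0 d) (by positivity)) (Real.log_natCast_nonneg d)
    have e : -(b d / d * Real.log d) = ((bn d:ℝ) - bp d)/d * Real.log d - c d / d * Real.log d := by
      simp only [hb]; ring
    linarith
  have hC : ∑ d ∈ Icc 1 D, |b d| ≤ ∑ d ∈ Icc 1 D, ((bp d:ℝ) + bn d) + 1 := by
    have e : ∑ d ∈ Icc 1 D, |b d| ≤ ∑ d ∈ Icc 1 D, (((bp d:ℝ) + bn d) + c d * 1) := by
      apply Finset.sum_le_sum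
      intro d _
      have h4 : (0:ℝ) ≤ bp d := by positivity
      have h5 : (0:ℝ) ≤ bn d := by positivity
      have := hc0 d
      simp only [hb]
      rw [abs_le]; constructor <;> linarith
    rw [Finset.sum_add_distrib, hsc] at e
    linarith
  have hX0 : (0:ℝ) ≤ X := by positivity
  calc _ ≤ _ := g
    _ ≤ _ := by gcongr

/-! fixed point logarithms -/

def lamLo (T j : ℕ) : ℕ :=
  if j = 1 then T * 6931471803 / 10000000000 else
    2*T/(2*j+1) + 2*T/(3*(2*j+1)^3) + 2*T/(5*(2*j+1)^5)

def lamHi (T j : ℕ) : ℕ :=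
  if j = 1 then T * 6931471808 / 10000000000 + 1 else
    2*T/(2*j+1) + 2*T/(3*(2*j+1)^3) + 2*T/(5*(2*j+1)^5) + 2*T/((2*j+1)^5*((2*j+1)^2-1)) + 4

lemma lam_bounds (T j : ℕ) (hj : 1 ≤ j) :
    (lamLo T j : ℝ) ≤ T * (Real.log (j+1) - Real.log j) ∧ T * (Real.log (j+1) - Real.log j) ≤ (lamHi T j : ℝ) := by
  have hT : (0:ℝ) ≤ T := by positivity
  by_cases h1 : j = 1
  · subst h1
    simp only [lamLo, lamHi, if_true]
    have a := frac_bound (T * 6931471803) 10000000000 (by norm_num)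
    have b := frac_bound (T * 6931471808) 10000000000 (by norm_num)
    have c := Real.log_two_gt_d9
    have d := Real.log_two_lt_d9
    push_cast at *
    norm_num at *
    constructor <;> nlinarith [a.1, b.2]
  · have hj0 : (1:ℝ) ≤ j := by exact_mod_cast hj
    set n : ℕ := 2*j+1 with hn
    have hnr : (n:ℝ) = 2*j+1 := by rw [hn]; push_cast; ring
    have hn0 : (3:ℝ) ≤ n := by rw [hnr]; linarith
    have hx : (1 + 1/(n:ℝ))/(1 - 1/(n:ℝ)) = (j+1)/j := by
      have h2 : (n:ℝ) - 1 ≠ 0 := by linarith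
      have h3 : (j:ℝ) ≠ 0 := by linarith
      rw [show 1 - 1/(n:ℝ) = (n-1)/n by field_simp, show 1 + 1/(n:ℝ) = (n+1)/n by field_simp,
        div_div_div_cancel_right₀ (by linarith), hnr]
      field_simp; ring
    have hl : Real.log ((1 + 1/(n:ℝ))/(1 - 1/(n:ℝ))) = Real.log (j+1) - Real.log j := by
      rw [hx, Real.log_div (by linarith) (by linarith)]
    have p0 : (0:ℝ) ≤ 1/n := by positivity
    have p1 : 1/(n:ℝ) < 1 := by rw [div_lt_one (by linarith)]; linarith
    have L1 := Real.sum_range_le_log_div p0 p1 3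
    have U1 := Real.log_div_le_sum_range_add p0 p1 3
    rw [hl] at L1 U1
    simp only [Finset.sum_range_succ, Finset.sum_range_zero] at L1 U1
    norm_num at L1 U1
    rw [lamLo, lamHi, if_neg h1, if_neg h1, ← hn]
    have a := frac_bound (2*T) n (by omega)
    have b := frac_bound (2*T) (3*n^3) (by have : 0 < n^3 := by positivity
                                           omega)
    have c := frac_bound (2*T) (5*n^5) (by have : 0 < n^5 := by positivity
                                           omega)
    have h9 : 3^2 ≤ n^2 := Nat.pow_le_pow_left (by omega) 2
    have d := frac_bound (2*T) (n^5*(n^2-1)) (by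
      have : 0 < n^5*(n^2-1) := by
        apply Nat.mul_pos
        · positivity
        · omega
      omega)
    have hsub : ((n^2-1 : ℕ):ℝ) = (n:ℝ)^2 - 1 := by
      rw [Nat.cast_sub (by omega)]; push_cast; ring
    push_cast [hsub] at a b c d ⊢
    have hn1 : (n:ℝ)^2 - 1 ≠ 0 := by nlinarith
    have hnz : (n:ℝ) ≠ 0 := by linarith
    constructor
    · calc _ ≤ 2*(T:ℝ)/n + 2*T/(3*n^3) + 2*T/(5*n^5) := by linarith [a.1, b.1, c.1]
        _ = T * (2 * ((n:ℝ)⁻¹ + ((n:ℝ)^3)⁻¹/3 + ((n:ℝ)^5)⁻¹/5)) := by field_simp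
        _ ≤ _ := by gcongr; linarith
    · calc T * (Real.log (j+1) - Real.log j) ≤
          T * (2 * ((n:ℝ)⁻¹ + ((n:ℝ)^3)⁻¹/3 + ((n:ℝ)^5)⁻¹/5 + ((n:ℝ)^7)⁻¹/(1-((n:ℝ)^2)⁻¹))) := by
            gcongr
            linarith
        _ = 2*(T:ℝ)/n + 2*T/(3*n^3) + 2*T/(5*n^5) + 2*T/(n^5*(n^2-1)) := by
            have : 1-((n:ℝ)^2)⁻¹ = ((n:ℝ)^2-1)/n^2 := by field_simp
            rw [this]; field_simp
        _ ≤ _ := by linarith [a.2, b.2, c.2, d.2]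

/-- evaluate a natural number before passing it on -/
def force {α : Type} (n : ℕ) (k : ℕ → α) : α := Nat.rec (k 0) (fun m _ => k (m + 1)) n

lemma force_eq {α : Type} (n : ℕ) (k : ℕ → α) : force n k = k n := by
  cases n <;> rfl

def SL (b lam : ℕ → ℕ) : ℕ → ℕ → ℕ → ℕ
  | 0, lo, c => b lo * (c/lo)
  | k+1, lo, c => SL b lam k lo c + force (c + bsum lam k lo) (fun c' => SL b lam k (lo+2^k) c')

def SU (b lam : ℕ → ℕ) : ℕ → ℕ → ℕ → ℕ
  | 0, lo, c => b lo * (c/lo+1)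
  | k+1, lo, c => SU b lam k lo c + force (c + bsum lam k lo) (fun c' => SU b lam k (lo+2^k) c')

lemma bsum_lamLo (T k lo : ℕ) (hlo : 1 ≤ lo) :
    (bsum (lamLo T) k lo : ℝ) ≤ T * (Real.log ((lo + 2^k : ℕ):ℝ) - Real.log lo) := by
  induction k generalizing lo with
  | zero => simpa [bsum] using (lam_bounds T lo hlo).1
  | succ k ih =>
    have h1 := ih lo hlo
    have h2 := ih (lo+2^k) (le_trans hlo (Nat.le_add_right _ _))
    rw [bsum]
    rw [show lo + 2^(k+1) = lo + 2^k + 2^k by ring]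
    push_cast at *
    linarith

lemma bsum_lamHi (T k lo : ℕ) (hlo : 1 ≤ lo) :
    T * (Real.log ((lo + 2^k : ℕ):ℝ) - Real.log lo) ≤ (bsum (lamHi T) k lo : ℝ) := by
  induction k generalizing lo with
  | zero => simpa [bsum] using (lam_bounds T lo hlo).2
  | succ k ih =>
    have h1 := ih lo hlo
    have h2 := ih (lo+2^k) (le_trans hlo (Nat.le_add_right _ _))
    rw [bsum]
    rw [show lo + 2^(k+1) = lo + 2^k + 2^k by ring]
    push_cast at *
    linarith

lemma SL_le (b : ℕ → ℕ) (T k lo c : ℕ) (hlo : 1 ≤ lo) (hc : (c:ℝ) ≤ T * Real.log lo) :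
    (SL b (lamLo T) k lo c : ℝ) ≤ T * ∑ d ∈ Ico lo (lo+2^k), (b d:ℝ) / d * Real.log d := by
  induction k generalizing lo c with
  | zero =>
    simp only [SL, pow_zero, Nat.Ico_succ_singleton, Finset.sum_singleton]
    push_cast
    have h1 := (frac_bound c lo hlo).1
    have hlo0 : (0:ℝ) < lo := by exact_mod_cast hlo
    calc (b lo:ℝ) * ((c/lo:ℕ):ℝ) ≤ b lo * ((T * Real.log lo)/lo) := by
          gcongr; exact h1.trans (by gcongr)
      _ = _ := by ring
  | succ k ih =>
    have h1 := ih lo c hlo hc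
    have h2 := ih (lo+2^k) (c + bsum (lamLo T) k lo) (le_trans hlo (Nat.le_add_right _ _)) (by
      have := bsum_lamLo T k lo hlo
      push_cast at *; linarith)
    rw [SL, force_eq, pow_succ, mul_two, ← add_assoc,
      ← Finset.sum_Ico_consecutive (n := lo + 2^k) _ (Nat.le_add_right _ _) (Nat.le_add_right _ _)]
    push_cast at *
    linarith

lemma SU_ge (b : ℕ → ℕ) (T k lo c : ℕ) (hlo : 1 ≤ lo) (hc : T * Real.log lo ≤ (c:ℝ)) :
    T * ∑ d ∈ Ico lo (lo+2^k), (b d:ℝ) / d * Real.log d ≤ (SU b (lamHi T) k lo c : ℝ) := by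
  induction k generalizing lo c with
  | zero =>
    simp only [SU, pow_zero, Nat.Ico_succ_singleton, Finset.sum_singleton]
    push_cast
    have h1 := (frac_bound c lo hlo).2
    have hlo0 : (0:ℝ) < lo := by exact_mod_cast hlo
    calc (T:ℝ) * ((b lo:ℝ) / lo * Real.log lo) = b lo * ((T * Real.log lo)/lo) := by ring
      _ ≤ b lo * (((c/lo:ℕ):ℝ) + 1) := by
          gcongr; exact le_trans (by gcongr) h1
  | succ k ih =>
    have h1 := ih lo c hlo hc
    have h2 := ih (lo+2^k) (c + bsum (lamHi T) k lo) (le_trans hlo (Nat.le_add_right _ _)) (by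
      have := bsum_lamHi T k lo hlo
      push_cast at *; linarith)
    rw [SU, force_eq, pow_succ, mul_two, ← add_assoc,
      ← Finset.sum_Ico_consecutive (n := lo + 2^k) _ (Nat.le_add_right _ _) (Nat.le_add_right _ _)]
    push_cast at *
    linarith

lemma A_bound (bp bn : ℕ → ℕ) (T k a : ℕ) (hT : 0 < T)
    (h : Nat.ble (SU bn (lamHi T) k 1 0) (SL bp (lamLo T) k 1 0 + a) = true) :
    ∑ d ∈ Icc 1 (2^k), ((bn d:ℝ) - bp d)/d * Real.log d ≤ a / T := by
  rw [Nat.ble_eq] at h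
  have h1 := SL_le bp T k 1 0 le_rfl (by simp)
  have h2 := SU_ge bn T k 1 0 le_rfl (by simp)
  have e : Ico 1 (1+2^k) = Icc 1 (2^k) := by ext; simp; omega
  rw [e] at h1 h2
  have h3 : (SU bn (lamHi T) k 1 0 : ℝ) ≤ SL bp (lamLo T) k 1 0 + a := by exact_mod_cast h
  have hT0 : (0:ℝ) < T := by exact_mod_cast hT
  rw [le_div_iff₀ hT0]
  have : ∑ d ∈ Icc 1 (2^k), ((bn d:ℝ) - bp d)/d * Real.log d =
    ∑ d ∈ Icc 1 (2^k), (bn d:ℝ)/d * Real.log d - ∑ d ∈ Icc 1 (2^k), (bp d:ℝ)/d * Real.log d := by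
    rw [← Finset.sum_sub_distrib]
    refine Finset.sum_congr rfl fun d _ => by ring
  rw [this]
  linarith

lemma inv_bounds (b : ℕ → ℕ) (T k : ℕ) :
    (bsum (fun d => b d * (T/d)) k 1 : ℝ) ≤ T * ∑ d ∈ Icc 1 (2^k), (b d:ℝ)/d ∧
    T * ∑ d ∈ Icc 1 (2^k), (b d:ℝ)/d ≤ (bsum (fun d => b d * (T/d+1)) k 1 : ℝ) := by
  rw [bsum_Icc, bsum_Icc, Finset.mul_sum]
  push_cast
  constructor <;> apply Finset.sum_le_sum <;> intro d hd
  · have h1 := (frac_bound T d (mem_Icc.mp hd).1).1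
    calc _ ≤ (b d:ℝ) * (T/d) := by gcongr
      _ = _ := by ring
  · have h1 := (frac_bound T d (mem_Icc.mp hd).1).2
    calc _ = (b d:ℝ) * (T/d) := by ring
      _ ≤ _ := by gcongr

lemma eta_bounds (bp bn : ℕ → ℕ) (T k e : ℕ) (hT : 0 < T)
    (h : Nat.ble (bsum (fun d => bp d * (T/d+1)) k 1) (bsum (fun d => bn d * (T/d)) k 1) = true)
    (h' : Nat.ble (bsum (fun d => bn d * (T/d+1)) k 1) (bsum (fun d => bp d * (T/d)) k 1 + e) = true) :
    0 ≤ ∑ d ∈ Icc 1 (2^k), ((bn d:ℝ) - bp d)/d ∧ ∑ d ∈ Icc 1 (2^k), ((bn d:ℝ) - bp d)/d ≤ e / T := by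
  rw [Nat.ble_eq] at h h'
  have a := inv_bounds bp T k
  have b := inv_bounds bn T k
  have hT0 : (0:ℝ) < T := by exact_mod_cast hT
  have h3 : (bsum (fun d => bp d * (T/d+1)) k 1 : ℝ) ≤ bsum (fun d => bn d * (T/d)) k 1 := by exact_mod_cast h
  have h4 : (bsum (fun d => bn d * (T/d+1)) k 1 : ℝ) ≤ bsum (fun d => bp d * (T/d)) k 1 + e := by exact_mod_cast h'
  have : ∑ d ∈ Icc 1 (2^k), ((bn d:ℝ) - bp d)/d =
    ∑ d ∈ Icc 1 (2^k), (bn d:ℝ)/d - ∑ d ∈ Icc 1 (2^k), (bp d:ℝ)/d := by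
    rw [← Finset.sum_sub_distrib]
    refine Finset.sum_congr rfl fun d _ => by ring
  rw [this, le_div_iff₀ hT0]
  constructor
  · by_contra hcon
    push Not at hcon
    nlinarith
  · linarith

end Elem

/-! part L1 -/

namespace Elem

def mP : ℕ := 848059278070702080112360047233102153282335016059972158463096651349217145548518262150524795399457866772584150781462882938275596431655567986322233971606041866921995397452705481432043466844280937034213852913387226778361914702062671559416607787086482118611524566682153569044528278210678396951950415530708088937206417729380582802709667170142509608732815637484464052615745586400018316707234432178930670551952441956810734824744047303411075748157066607902608468334665358283994707102057538
def mQ : ℕ := 3339339435532006285538166315491015654469112847192924284516461755106886724311115044826489753105020996143828945585525846767861896184093261969051505822133632251885249046717155959366662775474474872291740793586364247311276736352155089267139431052146497661803094021577169122645822663315781685143457308257444642719394414501048570601393119590810115080401577223938325666552642314419021445426051081457378104779864526324444810954719320761321768514181964018057262528256291903509374559725740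
def bp1 (d : ℕ) : ℕ := 12 * (mP / 2^d % 2) + (if d = 1594 then 5 else 0)
def bn1 (d : ℕ) : ℕ := 12 * (mQ / 2^d % 2)
def L1 : List (ℕ × ℕ) := [(1822,7), (1839,36), (1941,48), (1969,36), (2051,12), (2201,36), (2654,12), (3295,7), (7496,2), (14363,11), (28490,8), (37305,25), (107665,32), (204389,37)]

theorem check1_0 : laneCheck 14 1 79700 11 12 bp1 bn1 L1 = true := by decide +kernel
theorem check1_1 : laneCheck 14 79701 79700 11 12 bp1 bn1 L1 = true := by decide +kernel
theorem check1_2 : laneCheck 14 159401 79700 11 12 bp1 bn1 L1 = true := by decide +kernel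
theorem check1_3 : laneCheck 14 239101 79700 11 12 bp1 bn1 L1 = true := by decide +kernel

end Elem

/-! part P23 -/

namespace Elem
open Finset

noncomputable def sW : List (ℕ × ℕ) → ℝ
  | [] => 0
  | s :: L => (s.2 : ℝ) / s.1 + sW L

lemma sP_le (K : ℝ) (hK0 : 0 ≤ K) (X : ℕ) (L : List (ℕ × ℕ))
    (hK : ∀ s ∈ L, Chebyshev.psi ((X / s.1 : ℕ):ℝ) ≤ K * ((X / s.1 : ℕ):ℝ)) :
    sP L X ≤ K * X * sW L := by
  induction L with
  | nil => simp [sP, sW]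
  | cons s L ih =>
    have h1 := ih (fun t ht => hK t (List.mem_cons_of_mem _ ht))
    have h2 := hK s List.mem_cons_self
    have h3 : ((X / s.1 : ℕ):ℝ) ≤ (X:ℝ) / s.1 := Nat.cast_div_le
    simp only [sP, sW]
    have h4 : (s.2:ℝ) * Chebyshev.psi ((X / s.1 : ℕ):ℝ) ≤ s.2 * (K * ((X:ℝ) / s.1)) := by
      gcongr
      exact h2.trans (by gcongr)
    calc _ ≤ s.2 * (K * ((X:ℝ) / s.1)) + K * X * sW L := add_le_add h4 h1
      _ = _ := by ring

lemma lane_ok (bp bn : ℕ → ℕ) (k N P Q : ℕ) (e : ℕ) (hP : ∑ d ∈ Icc 1 (2^k), bp d = P) (hQ : ∑ d ∈ Icc 1 (2^k), bn d = Q)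
    (h0 : 0 ≤ ∑ d ∈ Icc 1 (2^k), ((bn d:ℝ) - bp d)/d)
    (h1 : N * ∑ d ∈ Icc 1 (2^k), ((bn d:ℝ) - bp d)/d ≤ e) (m : ℕ) (hm : m ≤ N) :
    (∑ d ∈ Icc 1 (2^k), bn d * (m/d) ≤ ∑ d ∈ Icc 1 (2^k), bp d * (m/d) + (P + e)) ∧
    (∑ d ∈ Icc 1 (2^k), bp d * (m/d) ≤ ∑ d ∈ Icc 1 (2^k), bn d * (m/d) + Q) := by
  obtain ⟨a, b⟩ := F_bounds (2^k) bp bn m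
  set η := ∑ d ∈ Icc 1 (2^k), ((bn d:ℝ) - bp d)/d
  have hm' : (m:ℝ) ≤ N := by exact_mod_cast hm
  have h2 : m * η ≤ e := le_trans (by gcongr) h1
  have h3 : 0 ≤ m * η := by positivity
  have hP' : ∑ d ∈ Icc 1 (2^k), (bp d:ℝ) = P := by exact_mod_cast hP
  have hQ' : ∑ d ∈ Icc 1 (2^k), (bn d:ℝ) = Q := by exact_mod_cast hQ
  rw [hQ'] at a
  rw [hP'] at b
  constructor
  · have : ((∑ d ∈ Icc 1 (2^k), bn d * (m/d) : ℕ):ℝ) ≤ ((∑ d ∈ Icc 1 (2^k), bp d * (m/d) + (P + e) : ℕ):ℝ) := by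
      push_cast
      linarith
    exact_mod_cast this
  · have : ((∑ d ∈ Icc 1 (2^k), bp d * (m/d) : ℕ):ℝ) ≤ ((∑ d ∈ Icc 1 (2^k), bn d * (m/d) + Q : ℕ):ℝ) := by
      push_cast
      linarith
    exact_mod_cast this

/-! ### first instance: Chebyshev -/

def bp0 (d : ℕ) : ℕ := if d = 1 then 1 else if d = 30 then 1 else 0
def bn0 (d : ℕ) : ℕ := if d = 2 then 1 else if d = 3 then 1 else if d = 5 then 1 else 0
def L0 : List (ℕ × ℕ) := [(6,1)]
def L0f : List (ℕ × ℕ) := [(6,1), (30000,3)]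

theorem check0 : laneCheck 4 1 30000 5 1 bp0 bn0 L0 = true := by decide +kernel

lemma eta0 : ∑ d ∈ Icc 1 (2^5), ((bn0 d:ℝ) - bp0 d)/d = 0 := by
  rw [show Icc 1 (2^5) = (range 33).erase 0 by decide]
  rw [Finset.sum_erase _ (by simp)]
  simp only [Finset.sum_range_succ, Finset.sum_range_zero, bn0, bp0]
  norm_num

lemma A0 : ∑ d ∈ Icc 1 (2^5), ((bn0 d:ℝ) - bp0 d)/d * Real.log d ≤ ((9214:ℕ):ℝ) * 10^20 / (10^24 : ℕ) := by
  have := A_bound bp0 bn0 (10^24) 5 (9214*10^20) (by norm_num) (by decide +kernel)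
  exact_mod_cast this

lemma cheb0 (X : ℕ) (hX : 32 ≤ X) :
    Chebyshev.psi X ≤ 0.9214 * X + 6 * (Real.log X + 1) + sP L0f X := by
  have hP : ∑ d ∈ Icc 1 (2^5), bp0 d = 2 := by rw [← bsum_Icc]; decide +kernel
  have hQ : ∑ d ∈ Icc 1 (2^5), bn0 d = 3 := by rw [← bsum_Icc]; decide +kernel
  have hl := lane_ok bp0 bn0 5 30001 2 3 0 hP hQ eta0.ge (by rw [eta0]; simp)
  have g := generic2 (2^5) 30000 1 (by norm_num) bp0 bn0 L0f (by decide +kernel) eta0.ge (by rw [eta0]; norm_num)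
    (by
      intro m h1 h2
      have := lane 4 1 30000 5 1 2 3 le_rfl (by norm_num) (by norm_num) bp0 bn0 L0 (by norm_num) (by decide +kernel)
        (fun m hm => (hl m (by omega)).1) (fun m hm => (hl m (by omega)).2) check0 m h1 (by omega)
      have h3 : sS L0f m = sS L0 m := by simp [sS, L0, L0f]; omega
      rw [h3]; exact this)
    (by rw [hP]; decide +kernel) X (by omega)
  have hP' : ∑ d ∈ Icc 1 (2^5), (bp0 d:ℝ) = 2 := by exact_mod_cast hP
  have hQ' : ∑ d ∈ Icc 1 (2^5), (bn0 d:ℝ) = 3 := by exact_mod_cast hQ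
  rw [Finset.sum_add_distrib, hP', hQ'] at g
  have hA : (∑ d ∈ Icc 1 (2^5), ((bn0 d:ℝ) - bp0 d)/d * Real.log d) * X ≤ 0.9214 * X := by
    gcongr
    refine A0.trans ?_
    norm_num
  norm_num at g ⊢
  norm_num at hA
  linarith

/-! ### second instance -/

def L1f : List (ℕ × ℕ) := [(1822,7), (1839,36), (1941,48), (1969,36), (2051,12), (2201,36), (2654,12), (3295,7), (7496,2), (14363,11), (28490,8), (37305,25), (107665,32), (204389,37), (318800,5529)]

lemma A1 : ∑ d ∈ Icc 1 (2^11), ((bn1 d:ℝ) - bp1 d)/d * Real.log d ≤ (120065 * 10^20 : ℕ) / (10^24 : ℕ) :=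
  A_bound bp1 bn1 (10^24) 11 (120065*10^20) (by norm_num) (by decide +kernel)

lemma eta1 : 0 ≤ ∑ d ∈ Icc 1 (2^11), ((bn1 d:ℝ) - bp1 d)/d ∧
    ∑ d ∈ Icc 1 (2^11), ((bn1 d:ℝ) - bp1 d)/d ≤ (5790 * 10^16 : ℕ) / (10^24 : ℕ) :=
  eta_bounds bp1 bn1 (10^24) 11 (5790 * 10^16) (by norm_num) (by decide +kernel) (by decide +kernel)

lemma main1 (X : ℕ) (hX : 2048 ≤ X) :
    12 * Chebyshev.psi X ≤ 12.0065 * X + 11682 * (Real.log X + 1) + sP L1f X := by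
  have hP : ∑ d ∈ Icc 1 (2^11), bp1 d = 5825 := by rw [← bsum_Icc]; decide +kernel
  have hQ : ∑ d ∈ Icc 1 (2^11), bn1 d = 5856 := by rw [← bsum_Icc]; decide +kernel
  obtain ⟨e0, e1⟩ := eta1
  have hl := lane_ok bp1 bn1 11 318801 5825 5856 19 hP hQ e0
    (by
      calc _ ≤ ((318801:ℕ):ℝ) * ((5790 * 10^16 : ℕ) / (10^24 : ℕ)) := by gcongr
        _ ≤ _ := by norm_num)
  have hlo : ∀ r, r + 79700 ≤ 318801 → ∀ m, m < r + 79700 → _ := fun r hr m hm => (hl m (by omega)).1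
  have hhi : ∀ r, r + 79700 ≤ 318801 → ∀ m, m < r + 79700 → _ := fun r hr m hm => (hl m (by omega)).2
  have ln : ∀ r, r + 79700 ≤ 318801 → laneCheck 14 r 79700 11 12 bp1 bn1 L1 = true → ∀ m, r ≤ m → m < r + 79700 → _ :=
    fun r hr hc => lane 14 r 79700 11 12 5844 5856 (by norm_num) (by norm_num) (by norm_num) bp1 bn1 L1
      (by norm_num) (by decide +kernel) (hlo r hr) (hhi r hr) hc
  have g := generic2 (2^11) 318800 12 (by norm_num) bp1 bn1 L1f (by decide +kernel) e0
    (by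
      calc _ ≤ ((2^11:ℕ):ℝ) * ((5790 * 10^16 : ℕ) / (10^24 : ℕ)) := by gcongr
        _ ≤ _ := by norm_num)
    (by
      intro m h1 h2
      have h3 : sS L1f m = sS L1 m := by
        simp only [sS, L1, L1f]; rw [if_neg (by omega : ¬ 318800 ≤ m)]
      rw [h3]
      rcases lt_or_ge m 79701 with h | h
      · exact ln 1 (by norm_num) check1_0 m h1 (by omega)
      rcases lt_or_ge m 159401 with h' | h'
      · exact ln 79701 (by norm_num) check1_1 m h (by omega)
      rcases lt_or_ge m 239101 with h'' | h''
      · exact ln 159401 (by norm_num) check1_2 m h' (by omega)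
      · exact ln 239101 (by norm_num) check1_3 m h'' (by omega))
    (by rw [hP]; decide +kernel) X (by omega)
  have hP' : ∑ d ∈ Icc 1 (2^11), (bp1 d:ℝ) = 5825 := by exact_mod_cast hP
  have hQ' : ∑ d ∈ Icc 1 (2^11), (bn1 d:ℝ) = 5856 := by exact_mod_cast hQ
  rw [Finset.sum_add_distrib, hP', hQ'] at g
  have hA : (∑ d ∈ Icc 1 (2^11), ((bn1 d:ℝ) - bp1 d)/d * Real.log d) * X ≤ 12.0065 * X := by
    gcongr
    refine A1.trans ?_
    norm_num
  have e : ((5825:ℝ) + 5856 + 1) = 11682 := by norm_num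
  rw [e] at g
  calc _ = ((12:ℕ):ℝ) * Chebyshev.psi X := by norm_num
    _ ≤ _ := g
    _ ≤ _ := by gcongr

end Elem

/-! part P24 -/

namespace Elem
open Finset

def lcmT : ℕ → ℕ → ℕ
  | 0, lo => lo
  | k+1, lo => Nat.lcm (lcmT k lo) (lcmT k (lo + 2^k))

lemma lcmT_dvd (k lo m : ℕ) (h1 : lo ≤ m) (h2 : m < lo + 2^k) : m ∣ lcmT k lo := by
  induction k generalizing lo with
  | zero => simp at h2; rw [lcmT, show m = lo by omega]
  | succ k ih =>
    rw [lcmT]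
    rcases lt_or_ge m (lo + 2^k) with h | h
    · exact (ih lo h1 h).trans (Nat.dvd_lcm_left _ _)
    · exact (ih _ h (by rw [pow_succ] at h2; omega)).trans (Nat.dvd_lcm_right _ _)

lemma lcmT_pos (k lo : ℕ) (h : 0 < lo) : 0 < lcmT k lo := by
  induction k generalizing lo with
  | zero => simpa [lcmT]
  | succ k ih => exact Nat.lcm_pos (ih lo h) (ih _ (Nat.add_pos_left h _))

def chk3 : List ℕ → ℕ → ℕ → Bool
  | [], _, _ => true
  | k :: ks, c, L => force (Nat.lcm L (lcmT k (c+1))) fun L' => force (c + 2^k) fun c' =>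
      Nat.ble L' (3^(c+1)) && chk3 ks c' L'

def endc : List ℕ → ℕ → ℕ
  | [], c => c
  | k :: ks, c => endc ks (c + 2^k)

lemma chk3_ok (ks : List ℕ) (c L : ℕ) (hL : 0 < L) (hd : Nat.lcmUpto c ∣ L) (h : chk3 ks c L = true)
    (m : ℕ) (h1 : c < m) (h2 : m ≤ endc ks c) : Nat.lcmUpto m ≤ 3^m := by
  induction ks generalizing c L with
  | nil => simp [endc] at h2; omega
  | cons k ks ih =>
    simp only [chk3, force_eq, Bool.and_eq_true, Nat.ble_eq] at h
    have hp : 0 < Nat.lcm L (lcmT k (c+1)) := Nat.lcm_pos hL (lcmT_pos k _ (by omega))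
    have hall : ∀ m, m ≤ c + 2^k → Nat.lcmUpto m ∣ Nat.lcm L (lcmT k (c+1)) := by
      intro m hm
      rw [Nat.lcmUpto]
      apply Finset.lcm_dvd
      intro b hb
      rw [Finset.mem_Icc] at hb
      rcases le_or_gt b c with h | h
      · refine dvd_trans ?_ (hd.trans (Nat.dvd_lcm_left _ _))
        rw [Nat.lcmUpto]
        exact Finset.dvd_lcm (f := id) (Finset.mem_Icc.mpr ⟨hb.1, h⟩)
      · exact (lcmT_dvd k (c+1) b (by omega) (by omega)).trans (Nat.dvd_lcm_right _ _)
    rcases le_or_gt m (c + 2^k) with h3 | h3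
    · calc _ ≤ _ := Nat.le_of_dvd hp (hall m h3)
        _ ≤ 3^(c+1) := h.1
        _ ≤ 3^m := Nat.pow_le_pow_right (by norm_num) h1
    · exact ih (c+2^k) _ hp (hall _ le_rfl) h.2 h3 h2

def ks3 : List ℕ := [1, 1, 1, 1, 1, 1, 2, 1, 2, 2, 2, 2, 2, 2, 2, 2, 3, 3, 2, 3, 3, 3, 3, 3, 4, 3, 4, 4, 3, 4, 4, 4, 4, 4, 4, 4, 4, 5, 5, 5, 5, 5, 5, 5, 5, 5, 5, 5, 6, 6, 6, 6, 6, 6, 6, 6, 6, 7, 7, 7, 7, 7, 7, 7, 7, 7, 8, 7, 8, 8, 8, 8, 8, 8, 8, 8, 8, 8, 9, 9, 9, 9, 9, 9, 9, 9, 9, 9, 10, 10, 10, 10, 10, 10, 10, 10, 10, 10]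

theorem chk3_run : chk3 ks3 0 1 = true := by decide +kernel

lemma psi_small (m : ℕ) (hm : m ≤ 20000) : Chebyshev.psi m ≤ 1.11 * m := by
  rcases Nat.eq_zero_or_pos m with rfl | h0
  · simp [Chebyshev.psi]
  have h := chk3_ok ks3 0 1 one_pos (by simp [Nat.lcmUpto]) chk3_run m h0
    (hm.trans (by decide +kernel))
  rw [Chebyshev.psi_eq_log_lcmUpto]
  have hp : (0:ℝ) < Nat.lcmUpto m := by exact_mod_cast Nat.lcmUpto_pos m
  have h2 : (Nat.lcmUpto m:ℝ) ≤ 3^m := by exact_mod_cast h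
  calc _ ≤ Real.log ((3:ℝ)^m) := Real.log_le_log hp h2
    _ = m * Real.log 3 := by rw [Real.log_pow]
    _ ≤ m * 1.11 := by gcongr; linarith [ZetaXi.log3_le]
    _ = _ := by ring

lemma log_tangent (x : ℝ) (hx : 0 < x) : Real.log x ≤ 10 - 1 + x / Real.exp 10 := by
  have := Real.add_one_le_exp (Real.log x - 10)
  rw [Real.exp_sub, Real.exp_log hx] at this
  linarith

lemma exp10 : (22000:ℝ) ≤ Real.exp 10 := by
  have h : Real.exp 10 = (Real.exp 1)^10 := by rw [← Real.exp_nat_mul]; norm_num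
  rw [h]
  calc (22000:ℝ) ≤ 2.718^10 := by norm_num
    _ ≤ _ := by gcongr; linarith [Real.exp_one_gt_d9]

theorem psi_nat_le (X : ℕ) : Chebyshev.psi X ≤ 1.11 * X := by
  induction X using Nat.strong_induction_on with
  | _ X ih =>
  rcases le_or_gt X 20000 with h | h
  · exact psi_small X h
  have h1 := cheb0 X (by omega)
  have h2 := sP_le 1.11 (by norm_num) X L0f (by
    intro s hs
    apply ih
    apply Nat.div_lt_self (by omega)
    simp [L0f] at hs
    rcases hs with rfl | rfl <;> norm_num)
  have hX : (20000:ℝ) ≤ X := by exact_mod_cast h.le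
  have h3 : sW L0f = 1/6 + (3/30000 + 0) := by simp [sW, L0f]
  rw [h3] at h2
  have h4 := log_tangent X (by linarith)
  have h5 : (X:ℝ) / Real.exp 10 ≤ X / 22000 := by gcongr; exact exp10
  norm_num at h1 h2 h4 h5 ⊢
  linarith

theorem psi_real_le (x : ℝ) (hx : 0 ≤ x) : Chebyshev.psi x ≤ 1.11 * x := by
  rw [Chebyshev.psi_eq_psi_coe_floor]
  exact (psi_nat_le _).trans (by gcongr; exact Nat.floor_le hx)

theorem psi_nat_main (X : ℕ) (hX : 2048 ≤ X) :
    Chebyshev.psi X ≤ 1.0112 * X + 974 * (Real.log X + 1) := by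
  have h1 := main1 X hX
  have h2 := sP_le 1.11 (by norm_num) X L1f (fun s _ => psi_nat_le _)
  have h3 : sW L1f ≤ 0.1151 := by
    simp only [sW, L1f]; norm_num
  have h0 : (0:ℝ) ≤ X := by positivity
  have h4 : 1.11 * X * sW L1f ≤ 1.11 * X * 0.1151 := by gcongr
  have h5 : 0 ≤ Real.log X := Real.log_natCast_nonneg X
  norm_num at *
  linarith

theorem psi_real_main (x : ℝ) (hx : 2048 ≤ x) :
    Chebyshev.psi x ≤ 1.0112 * x + 974 * (Real.log x + 1) := by
  rw [Chebyshev.psi_eq_psi_coe_floor]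
  have h2 : 2048 ≤ ⌊x⌋₊ := Nat.le_floor (by exact_mod_cast hx)
  have h3 : (⌊x⌋₊:ℝ) ≤ x := Nat.floor_le (by linarith)
  have h4 : (0:ℝ) < ⌊x⌋₊ := by
    have : 0 < ⌊x⌋₊ := by omega
    exact_mod_cast this
  refine (psi_nat_main _ h2).trans ?_
  gcongr

end Elem

/-! part P80 -/

namespace Direct

def M403 : ℕ := 40786437068665554814618971683922828694582892964708884701862361274616519644579867220074319283900539893834048687270253154873138028145776983601098265140488742774844290

theorem M403_dvd : M403 ∣ Nat.factorial 403 := by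
  rw [Nat.dvd_iff_mod_eq_zero]; decide +kernel

/-- number of integers in a dyadic interval coprime to `M` -/
def cop (M : ℕ) : ℕ → ℕ → ℕ
  | 0, lo => 1 - (Nat.gcd M lo - 1)
  | k+1, lo => cop M k lo + cop M k (lo + 2^k)

def Mof (c : ℕ) : ℕ := if c < 512 then 30030 else M403

lemma Mof_prime (c q : ℕ) (hc : 13 ≤ c) (hq : q.Prime) (h : c < q) : Nat.gcd (Mof c) q = 1 := by
  rw [Nat.gcd_comm]
  refine (Nat.Prime.coprime_iff_not_dvd hq).mpr fun hd => ?_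
  unfold Mof at hd
  split_ifs at hd with h1
  · have h2 : q ∣ Nat.factorial 13 := hd.trans (by decide +kernel)
    rw [Nat.Prime.dvd_factorial hq] at h2
    omega
  · have h2 := hd.trans M403_dvd
    rw [Nat.Prime.dvd_factorial hq] at h2
    omega

lemma count_cop (M k lo : ℕ) (h : ∀ q, q.Prime → lo ≤ q → Nat.gcd M q = 1) :
    Nat.count Nat.Prime (lo + 2^k) ≤ Nat.count Nat.Prime lo + cop M k lo := by
  induction k generalizing lo with
  | zero =>
    simp only [pow_zero, cop, Nat.count_succ]
    split_ifs with hp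
    · rw [h lo hp le_rfl]
    · omega
  | succ k ih =>
    have h1 := ih lo h
    have h2 := ih (lo + 2^k) (fun q hq hl => h q hq (le_trans (Nat.le_add_right _ _) hl))
    rw [cop, pow_succ, mul_two, ← add_assoc]
    omega

/-- evaluate a natural number before passing it on -/
def force {α : Type} (n : ℕ) (k : ℕ → α) : α := Nat.rec (k 0) (fun m _ => k (m + 1)) n

lemma force_eq {α : Type} (n : ℕ) (k : ℕ → α) : force n k = k n := by
  cases n <;> rfl

def chk : List ℕ → ℕ → ℕ → Bool
  | [], _, _ => true
  | k :: ks, c, N => force (N + cop (Mof c) k (c+1)) fun N' => force (c + 2^k) fun c' =>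
      Nat.ble (N'^N' * 7^(c+1)) (19^(c+1)) && chk ks c' N'

def endc : List ℕ → ℕ → ℕ
  | [], c => c
  | k :: ks, c => endc ks (c + 2^k)

lemma log197 : Real.log (19/7) ≤ 1 := by
  rw [Real.log_le_iff_le_exp (by norm_num)]
  have := Real.exp_one_gt_d9
  norm_num at *
  linarith

lemma mul_log_mono {a b : ℕ} (h : a ≤ b) : (a:ℝ) * Real.log a ≤ b * Real.log b := by
  rcases Nat.eq_zero_or_pos a with rfl | h0
  · simp; exact mul_nonneg (by positivity) (Real.log_natCast_nonneg b)
  have h1 : (a:ℝ) ≤ b := by exact_mod_cast h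
  have h2 : (0:ℝ) < a := by exact_mod_cast h0
  have h3 := Real.log_natCast_nonneg a
  gcongr

lemma pow_log {N b : ℕ} (h : N^N * 7^b ≤ 19^b) : (N:ℝ) * Real.log N ≤ b := by
  rcases Nat.eq_zero_or_pos N with rfl | h0
  · simp
  have h1 : (N:ℝ)^N ≤ (19/7)^b := by
    rw [div_pow, le_div_iff₀ (by positivity)]
    exact_mod_cast h
  have h2 : (0:ℝ) < N := by exact_mod_cast h0
  have h3 := Real.log_le_log (by positivity) h1
  rw [Real.log_pow, Real.log_pow] at h3
  have h4 : (b:ℝ) * Real.log (19/7) ≤ b * 1 := by gcongr; exact log197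
  linarith

lemma chk_ok (ks : List ℕ) (c N : ℕ) (hc : 13 ≤ c) (hN : Nat.primeCounting c ≤ N) (h : chk ks c N = true)
    (m : ℕ) (h1 : c < m) (h2 : m ≤ endc ks c) :
    (Nat.primeCounting m : ℝ) * Real.log (Nat.primeCounting m) ≤ m := by
  induction ks generalizing c N with
  | nil => simp [endc] at h2; omega
  | cons k ks ih =>
    simp only [chk, force_eq, Bool.and_eq_true, Nat.ble_eq] at h
    have hcount : Nat.primeCounting (c + 2^k) ≤ N + cop (Mof c) k (c+1) := by
      have := count_cop (Mof c) k (c+1) (fun q hq hl => Mof_prime c q hc hq (by omega))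
      have e : Nat.primeCounting (c + 2^k) = Nat.count Nat.Prime (c + 1 + 2^k) := by
        rw [Nat.primeCounting, Nat.primeCounting']; congr 1; ring
      rw [e]
      rw [Nat.primeCounting, Nat.primeCounting'] at hN
      omega
    rcases le_or_gt m (c + 2^k) with h3 | h3
    · have a := pow_log h.1
      have b := mul_log_mono ((Nat.monotone_primeCounting h3).trans hcount)
      have d : ((c+1:ℕ):ℝ) ≤ m := by exact_mod_cast h1
      linarith
    · exact ih (c+2^k) _ (hc.trans (Nat.le_add_right _ _)) hcount h.2 h3 h2

def ks : List ℕ := [2, 3, 3, 2, 3, 3, 3, 3, 4, 3, 3, 4, 4, 4, 4, 4, 5, 5, 5, 5, 5, 5, 5, 5, 5, 5, 5, 5, 5, 5, 5, 5, 5, 6, 6, 6, 6, 6, 6, 6, 6, 7, 7, 7, 7, 7, 7, 8, 8, 8, 8, 8, 8, 8, 8, 9, 9, 9, 9, 9, 9, 9, 10, 10, 10, 10, 10, 10, 10, 10, 11, 11, 11, 11, 11, 11, 11, 12, 12, 12, 12, 12, 12, 12, 12, 13, 13, 13, 13, 13, 13, 13, 13, 14, 14, 14]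

theorem chk_run : chk ks 16 6 = true := by decide +kernel

theorem direct (m : ℕ) (h1 : 17 ≤ m) (h2 : m ≤ 177624) :
    (Nat.primeCounting m : ℝ) * Real.log (Nat.primeCounting m) ≤ m :=
  chk_ok ks 16 6 (by norm_num) (by decide +kernel) chk_run m (by omega) (h2.trans (by decide +kernel))

end Direct

/-! part P81 -/

namespace Rosser

open intervalIntegral MeasureTheory

lemma li_seg (a b c : ℝ) (ha : 2 < a) (hab : a ≤ b) (hc : 1 ≤ c * (1 - 2/a)) (hc0 : 0 ≤ c) :
    ∫ t in (Real.exp a)..(Real.exp b), 1 / Real.log t ^ 2 ≤ c * (Real.exp b / b^2 - Real.exp a / a^2) := by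
  have hea : (1:ℝ) < Real.exp a := Real.one_lt_exp_iff.mpr (by linarith)
  have heb : (1:ℝ) < Real.exp b := Real.one_lt_exp_iff.mpr (by linarith)
  have hle : Real.exp a ≤ Real.exp b := Real.exp_le_exp.mpr hab
  have hmem : ∀ x ∈ Set.Icc (Real.exp a) (Real.exp b), a ≤ Real.log x ∧ 0 < x := by
    intro x hx
    have hx0 : 0 < x := (Real.exp_pos a).trans_le hx.1
    exact ⟨(Real.le_log_iff_exp_le hx0).mpr hx.1, hx0⟩
  have hder : ∀ x ∈ Set.uIcc (Real.exp a) (Real.exp b),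
      HasDerivAt (fun x => c * (x / Real.log x ^ 2)) (c * (1 / Real.log x ^ 2 - 2 / Real.log x ^ 3)) x := by
    intro x hx
    rw [Set.uIcc_of_le hle] at hx
    obtain ⟨h1, h2⟩ := hmem x hx
    have h3 : Real.log x ≠ 0 := by linarith
    have := ((hasDerivAt_id x).div ((Real.hasDerivAt_log h2.ne').pow 2) (pow_ne_zero 2 h3)).const_mul c
    refine HasDerivAt.congr_deriv (f := fun x => c * (x / Real.log x ^ 2)) this ?_
    simp only [Pi.pow_apply, id]
    norm_num
    field_simp
    simp
  have hint : IntervalIntegrable (fun x => c * (1 / Real.log x ^ 2 - 2 / Real.log x ^ 3)) volume (Real.exp a) (Real.exp b) := by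
    apply ContinuousOn.intervalIntegrable
    rw [Set.uIcc_of_le hle]
    intro x hx
    obtain ⟨h1, h2⟩ := hmem x hx
    have h3 : Real.log x ≠ 0 := by linarith
    have h4 : ContinuousAt Real.log x := Real.continuousAt_log h2.ne'
    apply ContinuousAt.continuousWithinAt
    exact continuousAt_const.mul ((continuousAt_const.div (h4.pow 2) (pow_ne_zero 2 h3)).sub
      (continuousAt_const.div (h4.pow 3) (pow_ne_zero 3 h3)))
  have hf := integral_eq_sub_of_hasDerivAt hder hint
  calc _ ≤ ∫ x in (Real.exp a)..(Real.exp b), c * (1 / Real.log x ^ 2 - 2 / Real.log x ^ 3) := by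
        apply integral_mono_on hle (Chebyshev.intervalIntegrable_one_div_log_sq hea heb) hint
        intro x hx
        obtain ⟨h1, h2⟩ := hmem x hx
        have h3 : 0 < Real.log x := by linarith
        have e : c * (1 / Real.log x ^ 2 - 2 / Real.log x ^ 3) = (c * (1 - 2/Real.log x)) * (1 / Real.log x ^ 2) := by
          field_simp
        rw [e]
        have h4 : 2 / Real.log x ≤ 2 / a := by gcongr
        have h5 : 1 ≤ c * (1 - 2/Real.log x) := hc.trans (by gcongr)
        have h6 : 0 ≤ 1 / Real.log x ^ 2 := by positivity
        nlinarith
    _ = _ := by rw [hf]; simp; ring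

lemma li_crude (a b : ℝ) (ha : 1 < a) (hab : a ≤ b) :
    ∫ t in a..b, 1 / Real.log t ^ 2 ≤ (b - a) / Real.log a ^ 2 := by
  have hla : 0 < Real.log a := Real.log_pos ha
  calc _ ≤ ∫ t in a..b, 1 / Real.log a ^ 2 := by
        apply integral_mono_on hab (Chebyshev.intervalIntegrable_one_div_log_sq ha (by linarith)) (by simp)
        intro x hx
        have : Real.log a ≤ Real.log x := Real.log_le_log (by linarith) hx.1
        gcongr
    _ = _ := by simp; ring

lemma exp_nat_bounds : (7.389 ≤ Real.exp 2 ∧ Real.exp 2 ≤ 7.3891) ∧ (54.59 ≤ Real.exp 4 ∧ Real.exp 4 ≤ 54.6) ∧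
    (2980 ≤ Real.exp 8 ∧ Real.exp 8 ≤ 2981.1) ∧ (162700 ≤ Real.exp 12 ∧ Real.exp 12 ≤ 162800) := by
  have h1 := Real.exp_one_gt_d9
  have h2 := Real.exp_one_lt_d9
  have e : ∀ n : ℕ, Real.exp n = (Real.exp 1)^n := fun n => by rw [← Real.exp_nat_mul]; simp
  have lo : ∀ n : ℕ, (2.7182818283:ℝ)^n ≤ Real.exp n := fun n => by rw [e]; gcongr
  have hi : ∀ n : ℕ, Real.exp n ≤ (2.7182818286:ℝ)^n := fun n => by rw [e]; gcongr
  refine ⟨⟨?_, ?_⟩, ⟨?_, ?_⟩, ⟨?_, ?_⟩, ⟨?_, ?_⟩⟩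
  · have := lo 2; norm_num at *; linarith
  · have := hi 2; norm_num at *; linarith
  · have := lo 4; norm_num at *; linarith
  · have := hi 4; norm_num at *; linarith
  · have := lo 8; norm_num at *; linarith
  · have := hi 8; norm_num at *; linarith
  · have := lo 12; norm_num at *; linarith
  · have := hi 12; norm_num at *; linarith

lemma li_bound (u : ℝ) (hu : 12 ≤ u) :
    ∫ t in (2:ℝ)..(Real.exp u), 1 / Real.log t ^ 2 ≤ 1.4 * (Real.exp u / u^2) := by
  obtain ⟨⟨a1, a2⟩, ⟨b1, b2⟩, ⟨c1, c2⟩, ⟨d1, d2⟩⟩ := exp_nat_bounds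
  have ii : ∀ a b : ℝ, 1 < a → 1 < b → IntervalIntegrable (fun t => 1 / Real.log t ^ 2) volume a b :=
    fun a b => Chebyshev.intervalIntegrable_one_div_log_sq
  have hu1 : (1:ℝ) < Real.exp u := Real.one_lt_exp_iff.mpr (by linarith)
  have s1 := integral_add_adjacent_intervals (ii 2 (Real.exp 2) (by norm_num) (by linarith)) (ii (Real.exp 2) (Real.exp 4) (by linarith) (by linarith))
  have s2 := integral_add_adjacent_intervals (ii 2 (Real.exp 4) (by norm_num) (by linarith)) (ii (Real.exp 4) (Real.exp 8) (by linarith) (by linarith))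
  have s3 := integral_add_adjacent_intervals (ii 2 (Real.exp 8) (by norm_num) (by linarith)) (ii (Real.exp 8) (Real.exp 12) (by linarith) (by linarith))
  have s4 := integral_add_adjacent_intervals (ii 2 (Real.exp 12) (by norm_num) (by linarith)) (ii (Real.exp 12) (Real.exp u) (by linarith) hu1)
  have t1 := li_crude 2 (Real.exp 2) (by norm_num) (by linarith)
  have t2 := li_crude (Real.exp 2) (Real.exp 4) (by linarith) (by linarith)
  have t3 := li_seg 4 8 2 (by norm_num) (by norm_num) (by norm_num) (by norm_num)
  have t4 := li_seg 8 12 (4/3) (by norm_num) (by norm_num) (by norm_num) (by norm_num)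
  have t5 := li_seg 12 u 1.4 (by norm_num) hu (by norm_num) (by norm_num)
  rw [Real.log_exp] at t2
  have hl2 := Real.log_two_gt_d9
  have t1' : (Real.exp 2 - 2) / Real.log 2 ^ 2 ≤ 11.3 := by
    rw [div_le_iff₀ (by positivity)]
    nlinarith
  norm_num at *
  linarith

lemma pi_bound (u ε : ℝ) (hu : 12 ≤ u) (h : Chebyshev.psi (Real.exp u) ≤ Real.exp u * (1 + ε)) :
    (Nat.primeCounting ⌊Real.exp u⌋₊ : ℝ) ≤ Real.exp u / u * (1 + (ε + 1.554 / u)) := by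
  have hx2 : (2:ℝ) ≤ Real.exp u := by linarith [Real.add_one_le_exp u]
  rw [Chebyshev.primeCounting_eq_theta_div_log_add_integral hx2, Real.log_exp]
  have h1 : Chebyshev.theta (Real.exp u) / u ≤ Real.exp u * (1 + ε) / u := by
    gcongr; exact (Chebyshev.theta_le_psi _).trans h
  have h2 : ∫ t in (2:ℝ)..(Real.exp u), Chebyshev.theta t / (t * Real.log t ^ 2) ≤
      ∫ t in (2:ℝ)..(Real.exp u), 1.11 * (1 / Real.log t ^ 2) := by
    apply integral_mono_on hx2
    · rw [intervalIntegrable_iff_integrableOn_Icc_of_le hx2]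
      exact Chebyshev.integrableOn_theta_div_id_mul_log_sq _
    · exact (Chebyshev.intervalIntegrable_one_div_log_sq (by norm_num) (by linarith)).const_mul _
    · intro t ht
      have ht0 : 0 < t := by linarith [ht.1]
      have hl : 0 < Real.log t := Real.log_pos (by linarith [ht.1])
      have h3 := (Chebyshev.theta_le_psi t).trans (Elem.psi_real_le t ht0.le)
      calc _ ≤ 1.11 * t / (t * Real.log t ^ 2) := by gcongr
        _ = _ := by field_simp
  rw [intervalIntegral.integral_const_mul] at h2
  have h3 := li_bound u hu
  calc _ ≤ Real.exp u * (1 + ε) / u + 1.11 * (1.4 * (Real.exp u / u^2)) := by linarith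
    _ = _ := by field_simp; ring

lemma concl (u δ : ℝ) (n : ℕ) (hn : 1 ≤ n) (hu : 12 ≤ u) (hδ : 0 ≤ δ) (h : (n:ℝ) ≤ Real.exp u / u * (1 + δ))
    (hc : (1 + δ) * (u - Real.log u + δ) ≤ u) : (n:ℝ) * Real.log n ≤ Real.exp u := by
  have hn0 : (1:ℝ) ≤ n := by exact_mod_cast hn
  have hu0 : 0 < u := by linarith
  have h1 : Real.log n ≤ u - Real.log u + δ := by
    calc _ ≤ Real.log (Real.exp u / u * (1 + δ)) := Real.log_le_log (by linarith) h
      _ = u - Real.log u + Real.log (1 + δ) := by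
        rw [Real.log_mul (by positivity) (by positivity), Real.log_div (by positivity) (by positivity), Real.log_exp]
      _ ≤ _ := by
        have := Real.log_le_sub_one_of_pos (show 0 < 1 + δ by linarith)
        linarith
  have h0 : 0 ≤ Real.log n := Real.log_nonneg hn0
  calc (n:ℝ) * Real.log n ≤ (Real.exp u / u * (1 + δ)) * (u - Real.log u + δ) := by
        gcongr
    _ = Real.exp u / u * ((1 + δ) * (u - Real.log u + δ)) := by ring
    _ ≤ Real.exp u / u * u := by gcongr
    _ = _ := by field_simp

end Rosser

/-! part P82 -/

namespace Rosser

lemma e4u (u : ℝ) (hu : 12 ≤ u) : 974 * (u + 1) * u ≤ 0.934 * Real.exp u := by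
  obtain ⟨_, _, _, ⟨d1, d2⟩⟩ := exp_nat_bounds
  have h : Real.exp u = Real.exp 12 * Real.exp (u - 12) := by rw [← Real.exp_add]; ring_nf
  have h2 := Real.quadratic_le_exp_of_nonneg (show 0 ≤ u - 12 by linarith)
  have h3 : 162700 * (1 + (u-12) + (u-12)^2/2) ≤ Real.exp u := by rw [h]; gcongr
  nlinarith

lemma e4u' (u : ℝ) (hu : 16 ≤ u) : 974 * (u + 1) * u ≤ 0.04 * Real.exp u := by
  obtain ⟨_, ⟨b1, b2⟩, _, ⟨d1, d2⟩⟩ := exp_nat_bounds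
  have h : Real.exp u = Real.exp 12 * Real.exp 4 * Real.exp (u - 16) := by
    rw [← Real.exp_add, ← Real.exp_add]; ring_nf
  have h2 := Real.quadratic_le_exp_of_nonneg (show 0 ≤ u - 16 by linarith)
  have h3 : 162700 * 54.59 * (1 + (u-16) + (u-16)^2/2) ≤ Real.exp u := by rw [h]; gcongr
  nlinarith

lemma e4u'' (u : ℝ) (hu : 40 ≤ u) : 974 * (u + 1) * u ≤ 0.001 * Real.exp u := by
  obtain ⟨_, ⟨b1, b2⟩, _, ⟨d1, d2⟩⟩ := exp_nat_bounds
  have h : Real.exp u = Real.exp 12 * Real.exp 12 * Real.exp (u - 24) := by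
    rw [← Real.exp_add, ← Real.exp_add]; ring_nf
  have h2 := Real.quadratic_le_exp_of_nonneg (show 0 ≤ u - 24 by linarith)
  have h3 : 162700 * 162700 * (1 + (u-24) + (u-24)^2/2) ≤ Real.exp u := by
    have h0 : 0 ≤ 1 + (u-24) + (u-24)^2/2 := by nlinarith
    rw [h]; gcongr
  nlinarith

lemma psi_main_u (u η : ℝ) (hu : 12 ≤ u) (h : 974 * (u + 1) * u ≤ η * Real.exp u) :
    Chebyshev.psi (Real.exp u) ≤ Real.exp u * (1 + (0.0112 + η / u)) := by
  obtain ⟨_, _, _, ⟨d1, d2⟩⟩ := exp_nat_bounds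
  have hx : 162700 ≤ Real.exp u := d1.trans (Real.exp_le_exp.mpr hu)
  have h1 := Elem.psi_real_main (Real.exp u) (by linarith)
  rw [Real.log_exp] at h1
  have h2 : 974 * (u + 1) ≤ Real.exp u * (η / u) := by
    rw [← mul_div_assoc, le_div_iff₀ (by linarith)]; linarith
  linarith

/-- lower bound for the logarithm from an upper bound for the exponential -/
lemma log_lower (u v a : ℝ) (ha : 0 < a) (hu : 0 < u) (h : Real.exp v ≤ a) : v + 1 - a / u ≤ Real.log u := by
  have h1 := Real.one_sub_inv_le_log_of_pos (show 0 < u / a by positivity)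
  rw [Real.log_div hu.ne' ha.ne', inv_div] at h1
  have h2 : v ≤ Real.log a := (Real.le_log_iff_exp_le ha).mpr h
  linarith

lemma exp_rat (k : ℕ) (a : ℝ) (h : (2.7182818286:ℝ)^k ≤ a) : Real.exp k ≤ a := by
  have e : Real.exp k = (Real.exp 1)^k := by rw [← Real.exp_nat_mul]; simp
  rw [e]
  refine le_trans ?_ h
  gcongr
  exact Real.exp_one_lt_d9.le

lemma log400 : 5.9914 ≤ Real.log 400 := by
  have h := log_lower 400 6 403.43 (by norm_num) (by norm_num) (by
    have := exp_rat 6 403.43 (by norm_num)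
    exact_mod_cast this)
  norm_num at *
  linarith

lemma rosser_u (u : ℝ) (n : ℕ) (hu : 12 ≤ u) (hn1 : 1 ≤ n) (hn : n = Nat.primeCounting ⌊Real.exp u⌋₊) :
    (n:ℝ) * Real.log n ≤ Real.exp u := by
  have hu0 : 0 < u := by linarith
  have pb := fun ε => pi_bound u ε hu
  rw [← hn] at pb
  rcases le_or_gt u 16 with h16 | h16
  · have h1 := pb _ (psi_main_u u _ hu (e4u u hu))
    have h2 : (n:ℝ) ≤ Real.exp u / u * (1 + 2.668/u) := by
      refine h1.trans ?_
      have : 0.0112 + 0.934/u + 1.554/u ≤ 2.668/u := by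
        rw [le_div_iff₀ hu0]; field_simp; linarith
      gcongr
    apply concl u _ n hn1 hu (by positivity) h2
    have h3 : 2.48 ≤ Real.log u := by
      have h := log_lower 12 2.5 12.183 (by norm_num) (by norm_num) (by
        have h5 : Real.exp 5 ≤ 12.183^2 := by
          have := exp_rat 5 (12.183^2) (by norm_num)
          exact_mod_cast this
        have h6 : Real.exp 2.5 ^ 2 = Real.exp 5 := by rw [← Real.exp_nat_mul]; norm_num
        rw [← h6] at h5
        exact (sq_le_sq₀ (Real.exp_pos _).le (by norm_num)).mp h5)
      have h4 : Real.log 12 ≤ Real.log u := Real.log_le_log (by norm_num) hu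
      norm_num at *
      linarith
    have h7 : (1 + 2.668/u) * (u - Real.log u + 2.668/u) ≤ (1 + 2.668/u) * (u - 2.48 + 2.668/u) := by gcongr
    refine h7.trans ?_
    have e : (1 + 2.668/u) * (u - 2.48 + 2.668/u) = u + (2.668 - 2.48) + (2.668 - 2.668*2.48)/u + (2.668/u)^2 := by
      field_simp; ring
    rw [e]
    have hz : (2.668/u)^2 ≤ 2.668/u * (2.668/12) := by
      rw [sq]; gcongr
    have hz2 : (1/16:ℝ) ≤ 1/u := by gcongr
    have e2 : (2.668 - 2.668*2.48)/u = (2.668 - 2.668*2.48) * (1/u) := by ring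
    have e3 : 2.668/u = 2.668 * (1/u) := by ring
    rw [e2]; rw [e3] at hz ⊢
    nlinarith
  rcases le_or_gt u 40 with h40 | h40
  · have h1 := pb _ (psi_main_u u _ hu (e4u' u h16.le))
    have h2 : (n:ℝ) ≤ Real.exp u / u * (1 + 2.05/u) := by
      refine h1.trans ?_
      have : 0.0112 + 0.04/u + 1.554/u ≤ 2.05/u := by
        rw [le_div_iff₀ hu0]; field_simp; linarith
      gcongr
    apply concl u _ n hn1 hu (by positivity) h2
    have h3 : 2.5 ≤ Real.log u := by
      have h4 : Real.log 16 ≤ Real.log u := Real.log_le_log (by norm_num) h16.le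
      have h5 : Real.log 16 = 4 * Real.log 2 := by
        rw [show (16:ℝ) = 2^4 by norm_num, Real.log_pow]; norm_num
      have := Real.log_two_gt_d9
      linarith
    have h7 : (1 + 2.05/u) * (u - Real.log u + 2.05/u) ≤ (1 + 2.05/u) * (u - 2.5 + 2.05/u) := by gcongr
    refine h7.trans ?_
    have e : (1 + 2.05/u) * (u - 2.5 + 2.05/u) = u + (2.05 - 2.5) + (2.05 - 2.05*2.5)/u + (2.05/u)^2 := by
      field_simp; ring
    rw [e]
    have hz : 2.05/u ≤ 2.05/16 := by gcongr
    have hz0 : 0 ≤ 2.05/u := by positivity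
    have e2 : (2.05 - 2.05*2.5)/u ≤ 0 := by
      apply div_nonpos_of_nonpos_of_nonneg <;> linarith
    nlinarith
  rcases le_or_gt u 400 with h400 | h400
  · have h1 := pb _ (psi_main_u u _ hu (e4u'' u h40.le))
    have h2 : (n:ℝ) ≤ Real.exp u / u * (1 + (0.0112 + 1.555/u)) := by
      refine h1.trans (le_of_eq ?_)
      ring
    apply concl u _ n hn1 hu (by positivity) h2
    -- chord bound
    have h3 : 3.67 + 0.00644 * (u - 40) ≤ Real.log u := by
      have hl40 : 3.67 ≤ Real.log 40 := by
        have h := log_lower 40 3.5 33.12 (by norm_num) (by norm_num) (by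
          have h5 : Real.exp 7 ≤ 33.12^2 := by
            have := exp_rat 7 (33.12^2) (by norm_num)
            exact_mod_cast this
          have h6 : Real.exp 3.5 ^ 2 = Real.exp 7 := by rw [← Real.exp_nat_mul]; norm_num
          rw [← h6] at h5
          exact (sq_le_sq₀ (Real.exp_pos _).le (by norm_num)).mp h5)
        norm_num at *
        linarith
      have hcc := strictConcaveOn_log_Ioi.concaveOn.2 (show (40:ℝ) ∈ Set.Ioi 0 by norm_num) (show (400:ℝ) ∈ Set.Ioi 0 by norm_num)
        (show 0 ≤ (400 - u)/360 by linarith) (show 0 ≤ (u - 40)/360 by linarith) (by ring)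
      simp only [smul_eq_mul] at hcc
      rw [show (400 - u)/360 * 40 + (u - 40)/360 * 400 = u by ring] at hcc
      have := log400
      nlinarith
    have h7 : (1 + (0.0112 + 1.555/u)) * (u - Real.log u + (0.0112 + 1.555/u)) ≤
      (1 + (0.0112 + 1.555/u)) * (u - (3.67 + 0.00644 * (u - 40)) + (0.0112 + 1.555/u)) := by gcongr
    refine h7.trans ?_
    have hz2 : (1.555/u) ≤ 1.555/40 := by gcongr
    have hz0 : 0 ≤ 1.555/u := by positivity
    have hz1 : 1.555/u * u = 1.555 := by field_simp
    set z := 1.555/u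
    nlinarith
  · have h1 := pb _ (Expl.psi_large h400.le)
    have h2 : (n:ℝ) ≤ Real.exp u / u * (1 + 6.054/u) := by
      refine h1.trans (le_of_eq ?_)
      ring
    apply concl u _ n hn1 hu (by positivity) h2
    have h3 : 5.9914 + 1 - 400/u ≤ Real.log u :=
      log_lower u 5.9914 400 (by norm_num) hu0 ((Real.le_log_iff_exp_le (by norm_num)).mp log400)
    have h7 : (1 + 6.054/u) * (u - Real.log u + 6.054/u) ≤ (1 + 6.054/u) * (u - (5.9914 + 1 - 400/u) + 6.054/u) := by gcongr
    refine h7.trans ?_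
    have hz : 400/u ≤ 1 := by rw [div_le_one hu0]; linarith
    have hz0 : 0 ≤ 400/u := by positivity
    have hz1 : 400/u * u = 400 := by field_simp
    have e3 : 6.054/u = 6.054/400 * (400/u) := by field_simp
    rw [e3]
    set z := 400/u
    nlinarith

theorem rosser (m : ℕ) (hm : 17 ≤ m) : (Nat.primeCounting m : ℝ) * Real.log (Nat.primeCounting m) ≤ m := by
  rcases le_or_gt m 177624 with h | h
  · exact Direct.direct m hm h
  obtain ⟨_, _, _, ⟨d1, d2⟩⟩ := exp_nat_bounds
  have hm0 : (177624:ℝ) ≤ m := by exact_mod_cast h.le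
  have hu : 12 ≤ Real.log m := (Real.le_log_iff_exp_le (by linarith)).mpr (by linarith)
  have hpos : 1 ≤ Nat.primeCounting m := by
    have := Nat.monotone_primeCounting (show 2 ≤ m by omega)
    have h2 : Nat.primeCounting 2 = 1 := by decide +kernel
    omega
  have := rosser_u (Real.log m) (Nat.primeCounting m) hu hpos (by
    rw [Real.exp_log (by linarith), Nat.floor_natCast])
  rwa [Real.exp_log (by linarith)] at this

end Rosser

lemma p_count (n : ℕ) (hn : 1 ≤ n) : Nat.primeCounting (p n) = n := by
  have hp : (p n).Prime := Nat.prime_nth_prime _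
  rw [Nat.primeCounting, Nat.primeCounting', Nat.count_succ, if_pos hp, p, Nat.count_nth_of_infinite Nat.infinite_setOf_prime]
  omega

lemma p_ge (n : ℕ) (hn : 6 < n) : 17 ≤ p n := by
  by_contra h
  push Not at h
  have h1 := p_count n (by omega)
  have h2 := Nat.monotone_primeCounting (show p n ≤ 16 by omega)
  have h3 : Nat.primeCounting 16 = 6 := by decide +kernel
  omega

theorem rosser_p (n : ℕ) (hn : 6 < n) : (n:ℝ) * Real.log n ≤ p n := by
  have := Rosser.rosser (p n) (p_ge n hn)
  rwa [p_count n (by omega)] at this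

theorem sufficient_farhadian' (n : ℕ) (hn : 6 < n)
    (h : g n < (p n : ℝ) *
        (Real.log ((n : ℝ) * Real.log n) + Real.log (Real.log n) -
          Real.log (Real.log ((n : ℝ) * Real.log ((n : ℝ) * Real.log n)))) / n) :
    g n ≤ (p n : ℝ) * (((p n : ℝ) * Real.log n / Real.log (p n)) ^ ((1 : ℝ) / n) - 1) := by
  have hn0 : (7:ℝ) ≤ n := by exact_mod_cast hn
  have hr := rosser_p n hn
  have h17 : (17:ℝ) ≤ p n := by exact_mod_cast p_ge n hn
  generalize (p n : ℝ) = P at *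
  have he : Real.exp 1 ≤ 3 := by linarith [Real.exp_one_lt_d9]
  have hl1 : 1 ≤ Real.log n := (Real.le_log_iff_exp_le (by linarith)).mpr (by linarith)
  set y := (n:ℝ) * Real.log n with hy
  have hyn : (n:ℝ) ≤ y := by rw [hy]; nlinarith
  have hly : Real.log n ≤ Real.log y := Real.log_le_log (by linarith) hyn
  have hlP : Real.log y ≤ Real.log P := Real.log_le_log (by linarith) hr
  have hanti := Real.log_div_self_antitoneOn (show y ∈ {x : ℝ | Real.exp 1 ≤ x} by
      simp only [Set.mem_setOf_eq]; linarith)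
    (show P ∈ {x : ℝ | Real.exp 1 ≤ x} by simp only [Set.mem_setOf_eq]; linarith) hr
  -- log log comparison
  have h1 : Real.log (Real.log y) ≤ Real.log (Real.log ((n:ℝ) * Real.log y)) := by
    apply Real.log_le_log (by linarith)
    apply Real.log_le_log (by linarith)
    rw [hy]; rw [hy] at hly; gcongr
  have h2 : Real.log (Real.log P) - Real.log P ≤ Real.log (Real.log y) - Real.log y := by
    rw [← Real.log_div (by linarith) (by linarith), ← Real.log_div (by linarith) (by linarith)]
    apply Real.log_le_log
    · apply div_pos <;> linarith
    · exact hanti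
  have hP0 : 0 < P := by linarith
  have hLP : 0 < Real.log P := by linarith
  have ha : 0 < P * Real.log n / Real.log P := by
    apply div_pos _ hLP
    apply mul_pos <;> linarith
  have h3 : Real.log (P * Real.log n / Real.log P) = Real.log P + Real.log (Real.log n) - Real.log (Real.log P) := by
    rw [Real.log_div (by apply ne_of_gt; apply mul_pos <;> linarith) (by linarith), Real.log_mul (by linarith) (by linarith)]
  have h4 : Real.log (P * Real.log n / Real.log P) / n ≤ (P * Real.log n / Real.log P) ^ ((1:ℝ)/n) - 1 := by
    rw [Real.rpow_def_of_pos ha]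
    have := Real.add_one_le_exp (Real.log (P * Real.log n / Real.log P) * (1/n))
    have e : Real.log (P * Real.log n / Real.log P) / n = Real.log (P * Real.log n / Real.log P) * (1/n) := by ring
    linarith
  calc g n ≤ _ := h.le
    _ = P * ((Real.log y + Real.log (Real.log n) - Real.log (Real.log ((n:ℝ) * Real.log y))) / n) := by ring
    _ ≤ P * (Real.log (P * Real.log n / Real.log P) / n) := by
      rw [h3]
      gcongr P * (?_ / _)
      linarith
    _ ≤ _ := by gcongr
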